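/- arXiv:1710.01970 — 13 statements merged into one kernel-verified Lean document; each statement's English description precedes it below -/
import Mathlib

section
/- Let f ∈ ℤ[t] be a quadratic polynomial. Then there exists a constant c > 0 such that for every N there exists a polynomial g ∈ ℤ[t] of odd degree k ≥ N (with k ≥ 16, say, so that log log k > 0) for which f(g(t)) factors in ℤ[t] as a product of polynomials each of degree at most c·k/√(log log k). In particular, f admits polysmoothness ε for every ε > 0. -/
open Polynomial

/-- A polynomial `f ∈ ℤ[t]` of positive degree admits polysmoothness `θ` if there exists a
non-constant polynomial `g ∈ ℤ[t]` such that every irreducible factor of `f(g(t))` in `ℤ[t]`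
has degree at most `θ·(deg f)·(deg g)`. -/
def AdmitsPolysmoothness (f : Polynomial ℤ) (θ : ℝ) : Prop :=
  ∃ g : Polynomial ℤ, 0 < g.natDegree ∧
    ∀ q : Polynomial ℤ, Irreducible q → q ∣ f.comp g →
      (q.natDegree : ℝ) ≤ θ * (f.natDegree : ℝ) * (g.natDegree : ℝ)

theorem totient_mul_log_le (n M : ℕ) (hM : M ≠ 0) (h : ∀ p : ℕ, p.Prime → p ≤ n → p ∣ M) :
    (M.totient : ℝ) * Real.log (n + 1) ≤ M := by
  let F : ℕ →* ℝ :=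
    { toFun := fun p => (p : ℝ)⁻¹
      map_one' := by simp
      map_mul' := fun a b => by simp [mul_comm] }
  obtain ⟨-, hsum⟩ := EulerProduct.summable_and_hasSum_factoredNumbers_prod_filter_prime_geometric
    (f := F) (fun {p} hp => by
      simpa [F] using inv_lt_one_of_one_lt₀ (by exact_mod_cast hp.one_lt : (1 : ℝ) < p))
    M.primeFactors
  have hfilter : M.primeFactors.filter Nat.Prime = M.primeFactors :=
    Finset.filter_true_of_mem fun p hp => Nat.prime_of_mem_primeFactors hp
  rw [hfilter] at hsum
  have hmem : ∀ i ∈ Finset.Icc 1 n, i ∈ Nat.factoredNumbers M.primeFactors := by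
    intro i hi
    rw [Finset.mem_Icc] at hi
    rw [Nat.mem_factoredNumbers]
    refine ⟨by lia, fun p hp => ?_⟩
    have hp' := Nat.mem_primeFactorsList (by lia : i ≠ 0) |>.1 hp
    exact Nat.mem_primeFactors.2
      ⟨hp'.1, h p hp'.1 ((Nat.le_of_dvd (by lia) hp'.2).trans hi.2), hM⟩
  have hle : Real.log (n + 1) ≤ ∏ p ∈ M.primeFactors, (1 - (p : ℝ)⁻¹)⁻¹ := by
    have h1 := log_add_one_le_harmonic n
    rw [harmonic_eq_sum_Icc] at h1
    push_cast at h1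
    refine h1.trans ?_
    have h2 := hsum.summable.sum_le_tsum ((Finset.Icc 1 n).attach.map
      ⟨fun i => (⟨i.1, hmem i.1 i.2⟩ : Nat.factoredNumbers M.primeFactors), by
        intro a b hab
        exact Subtype.ext (Subtype.mk.inj hab)⟩) (fun i _ => by simp [F])
    rw [hsum.tsum_eq, Finset.sum_map] at h2
    rw [← Finset.sum_attach]
    exact h2
  have ht : (M.totient : ℝ) = M * ∏ p ∈ M.primeFactors, (1 - (p : ℝ)⁻¹) := by
    have := congrArg (Rat.cast : ℚ → ℝ) (Nat.totient_eq_mul_prod_factors M)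
    push_cast at this
    exact this
  have hpos : 0 < ∏ p ∈ M.primeFactors, (1 - (p : ℝ)⁻¹) := by
    refine Finset.prod_pos fun p hp => sub_pos.2 ?_
    exact inv_lt_one_of_one_lt₀ (by exact_mod_cast (Nat.prime_of_mem_primeFactors hp).one_lt)
  rw [Finset.prod_inv_distrib] at hle
  rw [ht, mul_assoc]
  refine mul_le_of_le_one_right (Nat.cast_nonneg _) ?_
  calc _ ≤ _ := mul_le_mul_of_nonneg_left hle hpos.le
    _ = 1 := mul_inv_cancel₀ hpos.ne'

theorem exists_coprime_totient_le (m : ℕ) (hm : m ≠ 0) (N : ℕ) :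
    ∃ k : ℕ, N ≤ k ∧ 16 ≤ k ∧ k.Coprime m ∧
      (k.totient : ℝ) * Real.sqrt (Real.log (Real.log k)) ≤ 2 * m * k := by
  obtain ⟨n, hn, hnp⟩ := Nat.exists_infinite_primes (N + 16 + m + 1)
  set S := (Finset.range (n + 1)).filter Nat.Prime with hS
  set k := ∏ p ∈ S.filter (fun p => ¬ p ∣ m), p with hk
  have hk0 : k ≠ 0 := Finset.prod_ne_zero_iff.2 fun p hp => by
    simp only [hS, Finset.mem_filter] at hp
    exact hp.1.2.ne_zero
  have hnk : n ≤ k := by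
    refine Nat.le_of_dvd (Nat.pos_of_ne_zero hk0) (Finset.dvd_prod_of_mem _ ?_)
    simp only [hS, Finset.mem_filter, Finset.mem_range]
    exact ⟨⟨by lia, hnp⟩, Nat.not_dvd_of_pos_of_lt (Nat.pos_of_ne_zero hm) (by lia)⟩
  have hcop : k.Coprime m := Nat.Coprime.prod_left fun p hp => by
    simp only [hS, Finset.mem_filter] at hp
    exact (Nat.Prime.coprime_iff_not_dvd hp.1.2).2 hp.2
  have hk4 : k ≤ 4 ^ n := by
    refine le_trans (Nat.le_of_dvd (primorial_pos n) ?_) (primorial_le_four_pow n)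
    exact Finset.prod_dvd_prod_of_subset _ _ _ (Finset.filter_subset _ _)
  refine ⟨k, by lia, by lia, hcop, ?_⟩
  have hmain := totient_mul_log_le n (k * m) (mul_ne_zero hk0 hm) fun p hp hpn => by
    by_cases hpm : p ∣ m
    · exact hpm.mul_left k
    · refine Dvd.dvd.mul_right (Finset.dvd_prod_of_mem _ ?_) m
      simp only [hS, Finset.mem_filter, Finset.mem_range]
      exact ⟨⟨by lia, hp⟩, hpm⟩
  rw [Nat.totient_mul hcop] at hmain
  push_cast at hmain
  have hm1 : (1 : ℝ) ≤ m.totient := by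
    exact_mod_cast Nat.totient_pos.2 (Nat.pos_of_ne_zero hm)
  have hn16 : (16 : ℝ) ≤ n := by exact_mod_cast (by lia : 16 ≤ n)
  have hL : 1 ≤ Real.log (n + 1) := by
    rw [Real.le_log_iff_exp_le (by linarith)]
    linarith [Real.exp_one_lt_d9]
  have hkR : (16 : ℝ) ≤ k := by exact_mod_cast (by lia : 16 ≤ k)
  have hlogk : 0 < Real.log k := Real.log_pos (by linarith)
  have hlog4 : Real.log 4 ≤ 2 := by
    rw [Real.log_le_iff_le_exp (by norm_num)]
    have := Real.add_one_le_exp (1 : ℝ)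
    have h2 : Real.exp 2 = Real.exp 1 * Real.exp 1 := by rw [← Real.exp_add]; norm_num
    rw [h2]; nlinarith
  have hloglog : Real.log (Real.log k) ≤ 2 * Real.log (n + 1) := by
    have h1 : Real.log k ≤ n * Real.log 4 := by
      rw [← Real.log_pow]
      exact Real.log_le_log (by linarith) (by exact_mod_cast hk4)
    have h2 : Real.log k ≤ ((n : ℝ) + 1) ^ 2 := by nlinarith
    have h3 := Real.log_le_log hlogk h2
    rwa [Real.log_pow] at h3
  have hsqrt : Real.sqrt (Real.log (Real.log k)) ≤ 2 * Real.log (n + 1) := by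
    rw [Real.sqrt_le_iff]
    exact ⟨by linarith, by nlinarith⟩
  have hφ : (0 : ℝ) ≤ k.totient := Nat.cast_nonneg _
  have h5 : (k.totient : ℝ) * Real.log (n + 1) ≤ k * m := by
    refine le_trans ?_ hmain
    have := mul_nonneg hφ (by linarith : (0 : ℝ) ≤ Real.log (n + 1))
    nlinarith
  calc _ ≤ (k.totient : ℝ) * (2 * Real.log (n + 1)) := mul_le_mul_of_nonneg_left hsqrt hφ
    _ ≤ _ := by linarith

/-- Coordinates of powers: if `ω ^ 2 + b * ω + d = 0`, then
`(1 + y * ω) ^ j = (powCoords b d y j).1 + y * (powCoords b d y j).2 * ω`. -/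
def powCoords (b d y : ℤ) : ℕ → ℤ × ℤ
  | 0 => (1, 0)
  | j + 1 =>
    ((powCoords b d y j).1 - d * y ^ 2 * (powCoords b d y j).2,
      (powCoords b d y j).2 + (powCoords b d y j).1 - b * y * (powCoords b d y j).2)

theorem one_add_mul_pow_eq {R : Type*} [CommRing R] (b d y : ℤ) (ω : R)
    (hω : ω ^ 2 + b * ω + d = 0) (j : ℕ) :
    (1 + y * ω) ^ j = ((powCoords b d y j).1 : R) + y * (powCoords b d y j).2 * ω := by
  induction j with
  | zero => simp [powCoords]
  | succ j ih =>
    rw [pow_succ, ih]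
    simp only [powCoords]
    push_cast
    linear_combination (y : R) ^ 2 * ((powCoords b d y j).2 : R) * hω

theorem powCoords_norm (b d y : ℤ) (j : ℕ) :
    (powCoords b d y j).1 ^ 2 - b * y * (powCoords b d y j).1 * (powCoords b d y j).2 +
      d * y ^ 2 * (powCoords b d y j).2 ^ 2 = (1 - b * y + d * y ^ 2) ^ j := by
  induction j with
  | zero => simp [powCoords]
  | succ j ih =>
    simp only [powCoords]
    linear_combination (1 - b * y + d * y ^ 2) * ih

theorem dvd_powCoords_fst_sub_one (b d y : ℤ) (j : ℕ) :
    y ^ 2 ∣ (powCoords b d y j).1 - 1 := by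
  induction j with
  | zero => simp [powCoords]
  | succ j ih =>
    obtain ⟨r, hr⟩ := ih
    refine ⟨r - d * (powCoords b d y j).2, ?_⟩
    simp only [powCoords]
    linear_combination hr

theorem dvd_powCoords_snd_sub (b d y : ℤ) (j : ℕ) :
    y ∣ (powCoords b d y j).2 - j := by
  induction j with
  | zero => simp [powCoords]
  | succ j ih =>
    obtain ⟨r, hr⟩ := ih
    obtain ⟨t, ht⟩ := dvd_powCoords_fst_sub_one b d y j
    refine ⟨r + y * t - b * (powCoords b d y j).2, ?_⟩
    simp only [powCoords]
    push_cast
    linear_combination hr + ht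

theorem dvd_powCoords_snd_sub_trace_pow (b d y : ℤ) (j : ℕ) :
    1 - b * y + d * y ^ 2 ∣ (powCoords b d y (j + 1)).2 - (2 - b * y) ^ j := by
  induction j with
  | zero => simp [powCoords]
  | succ j ih =>
    obtain ⟨r, hr⟩ := ih
    refine ⟨r * (2 - b * y) - (powCoords b d y j).2, ?_⟩
    simp only [powCoords] at hr ⊢
    linear_combination (2 - b * y) * hr

theorem isCoprime_powCoords (b d y : ℤ) (hy : b ^ 2 - 4 * d ∣ y) (j : ℕ) :
    IsCoprime (powCoords b d y (j + 1)).1 (powCoords b d y (j + 1)).2 := by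
  set n := 1 - b * y + d * y ^ 2 with hn
  have hyn : IsCoprime y n := ⟨b - d * y, 1, by rw [hn]; ring⟩
  have htn : IsCoprime (2 - b * y) n := by
    have h1 : IsCoprime (y ^ 2 * (b ^ 2 - 4 * d)) n :=
      hyn.pow_left.mul_left (hyn.of_isCoprime_of_dvd_left hy)
    have h2 : IsCoprime ((2 - b * y) * (2 - b * y)) n := by
      rw [show (2 - b * y) * (2 - b * y) = y ^ 2 * (b ^ 2 - 4 * d) + 4 * n by rw [hn]; ring]
      exact h1.add_mul_right_left 4
    exact h2.of_mul_left_left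
  have hcn : IsCoprime (powCoords b d y (j + 1)).2 n := by
    obtain ⟨r, hr⟩ := dvd_powCoords_snd_sub_trace_pow b d y j
    have h1 := (htn.pow_left (m := j)).add_mul_left_left r
    rwa [← hr, add_sub_cancel] at h1
  have h2 : IsCoprime (n ^ (j + 1)) (powCoords b d y (j + 1)).2 := hcn.symm.pow_left
  rw [hn, ← powCoords_norm b d y (j + 1)] at h2
  have h3 := h2.add_mul_right_left (b * y * (powCoords b d y (j + 1)).1 -
    d * y ^ 2 * (powCoords b d y (j + 1)).2)
  refine IsCoprime.of_mul_left_left (y := (powCoords b d y (j + 1)).1) ?_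
  rw [← sq]
  ring_nf at h3 ⊢
  exact h3

theorem exists_pow_sub_dvd {A C n r : ℤ} {l k : ℕ} (hk : k + 1 = 2 * l) (hAC : IsCoprime A C)
    (h : A ^ 2 - n ^ k = C * r) : ∃ s : ℤ, C ∣ s ^ k - A := by
  obtain ⟨u, v, huv⟩ := hAC
  refine ⟨n ^ l * u, ?_⟩
  have h1 : A ^ 2 ≡ n ^ k [ZMOD C] := ((Int.modEq_iff_dvd).2 (Dvd.intro r h.symm)).symm
  have h2 : u * A ≡ 1 [ZMOD C] := by
    refine ((Int.modEq_iff_dvd).2 ⟨v, ?_⟩)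
    linarith
  have h3 : (n ^ l * u) ^ k ≡ A [ZMOD C] := by
    calc (n ^ l * u) ^ k = (n ^ k) ^ l * u ^ k := by ring
      _ ≡ (A ^ 2) ^ l * u ^ k [ZMOD C] := (h1.symm.pow l).mul_right _
      _ = A * (u * A) ^ k := by rw [← pow_mul, ← hk]; ring
      _ ≡ A * 1 ^ k [ZMOD C] := (h2.pow k).mul_left _
      _ = A := by simp
  exact (Int.modEq_iff_dvd).1 h3.symm

theorem natDegree_minpoly_le_finrank {K L : Type*} [Field K] [Field L] [Algebra K L]
    {E : IntermediateField K L} [FiniteDimensional K E] {z : L} (hz : z ∈ E) :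
    (minpoly K z).natDegree ≤ Module.finrank K E := by
  have h := IntermediateField.minpoly_eq (⟨z, hz⟩ : E)
  rw [← h]
  exact minpoly.natDegree_le _

theorem natDegree_minpoly_le_of_pow_eq {ω η x z : ℂ} {b d : ℤ} (hω : ω ^ 2 + b * ω + d = 0)
    (hη : η ∈ IntermediateField.adjoin ℚ {ω}) {k : ℕ} (hk : 0 < k) (hx : x ^ k = η ^ k)
    {s w : ℤ} (hw : w ≠ 0) (hz : s + w * z = x) :
    (minpoly ℚ z).natDegree ≤ 2 * k.totient := by
  obtain ⟨ζ, hζ, hxζ⟩ : ∃ ζ : ℂ, ζ ^ k = 1 ∧ x = ζ * η := by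
    rcases eq_or_ne η 0 with rfl | h0
    · refine ⟨1, one_pow _, ?_⟩
      rw [zero_pow hk.ne'] at hx
      simpa using pow_eq_zero_iff hk.ne' |>.1 hx
    · exact ⟨x / η, by rw [div_pow, hx, div_self (pow_ne_zero _ h0)], by field_simp⟩
  have hprim : IsPrimitiveRoot ζ (orderOf ζ) := IsPrimitiveRoot.orderOf ζ
  have hdvd : orderOf ζ ∣ k := orderOf_dvd_of_pow_eq_one hζ
  have hord : 0 < orderOf ζ := Nat.pos_of_dvd_of_pos hdvd hk
  have hζint : IsIntegral ℚ ζ := (hprim.isIntegral hord).tower_top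
  have hdeg : ((X : ℚ[X]) ^ 2 + C (b : ℚ) * X + C (d : ℚ)).natDegree = 2 := by
    compute_degree!
  have hmonic : ((X : ℚ[X]) ^ 2 + C (b : ℚ) * X + C (d : ℚ)).Monic := by monicity!
  have hroot : aeval ω ((X : ℚ[X]) ^ 2 + C (b : ℚ) * X + C (d : ℚ)) = 0 := by
    simpa using hω
  have hωint : IsIntegral ℚ ω := ⟨_, hmonic, by simpa [aeval_def] using hroot⟩
  have hfinω : Module.finrank ℚ (IntermediateField.adjoin ℚ {ω}) ≤ 2 := by
    rw [IntermediateField.adjoin.finrank hωint, ← hdeg]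
    exact natDegree_le_natDegree (minpoly.min _ _ hmonic hroot)
  have hfinζ : Module.finrank ℚ (IntermediateField.adjoin ℚ {ζ}) ≤ k.totient := by
    rw [IntermediateField.adjoin.finrank hζint, ← cyclotomic_eq_minpoly_rat hprim hord,
      natDegree_cyclotomic]
    exact Nat.le_of_dvd (Nat.totient_pos.2 hk) (Nat.totient_dvd_of_dvd hdvd)
  have := IntermediateField.adjoin.finiteDimensional hζint
  have := IntermediateField.adjoin.finiteDimensional hωint
  set E := IntermediateField.adjoin ℚ {ζ} ⊔ IntermediateField.adjoin ℚ {ω}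
  have hxE : x ∈ E := by
    rw [hxζ]
    exact mul_mem ((le_sup_left : _ ≤ E) (IntermediateField.mem_adjoin_simple_self ℚ ζ))
      ((le_sup_right : _ ≤ E) hη)
  have hzE : z ∈ E := by
    have hwC : (w : ℂ) ≠ 0 := by exact_mod_cast hw
    have : z = (x - s) / w := by rw [← hz]; field_simp; ring
    rw [this]
    exact div_mem (sub_mem hxE (intCast_mem _ _)) (intCast_mem _ _)
  calc _ ≤ _ := natDegree_minpoly_le_finrank hzE
    _ ≤ _ := IntermediateField.finrank_sup_le _ _
    _ ≤ k.totient * 2 := Nat.mul_le_mul hfinζ hfinω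
    _ = _ := mul_comm _ _

theorem natDegree_le_of_irreducible_dvd {F q : ℤ[X]} {B : ℕ}
    (hF : ∀ z : ℂ, aeval z F = 0 → (minpoly ℚ z).natDegree ≤ B)
    (hq : Irreducible q) (hdvd : q ∣ F) : q.natDegree ≤ B := by
  rcases Nat.eq_zero_or_pos q.natDegree with h0 | hpos
  · lia
  have hprim := hq.isPrimitive hpos.ne'
  have hqQ : Irreducible (q.map (Int.castRingHom ℚ)) :=
    (IsPrimitive.Int.irreducible_iff_irreducible_map_cast hprim).1 hq
  obtain ⟨z, hz⟩ : ∃ z : ℂ, aeval z q = 0 := by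
    obtain ⟨z, hz⟩ := IsAlgClosed.exists_aeval_eq_zero ℂ (q.map (Int.castRingHom ℚ))
      (by rw [degree_map_eq_of_injective Int.cast_injective]
          exact (natDegree_pos_iff_degree_pos.1 hpos).ne')
    exact ⟨z, by rwa [← algebraMap_int_eq, aeval_map_algebraMap] at hz⟩
  have hzQ : aeval z (q.map (Int.castRingHom ℚ)) = 0 := by
    rw [← algebraMap_int_eq, aeval_map_algebraMap]; exact hz
  have hdeg := congrArg natDegree (minpoly.eq_of_irreducible hqQ hzQ)
  rw [natDegree_mul_C (inv_ne_zero (leadingCoeff_ne_zero.2 hqQ.ne_zero)),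
    natDegree_map_eq_of_injective Int.cast_injective] at hdeg
  rw [hdeg]
  refine hF z ?_
  obtain ⟨r, rfl⟩ := hdvd
  rw [map_mul, hz, zero_mul]

theorem exists_mul_eq_pow_sub (s w A : ℤ) (hw : w ≠ 0) {k : ℕ} (h : w ∣ s ^ k - A) :
    ∃ g : ℤ[X], g.natDegree = k ∧ C w * g = (C s + C w * X) ^ k - C A := by
  obtain ⟨e, he⟩ := h
  obtain ⟨r, hr⟩ := sub_dvd_pow_sub_pow (C s + C w * X) (C s) k
  have hg : C w * (X * r + C e) = (C s + C w * X) ^ k - C A := by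
    have he' := congrArg (C : ℤ → ℤ[X]) he
    simp only [map_sub, map_mul, map_pow] at he'
    linear_combination -hr - he'
  refine ⟨X * r + C e, ?_, hg⟩
  rw [← natDegree_C_mul hw, hg, natDegree_sub_C, natDegree_pow, add_comm, natDegree_linear hw,
    mul_one]

theorem exists_dvd_pow_sub_powCoords {a b c y : ℤ} (ha : a ≠ 0) (hD : b ^ 2 - 4 * (a * c) ≠ 0)
    (hy : y = 2 * a * (b ^ 2 - 4 * (a * c))) {k : ℕ} (hk : Odd k) (hcop : IsCoprime (k : ℤ) y) :
    a * y * (powCoords b (a * c) y k).2 ≠ 0 ∧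
      ∃ s : ℤ, a * y * (powCoords b (a * c) y k).2 ∣ s ^ k - (powCoords b (a * c) y k).1 := by
  have hN := powCoords_norm b (a * c) y k
  have hA1 := dvd_powCoords_fst_sub_one b (a * c) y k
  have hBk := dvd_powCoords_snd_sub b (a * c) y k
  have hAB : IsCoprime (powCoords b (a * c) y k).1 (powCoords b (a * c) y k).2 := by
    obtain ⟨i, rfl⟩ := hk
    exact isCoprime_powCoords b (a * c) y ⟨2 * a, by rw [hy]; ring⟩ (2 * i)
  generalize (powCoords b (a * c) y k).1 = A at *
  generalize (powCoords b (a * c) y k).2 = B at *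
  have hy0 : y ≠ 0 := hy ▸ mul_ne_zero (mul_ne_zero two_ne_zero ha) hD
  have hay : a ∣ y := ⟨2 * (b ^ 2 - 4 * (a * c)), by rw [hy]; ring⟩
  have hBy : IsCoprime B y := by
    obtain ⟨r, hr⟩ := hBk
    have h1 := IsCoprime.add_mul_left_left hcop r
    rwa [show (k : ℤ) + y * r = B by linarith] at h1
  have hBay : IsCoprime B (a * y) := (hBy.of_isCoprime_of_dvd_right hay).mul_right hBy
  have hB0 : B ≠ 0 := by
    intro h0
    rw [h0, isCoprime_zero_left] at hBy
    have h2 : (2 : ℤ) ∣ y := ⟨a * (b ^ 2 - 4 * (a * c)), by rw [hy]; ring⟩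
    have := isUnit_of_dvd_unit h2 hBy
    rw [Int.isUnit_iff] at this
    lia
  refine ⟨mul_ne_zero (mul_ne_zero ha hy0) hB0, ?_⟩
  obtain ⟨i, hi⟩ := hk
  obtain ⟨t, ht⟩ := exists_pow_sub_dvd (k := k) (l := i + 1) (n := 1 - b * y + a * c * y ^ 2)
    (r := b * y * A - a * c * y ^ 2 * B) (by lia) hAB
    (by linear_combination hN)
  obtain ⟨u, v, huv⟩ := hBay
  obtain ⟨s, hs⟩ : ∃ s, s = 1 + v * (a * y) * (t - 1) := ⟨_, rfl⟩
  refine ⟨s, ?_⟩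
  have h1 : a * y ∣ s ^ k - A := by
    have h2 : a * y ∣ s ^ k - 1 ^ k :=
      Dvd.dvd.trans ⟨v * (t - 1), by rw [hs]; ring⟩ (sub_dvd_pow_sub_pow s 1 k)
    have h3 : a * y ∣ A - 1 :=
      Dvd.dvd.trans (by rw [sq]; exact mul_dvd_mul_right hay y)
        hA1
    have h4 := h2.sub h3
    rwa [one_pow, sub_sub_sub_cancel_right] at h4
  have h5 : B ∣ s ^ k - A := by
    have h6 : B ∣ s ^ k - t ^ k :=
      Dvd.dvd.trans ⟨u * (1 - t), by rw [hs]; linear_combination (t - 1) * huv⟩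
        (sub_dvd_pow_sub_pow s t k)
    simpa using h6.add ht
  exact IsCoprime.mul_dvd (IsCoprime.symm ⟨u, v, huv⟩) h1 h5

theorem exists_comp_roots_of_discrim_ne_zero (a b c : ℤ) (ha : a ≠ 0)
    (hD : b ^ 2 - 4 * (a * c) ≠ 0) {k : ℕ} (hk : Odd k)
    (hcop : IsCoprime (k : ℤ) (2 * a * (b ^ 2 - 4 * (a * c)))) :
    ∃ g : ℤ[X], g.natDegree = k ∧ ∀ z : ℂ,
      aeval z ((C a * X ^ 2 + C b * X + C c).comp g) = 0 →
        (minpoly ℚ z).natDegree ≤ 2 * k.totient := by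
  obtain ⟨y, hy⟩ : ∃ y, y = 2 * a * (b ^ 2 - 4 * (a * c)) := ⟨_, rfl⟩
  rw [← hy] at hcop
  obtain ⟨hw, s, hs⟩ := exists_dvd_pow_sub_powCoords ha hD hy hk hcop
  obtain ⟨g, hgk, hg⟩ := exists_mul_eq_pow_sub s _ _ hw hs
  refine ⟨g, hgk, fun z hz => ?_⟩
  set G := aeval z g with hG
  have hgz := congrArg (aeval z) hg
  simp only [map_mul, map_sub, map_pow, map_add, aeval_X, eq_intCast, map_intCast,
    ← hG] at hgz
  have hfz : (a : ℂ) * G ^ 2 + b * G + c = 0 := by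
    simpa [aeval_comp] using hz
  have hω : (a * G) ^ 2 + (b : ℂ) * (a * G) + ((a * c : ℤ) : ℂ) = 0 := by
    push_cast
    linear_combination (a : ℂ) * hfz
  have hpow := one_add_mul_pow_eq b (a * c) y _ hω k
  refine natDegree_minpoly_le_of_pow_eq (η := 1 + y * (a * G)) (s := s) hω ?_ hk.pos ?_ hw rfl
  · exact add_mem (one_mem _) (mul_mem (intCast_mem _ _)
      (IntermediateField.mem_adjoin_simple_self ℚ _))
  · rw [hpow]
    push_cast at hgz ⊢
    linear_combination -hgz

theorem exists_comp_roots_of_discrim_eq_zero (a b c : ℤ) (ha : a ≠ 0)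
    (hD : b ^ 2 - 4 * (a * c) = 0) {k : ℕ} (hk : 0 < k) :
    ∃ g : ℤ[X], g.natDegree = k ∧ ∀ z : ℂ,
      aeval z ((C a * X ^ 2 + C b * X + C c).comp g) = 0 →
        (minpoly ℚ z).natDegree ≤ 2 * k.totient := by
  have ha2 : 2 * a ≠ 0 := mul_ne_zero two_ne_zero ha
  obtain ⟨r, hr⟩ := sub_dvd_pow_sub_pow (1 + C (2 * a) * X) (1 : ℤ[X]) (k - 1)
  have hg : C (2 * a) * (X + (C (2 * a) * X + C b) * (X * r)) + C b =
      (C (2 * a) * X + C b) * (C (2 * a) * X + C 1) ^ (k - 1) := by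
    rw [one_pow] at hr
    rw [C_1]
    linear_combination -(C (2 * a) * X + C b) * hr
  refine ⟨X + (C (2 * a) * X + C b) * (X * r), ?_, fun z hz => ?_⟩
  · rw [← natDegree_C_mul ha2, ← natDegree_add_C (a := b), hg, natDegree_mul, natDegree_pow,
      natDegree_linear ha2, natDegree_linear ha2]
    · lia
    · exact ne_zero_of_natDegree_gt (n := 0) (by rw [natDegree_linear ha2]; exact one_pos)
    · exact pow_ne_zero _
        (ne_zero_of_natDegree_gt (n := 0) (by rw [natDegree_linear ha2]; exact one_pos))
  · set g := X + (C (2 * a) * X + C b) * (X * r)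
    set G := aeval z g with hG
    have hgz := congrArg (aeval z) hg
    simp only [map_mul, map_pow, map_add, aeval_X, eq_intCast, map_intCast,
      ← hG] at hgz
    have hfz : (a : ℂ) * G ^ 2 + b * G + c = 0 := by
      simpa [aeval_comp] using hz
    have hDC : (b : ℂ) ^ 2 - 4 * (a * c) = 0 := by exact_mod_cast hD
    push_cast at hgz
    have hsq : (2 * a * G + b) ^ 2 = 0 := by
      linear_combination 4 * (a : ℂ) * hfz + hDC
    rw [hgz] at hsq
    have haC : ((2 * a : ℤ) : ℂ) ≠ 0 := by exact_mod_cast ha2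
    obtain ⟨t, ht⟩ : ∃ t : ℤ, ((2 * a : ℤ) : ℂ) * z + t = 0 := by
      rcases mul_eq_zero.1 (pow_eq_zero_iff two_ne_zero |>.1 hsq) with h | h
      · exact ⟨b, by push_cast; exact h⟩
      · exact ⟨1, by push_cast; exact eq_zero_of_pow_eq_zero h⟩
    refine natDegree_minpoly_le_of_pow_eq (ω := 0) (b := 0) (d := 0) (η := 0) (x := 0) (s := t)
      (w := 2 * a) (by simp) (zero_mem _) hk rfl ha2 ?_
    rw [← ht, add_comm]

theorem exists_comp_irreducible_factors (f : ℤ[X]) (hf : f.natDegree = 2) :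
    ∃ m : ℕ, m ≠ 0 ∧ ∀ k : ℕ, 0 < k → k.Coprime m → Odd k ∧ ∃ g : ℤ[X], g.natDegree = k ∧
      ∀ q : ℤ[X], Irreducible q → q ∣ f.comp g → q.natDegree ≤ 2 * k.totient := by
  have ha : f.coeff 2 ≠ 0 := by
    rw [← hf]
    exact leadingCoeff_ne_zero.2 (ne_zero_of_natDegree_gt (n := 0) (by lia))
  obtain ⟨a, b, c, ha', rfl⟩ : ∃ a b c : ℤ, a ≠ 0 ∧ f = C a * X ^ 2 + C b * X + C c :=
    ⟨_, _, _, ha, eq_quadratic_of_degree_le_two (natDegree_le_iff_degree_le.1 hf.le)⟩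
  have hodd : ∀ (n : ℤ) (k : ℕ), k.Coprime (2 * n).natAbs → Odd k := fun n k h => by
    rw [← Nat.coprime_two_right]
    exact h.coprime_dvd_right (Int.natAbs_dvd_natAbs.2 (Dvd.intro n rfl))
  by_cases hD : b ^ 2 - 4 * (a * c) = 0
  · refine ⟨(2 * a).natAbs, by simpa using ha', fun k hk hcop => ⟨hodd _ _ hcop, ?_⟩⟩
    obtain ⟨g, hgk, hg⟩ := exists_comp_roots_of_discrim_eq_zero a b c ha' hD hk
    exact ⟨g, hgk, fun q => natDegree_le_of_irreducible_dvd hg⟩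
  · refine ⟨(2 * (a * (b ^ 2 - 4 * (a * c)))).natAbs, by simpa using ⟨ha', hD⟩,
      fun k hk hcop => ⟨hodd _ _ hcop, ?_⟩⟩
    obtain ⟨g, hgk, hg⟩ := exists_comp_roots_of_discrim_ne_zero a b c ha' hD (hodd _ _ hcop)
      (by rw [mul_assoc, Int.isCoprime_iff_gcd_eq_one]; exact hcop)
    exact ⟨g, hgk, fun q => natDegree_le_of_irreducible_dvd hg⟩

theorem exists_multiset_prod_eq_of_irreducible_factors {F : ℤ[X]} (hF : F ≠ 0) {B : ℕ}
    (h : ∀ q : ℤ[X], Irreducible q → q ∣ F → q.natDegree ≤ B) :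
    ∃ L : Multiset ℤ[X], F = L.prod ∧ ∀ p ∈ L, p.natDegree ≤ B := by
  obtain ⟨u, hu⟩ := UniqueFactorizationMonoid.factors_prod hF
  refine ⟨(u : ℤ[X]) ::ₘ UniqueFactorizationMonoid.factors F, ?_, fun p hp => ?_⟩
  · rw [Multiset.prod_cons, mul_comm, hu]
  · rcases Multiset.mem_cons.1 hp with rfl | hp
    · rw [natDegree_eq_zero_of_isUnit u.isUnit]
      exact Nat.zero_le _
    · exact h p (UniqueFactorizationMonoid.irreducible_of_factor p hp)
        (UniqueFactorizationMonoid.dvd_of_mem_factors hp)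

theorem smooth_values_quadratic (f : Polynomial ℤ) (hf : f.natDegree = 2) :
    (∃ c : ℝ, 0 < c ∧ ∀ N : ℕ, ∃ g : Polynomial ℤ,
      Odd g.natDegree ∧ N ≤ g.natDegree ∧ 16 ≤ g.natDegree ∧
      ∃ L : Multiset (Polynomial ℤ), f.comp g = L.prod ∧
        ∀ p ∈ L, (p.natDegree : ℝ) ≤
          c * (g.natDegree : ℝ) / Real.sqrt (Real.log (Real.log (g.natDegree : ℝ)))) ∧
    (∀ ε : ℝ, 0 < ε → AdmitsPolysmoothness f ε) := by
  obtain ⟨m, hm, hfactors⟩ := exists_comp_irreducible_factors f hf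
  have hmR : (0 : ℝ) < m := by exact_mod_cast Nat.pos_of_ne_zero hm
  have key : ∀ N : ℕ, ∃ g : ℤ[X], Odd g.natDegree ∧ N ≤ g.natDegree ∧ 16 ≤ g.natDegree ∧
      (∀ q : ℤ[X], Irreducible q → q ∣ f.comp g → q.natDegree ≤ 2 * g.natDegree.totient) ∧
      (2 * g.natDegree.totient : ℝ) ≤
        4 * m * g.natDegree / Real.sqrt (Real.log (Real.log g.natDegree)) := by
    intro N
    obtain ⟨k, hNk, hk16, hcop, hk⟩ := exists_coprime_totient_le m hm N
    obtain ⟨hodd, g, rfl, hg⟩ := hfactors k (by lia) hcop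
    refine ⟨g, hodd, hNk, hk16, hg, ?_⟩
    have h16 : (16 : ℝ) ≤ g.natDegree := by exact_mod_cast hk16
    have hlog : 1 < Real.log g.natDegree := by
      rw [Real.lt_log_iff_exp_lt (by linarith)]
      linarith [Real.exp_one_lt_d9]
    rw [le_div_iff₀ (Real.sqrt_pos.2 (Real.log_pos hlog))]
    linarith
  refine ⟨⟨4 * m, by positivity, fun N => ?_⟩, fun ε hε => ?_⟩
  · obtain ⟨g, hodd, hN, h16, hg, hle⟩ := key N
    have hne : f.comp g ≠ 0 := ne_zero_of_natDegree_gt (n := 0) (by rw [natDegree_comp]; lia)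
    obtain ⟨L, hL, hLdeg⟩ := exists_multiset_prod_eq_of_irreducible_factors hne hg
    exact ⟨g, hodd, hN, h16, L, hL, fun p hp =>
      le_trans (by exact_mod_cast hLdeg p hp) hle⟩
  · have htend : Filter.Tendsto (fun n : ℕ => Real.sqrt (Real.log (Real.log (n : ℝ))))
        Filter.atTop Filter.atTop :=
      Real.tendsto_sqrt_atTop.comp (Real.tendsto_log_atTop.comp
        (Real.tendsto_log_atTop.comp tendsto_natCast_atTop_atTop))
    obtain ⟨N, hN⟩ := Filter.eventually_atTop.1 (htend.eventually_ge_atTop (2 * m / ε))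
    obtain ⟨g, -, hgN, h16, hg, hle⟩ := key N
    refine ⟨g, by lia, fun q hq hqd => ?_⟩
    have hbound := hN _ hgN
    have hpos : 0 < 2 * (m : ℝ) / ε := by positivity
    calc (q.natDegree : ℝ) ≤ 2 * g.natDegree.totient := by exact_mod_cast hg q hq hqd
      _ ≤ 4 * m * g.natDegree / Real.sqrt (Real.log (Real.log g.natDegree)) := hle
      _ ≤ 4 * m * g.natDegree / (2 * m / ε) := by gcongr
      _ = ε * f.natDegree * g.natDegree := by rw [hf]; field_simp; norm_num
end

section
/- Let ε > 0 and let f ∈ ℤ[t] be a quadratic polynomial. Then there are infinitely many natural numbers n such that f(n) ≠ 0 and every prime p dividing f(n) satisfies p ≤ n^ε. In other words, f(n) is n^ε-smooth for infinitely many n ∈ ℕ. -/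
open Polynomial Filter

theorem totient_prod_primes (s : Finset ℕ) (hs : ∀ p ∈ s, p.Prime) :
    Nat.totient (∏ p ∈ s, p) = ∏ p ∈ s, (p - 1) := by
  induction s using Finset.induction_on with
  | empty => simp
  | insert p s hp ih =>
    rw [Finset.prod_insert hp, Finset.prod_insert hp, Nat.totient_mul,
      ih fun q hq => hs q (Finset.mem_insert_of_mem hq),
      Nat.totient_prime (hs p (Finset.mem_insert_self p s))]
    refine Nat.Coprime.prod_right fun q hq => ?_
    rw [Nat.coprime_primes (hs p (Finset.mem_insert_self p s))
      (hs q (Finset.mem_insert_of_mem hq))]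
    rintro rfl
    exact hp hq

theorem exists_coprime_totient_le_exp (N : ℕ) (hN : N ≠ 0) :
    ∃ m : ℕ, 0 < m ∧ m.Coprime N ∧ (m.totient : ℝ) ≤ Real.exp (-(1 / 2)) * m := by
  have key := one_half_le_sum_primes_ge_one_div (N + 1)
  set s := (4 ^ ((N + 1).primesBelow.card + 1)).succ.primesBelow \ (N + 1).primesBelow with hs
  have hprime : ∀ p ∈ s, p.Prime := fun p hp =>
    Nat.prime_of_mem_primesBelow (Finset.mem_sdiff.mp hp).1
  have hlt : ∀ p ∈ s, N < p := fun p hp => by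
    by_contra! h
    exact (Finset.mem_sdiff.mp hp).2
      (Nat.mem_primesBelow.mpr ⟨Nat.lt_succ_of_le h, hprime p hp⟩)
  refine ⟨∏ p ∈ s, p, Finset.prod_pos fun p hp => (hprime p hp).pos,
    Nat.Coprime.prod_left fun p hp => ?_, ?_⟩
  · rw [(hprime p hp).coprime_iff_not_dvd]
    exact fun h => (Nat.le_of_dvd (Nat.pos_of_ne_zero hN) h).not_gt (hlt p hp)
  · rw [totient_prod_primes s hprime]
    push_cast
    calc ∏ p ∈ s, ((p - 1 : ℕ) : ℝ) ≤ ∏ p ∈ s, (Real.exp (-(1 / (p : ℝ))) * p) := by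
          refine Finset.prod_le_prod (fun p _ => by positivity) fun p hp => ?_
          have hp0 : (0 : ℝ) < p := by exact_mod_cast (hprime p hp).pos
          rw [Nat.cast_pred (hprime p hp).pos]
          calc (p : ℝ) - 1 = (-(1 / (p : ℝ)) + 1) * p := by field_simp; ring
            _ ≤ _ := by gcongr; exact Real.add_one_le_exp _
      _ = Real.exp (-∑ p ∈ s, 1 / (p : ℝ)) * ∏ p ∈ s, (p : ℝ) := by
          rw [Finset.prod_mul_distrib, ← Real.exp_sum, Finset.sum_neg_distrib]
      _ ≤ _ := by gcongr

theorem exists_coprime_totient_le_s1 (N : ℕ) (hN : N ≠ 0) {δ : ℝ} (hδ : 0 < δ) :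
    ∃ m : ℕ, 0 < m ∧ m.Coprime N ∧ (m.totient : ℝ) ≤ δ * m := by
  have hpow : ∀ j : ℕ, ∃ m : ℕ, 0 < m ∧ m.Coprime N ∧
      (m.totient : ℝ) ≤ Real.exp (-(1 / 2)) ^ j * m := by
    intro j
    induction j with
    | zero => exact ⟨1, by simp⟩
    | succ j ih =>
      obtain ⟨m, hm, hmN, hle⟩ := ih
      obtain ⟨M, hM0, hM, hMle⟩ := exists_coprime_totient_le_exp (N * m) (by positivity)
      refine ⟨m * M, by positivity, hmN.mul_left (hM.coprime_dvd_right (dvd_mul_right N m)), ?_⟩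
      rw [Nat.totient_mul (hM.coprime_dvd_right (dvd_mul_left m N)).symm]
      push_cast
      calc (m.totient : ℝ) * M.totient
          ≤ (Real.exp (-(1 / 2)) ^ j * m) * (Real.exp (-(1 / 2)) * M) := by gcongr
        _ = _ := by ring
  obtain ⟨j, hj⟩ := exists_pow_lt_of_lt_one hδ
    (show Real.exp (-(1 / 2)) < 1 by rw [Real.exp_lt_one_iff]; norm_num)
  obtain ⟨m, hm, hmN, hle⟩ := hpow j
  exact ⟨m, hm, hmN, hle.trans (by gcongr)⟩

/-- The polynomials `Q k` such that `(z - z⁻¹) * Q k ((z - z⁻¹) ^ 2)` is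
`z ^ (2 * k + 1) - z⁻¹ ^ (2 * k + 1)`. -/
noncomputable def lucasQuotient : ℕ → ℤ[X]
  | 0 => 1
  | 1 => X + 3
  | k + 2 => (X + 2) * lucasQuotient (k + 1) - lucasQuotient k

theorem lucasQuotient_eval_zero : ∀ k : ℕ, (lucasQuotient k).eval 0 = 2 * k + 1
  | 0 => by simp [lucasQuotient]
  | 1 => by simp [lucasQuotient]
  | k + 2 => by
    simp only [lucasQuotient, eval_sub, eval_mul, eval_add, eval_X, eval_ofNat,
      lucasQuotient_eval_zero (k + 1), lucasQuotient_eval_zero k]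
    push_cast
    ring

theorem lucasQuotient_monic_natDegree :
    ∀ k : ℕ, (lucasQuotient k).Monic ∧ (lucasQuotient k).natDegree = k
  | 0 => by simp [lucasQuotient]
  | 1 => by
    have h : lucasQuotient 1 = X + C 3 := by simp [lucasQuotient]
    rw [h]
    exact ⟨monic_X_add_C 3, natDegree_X_add_C 3⟩
  | k + 2 => by
    obtain ⟨hm, hd⟩ := lucasQuotient_monic_natDegree k
    obtain ⟨hm', hd'⟩ := lucasQuotient_monic_natDegree (k + 1)
    have hlin : (X + 2 : ℤ[X]) = X + C 2 := by simp
    have hmul : ((X + 2 : ℤ[X]) * lucasQuotient (k + 1)).Monic := by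
      rw [hlin]
      exact (monic_X_add_C 2).mul hm'
    have hmuld : ((X + 2 : ℤ[X]) * lucasQuotient (k + 1)).natDegree = k + 2 := by
      rw [hlin, (monic_X_add_C 2).natDegree_mul hm', natDegree_X_add_C, hd']
      ring
    have hlt : (lucasQuotient k).natDegree <
        ((X + 2 : ℤ[X]) * lucasQuotient (k + 1)).natDegree := by omega
    refine ⟨hmul.sub_of_left (degree_lt_degree hlt), ?_⟩
    rw [lucasQuotient, natDegree_sub_eq_left_of_natDegree_lt hlt, hmuld]

theorem mul_aeval_lucasQuotient {z w : ℂ} (hzw : z * w = 1) : ∀ k : ℕ,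
    (z - w) * aeval ((z - w) ^ 2) (lucasQuotient k) = z ^ (2 * k + 1) - w ^ (2 * k + 1)
  | 0 => by simp [lucasQuotient]
  | 1 => by
    simp only [lucasQuotient, map_add, aeval_X, map_ofNat]
    linear_combination (-3) * (z - w) * hzw
  | k + 2 => by
    have h1 := mul_aeval_lucasQuotient hzw (k + 1)
    have h0 := mul_aeval_lucasQuotient hzw k
    simp only [lucasQuotient, map_sub, map_mul, map_add, aeval_X, map_ofNat]
    linear_combination ((z - w) ^ 2 + 2) * h1 - h0 +
      ((z * w + 1) * (z ^ (2 * k + 1) - w ^ (2 * k + 1)) -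
        2 * (z ^ (2 * k + 3) - w ^ (2 * k + 3))) * hzw

theorem exists_sub_inv_eq (v : ℂ) : ∃ z : ℂ, z ≠ 0 ∧ z - z⁻¹ = v := by
  obtain ⟨s, hs⟩ := IsAlgClosed.exists_eq_mul_self (v ^ 2 + 4)
  have hq : ((v + s) / 2) ^ 2 - v * ((v + s) / 2) = 1 := by linear_combination (-1 / 4) * hs
  have h0 : (v + s) / 2 ≠ 0 := by
    intro h
    rw [h] at hq
    norm_num at hq
  refine ⟨(v + s) / 2, h0, ?_⟩
  generalize (v + s) / 2 = z at *
  field_simp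
  linear_combination hq

theorem exists_rootOfUnity_mul {m : ℕ} {ζ : ℂ} (hζ : IsPrimitiveRoot ζ m) (hm : m ≠ 0) {z w : ℂ}
    (hw : w ≠ 0) (h : z ^ m = w ^ m) : ∃ j : ℕ, z = ζ ^ j * w := by
  have : NeZero m := ⟨hm⟩
  obtain ⟨j, -, hj⟩ := hζ.eq_pow_of_pow_eq_one (ξ := z / w) (by
    rw [div_pow, h, div_self (pow_ne_zero _ hw)])
  exact ⟨j, by rw [hj, div_mul_cancel₀ _ hw]⟩

/-- The polynomial `v * Q k (v ^ 2)` is conjugate to the power map, so all solutions of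
`v * Q k (v ^ 2) = y * Q k (y ^ 2)` lie in a number field of degree at most `4 * φ (2 * k + 1)`. -/
theorem exists_field_of_lucas_eq (k : ℕ) {y : ℂ} {E : ℤ} (hy : y ^ 2 = E) :
    ∃ K : IntermediateField ℚ ℂ, FiniteDimensional ℚ K ∧
      Module.finrank ℚ K ≤ 4 * (2 * k + 1).totient ∧
      ∀ v : ℂ, v * aeval (v ^ 2) (lucasQuotient k) = y * aeval (y ^ 2) (lucasQuotient k) →
        v ∈ K := by
  obtain ⟨w, hw, hwy⟩ := exists_sub_inv_eq y
  have hζ := Complex.isPrimitiveRoot_exp (2 * k + 1) (by omega)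
  set ζ := Complex.exp (2 * Real.pi * Complex.I / ((2 * k + 1 : ℕ) : ℂ))
  have hζi : IsIntegral ℚ ζ := (hζ.isIntegral (by omega)).tower_top
  set P : ℚ[X] := (X ^ 2 - 1) ^ 2 - C (E : ℚ) * X ^ 2 with hP
  have hPdeg : P.natDegree = 4 := by rw [hP]; compute_degree!
  have hPw : aeval w P = 0 := by
    have : (w ^ 2 - 1) ^ 2 - (E : ℂ) * w ^ 2 = 0 := by
      rw [← hy, ← hwy]
      field_simp
      ring
    simpa [hP] using this
  have hP0 : P ≠ 0 := by
    rintro h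
    rw [h] at hPdeg
    simp at hPdeg
  have hwi : IsIntegral ℚ w := IsAlgebraic.isIntegral ⟨P, hP0, hPw⟩
  have hfζ : FiniteDimensional ℚ (IntermediateField.adjoin ℚ {ζ}) :=
    IntermediateField.adjoin.finiteDimensional hζi
  have hfw : FiniteDimensional ℚ (IntermediateField.adjoin ℚ {w}) :=
    IntermediateField.adjoin.finiteDimensional hwi
  refine ⟨IntermediateField.adjoin ℚ {ζ} ⊔ IntermediateField.adjoin ℚ {w},
    IntermediateField.finiteDimensional_sup _ _, ?_, ?_⟩
  · refine (IntermediateField.finrank_sup_le _ _).trans ?_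
    rw [IntermediateField.adjoin.finrank hζi, IntermediateField.adjoin.finrank hwi,
      ← cyclotomic_eq_minpoly_rat hζ (by omega), natDegree_cyclotomic, mul_comm]
    gcongr
    exact hPdeg ▸ natDegree_le_of_dvd (minpoly.dvd ℚ w hPw) hP0
  · intro v hv
    obtain ⟨z, hz, rfl⟩ := exists_sub_inv_eq v
    rw [← hwy, mul_aeval_lucasQuotient (mul_inv_cancel₀ hz),
      mul_aeval_lucasQuotient (mul_inv_cancel₀ hw)] at hv
    have hζK : ζ ∈ IntermediateField.adjoin ℚ {ζ} ⊔ IntermediateField.adjoin ℚ {w} :=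
      le_sup_left (α := IntermediateField ℚ ℂ) (IntermediateField.mem_adjoin_simple_self ℚ ζ)
    have hwK : w ∈ IntermediateField.adjoin ℚ {ζ} ⊔ IntermediateField.adjoin ℚ {w} :=
      le_sup_right (α := IntermediateField ℚ ℂ) (IntermediateField.mem_adjoin_simple_self ℚ w)
    have hfac : (z ^ (2 * k + 1) - w ^ (2 * k + 1)) * (z ^ (2 * k + 1) * w ^ (2 * k + 1) + 1)
        = 0 := by
      rw [inv_pow, inv_pow] at hv
      have h1 : z ^ (2 * k + 1) ≠ 0 := pow_ne_zero _ hz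
      have h2 : w ^ (2 * k + 1) ≠ 0 := pow_ne_zero _ hw
      generalize z ^ (2 * k + 1) = a at *
      generalize w ^ (2 * k + 1) = b at *
      field_simp at hv
      linear_combination hv
    have hzK : z ∈ IntermediateField.adjoin ℚ {ζ} ⊔ IntermediateField.adjoin ℚ {w} := by
      rcases mul_eq_zero.mp hfac with h | h
      · obtain ⟨j, rfl⟩ := exists_rootOfUnity_mul hζ (by omega) hw (sub_eq_zero.mp h)
        exact mul_mem (pow_mem hζK j) hwK
      · obtain ⟨j, rfl⟩ := exists_rootOfUnity_mul hζ (by omega) (z := z)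
          (neg_ne_zero.mpr (inv_ne_zero hw)) (by
            rw [Odd.neg_pow ⟨k, rfl⟩, inv_pow]
            have h2 : w ^ (2 * k + 1) ≠ 0 := pow_ne_zero _ hw
            field_simp
            linear_combination h)
        exact mul_mem (pow_mem hζK j) (neg_mem (inv_mem hwK))
    exact sub_mem hzK (inv_mem hzK)

theorem natDegree_le_of_irreducible_dvd_s1 {H q : ℤ[X]} {d : ℕ}
    (hd : ∀ t : ℂ, aeval t H = 0 → (minpoly ℚ t).natDegree ≤ d)
    (hq : Irreducible q) (hqH : q ∣ H) : q.natDegree ≤ d := by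
  rcases Nat.eq_zero_or_pos q.natDegree with h0 | h0
  · omega
  have hinj : Function.Injective (Int.castRingHom ℚ) := Int.cast_injective
  have hirr : Irreducible (q.map (Int.castRingHom ℚ)) :=
    (IsPrimitive.Int.irreducible_iff_irreducible_map_cast (hq.isPrimitive h0.ne')).mp hq
  obtain ⟨t, ht⟩ := IsAlgClosed.exists_aeval_eq_zero ℂ q
    (natDegree_pos_iff_degree_pos.mp h0).ne'
  have hmin := minpoly.eq_of_irreducible hirr (x := t)
    (by rw [← ht]; exact aeval_map_algebraMap ℚ t q)
  have hlc : (q.map (Int.castRingHom ℚ)).leadingCoeff⁻¹ ≠ 0 :=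
    inv_ne_zero (leadingCoeff_ne_zero.mpr hirr.ne_zero)
  have htH : aeval t H = 0 := by
    obtain ⟨r, rfl⟩ := hqH
    rw [map_mul, ht, zero_mul]
  have := hd t htH
  rwa [← hmin, natDegree_mul_C hlc, natDegree_map_eq_of_injective hinj] at this

theorem eventually_abs_eval_le_pow (q : ℤ[X]) {d : ℕ} (hq : q.natDegree ≤ d) :
    ∀ᶠ n : ℕ in atTop, |((q.eval (n : ℤ) : ℤ) : ℝ)| ≤ (n : ℝ) ^ (d + 1) := by
  have h := isLittleO_atTop_of_degree_lt (q.map (Int.castRingHom ℝ)) (X ^ (d + 1)) (by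
    rw [degree_X_pow]
    refine (degree_map_le).trans_lt (lt_of_le_of_lt degree_le_natDegree ?_)
    exact_mod_cast Nat.lt_succ_of_le hq)
  filter_upwards [(h.comp_tendsto tendsto_natCast_atTop_atTop).def one_pos] with n hn
  simpa [eval_intCast_map, eval_natCast_map] using hn

theorem tendsto_eval_natCast_atTop {h : ℤ[X]} (hlc : 0 < h.leadingCoeff) (hd : 0 < h.natDegree) :
    Tendsto (fun n : ℕ => ((h.eval (n : ℤ) : ℤ) : ℝ)) atTop atTop := by
  have hinj : Function.Injective (Int.castRingHom ℝ) := Int.cast_injective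
  have ht := (tendsto_atTop_of_leadingCoeff_nonneg (h.map (Int.castRingHom ℝ))
    (by rwa [← natDegree_pos_iff_degree_pos, natDegree_map_eq_of_injective hinj])
    (by
      rw [leadingCoeff_map_of_injective hinj]
      exact Int.cast_nonneg hlc.le)).comp (tendsto_natCast_atTop_atTop (R := ℝ))
  simpa [Function.comp_def, eval_natCast_map] using ht

theorem eventually_pow_le_eval {h : ℤ[X]} (hlc : 0 < h.leadingCoeff) {d : ℕ}
    (hd : d < h.natDegree) :
    ∀ᶠ n : ℕ in atTop, (n : ℝ) ^ d ≤ ((h.eval (n : ℤ) : ℤ) : ℝ) := by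
  have hinj : Function.Injective (Int.castRingHom ℝ) := Int.cast_injective
  have hdeg : (X ^ d : ℝ[X]).degree < (h.map (Int.castRingHom ℝ)).degree := by
    rw [degree_X_pow, degree_map_eq_of_injective hinj,
      degree_eq_natDegree (leadingCoeff_ne_zero.mp hlc.ne')]
    exact_mod_cast hd
  have ho := isLittleO_atTop_of_degree_lt _ _ hdeg
  filter_upwards [(ho.comp_tendsto tendsto_natCast_atTop_atTop).def one_pos,
    (tendsto_eval_natCast_atTop hlc (by omega)).eventually_ge_atTop 0] with n hn hn0
  simp only [Function.comp_apply, eval_natCast_map, eq_intCast] at hn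
  simp only [eval_pow, eval_X, one_mul, norm_pow, RCLike.norm_natCast, Real.norm_eq_abs,
    abs_of_nonneg hn0] at hn
  simpa using hn

theorem eventually_eval_ne_zero {H : ℤ[X]} (hH : H ≠ 0) :
    ∀ᶠ n : ℕ in atTop, H.eval (n : ℤ) ≠ 0 := by
  rw [← Nat.cofinite_eq_atTop]
  refine ((H.roots.toFinset.finite_toSet).preimage
    (Nat.cast_injective (R := ℤ)).injOn).subset fun n hn => ?_
  simpa [hH] using hn

/-- If all complex roots of `H` have small degree over `ℚ` compared with the degree of `h`, then
the values of `H` are smooth relative to those of `h`. -/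
theorem eventually_smooth {H h : ℤ[X]} (hH : H ≠ 0) {d e : ℕ} {ε : ℝ} (hε : 0 < ε)
    (hd : ∀ t : ℂ, aeval t H = 0 → (minpoly ℚ t).natDegree ≤ d)
    (hlc : 0 < h.leadingCoeff) (he : e < h.natDegree) (hde : (d + 1 : ℝ) ≤ ε * e) :
    ∀ᶠ n : ℕ in atTop, ∀ p : ℕ, p.Prime → (p : ℤ) ∣ H.eval (n : ℤ) →
      (p : ℝ) ≤ ((h.eval (n : ℤ) : ℤ) : ℝ) ^ ε := by
  have hfac : ∀ᶠ n : ℕ in atTop, ∀ q ∈ (UniqueFactorizationMonoid.factors H).toFinset,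
      |((q.eval (n : ℤ) : ℤ) : ℝ)| ≤ (n : ℝ) ^ (d + 1) := by
    rw [Filter.eventually_all_finset]
    intro q hq
    rw [Multiset.mem_toFinset] at hq
    exact eventually_abs_eval_le_pow q (natDegree_le_of_irreducible_dvd_s1 hd
      (UniqueFactorizationMonoid.irreducible_of_factor q hq)
      (UniqueFactorizationMonoid.dvd_of_mem_factors hq))
  filter_upwards [hfac, eventually_pow_le_eval hlc he, eventually_eval_ne_zero hH,
    eventually_ge_atTop 1] with n hn hpow hne h1 p hp hpd
  have hdvd : H.eval (n : ℤ) ∣ ((UniqueFactorizationMonoid.factors H).map (eval (n : ℤ))).prod := by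
    rw [← eval_multiset_prod]
    exact eval_dvd (UniqueFactorizationMonoid.factors_prod hH).symm.dvd
  obtain ⟨q, hq, hpq⟩ := (Nat.prime_iff_prime_int.mp hp).exists_mem_multiset_map_dvd
    (hpd.trans hdvd)
  have hq0 : q.eval (n : ℤ) ≠ 0 := fun h0 => hne (zero_dvd_iff.mp
    (h0 ▸ eval_dvd (UniqueFactorizationMonoid.dvd_of_mem_factors hq)))
  have hle : (p : ℤ) ≤ |q.eval (n : ℤ)| := Int.le_of_dvd (abs_pos.mpr hq0) ((dvd_abs _ _).mpr hpq)
  have h1' : (1 : ℝ) ≤ n := by exact_mod_cast h1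
  calc (p : ℝ) ≤ |((q.eval (n : ℤ) : ℤ) : ℝ)| := by exact_mod_cast hle
    _ ≤ (n : ℝ) ^ (d + 1) := hn q (Multiset.mem_toFinset.mpr hq)
    _ = (n : ℝ) ^ ((d + 1 : ℝ)) := by rw [← Real.rpow_natCast]; push_cast; rfl
    _ ≤ (n : ℝ) ^ (ε * e) := Real.rpow_le_rpow_of_exponent_le h1' hde
    _ = ((n : ℝ) ^ e) ^ ε := by
      rw [mul_comm, Real.rpow_mul (by positivity), Real.rpow_natCast]
    _ ≤ _ := Real.rpow_le_rpow (by positivity) hpow hε.le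

/-- A quadratic `f` admits substitutions `h` of degree `2 * k + 1` such that all roots of
`f.comp h` have degree at most `4 * φ (2 * k + 1)` over `ℚ`. -/
theorem exists_comp_roots_mem_field (f : ℤ[X]) (hf : f.natDegree = 2) (k : ℕ)
    (hk : IsCoprime ((2 * k + 1 : ℕ) : ℤ) (2 * f.coeff 2)) :
    ∃ h : ℤ[X], 0 < h.leadingCoeff ∧ h.natDegree = 2 * k + 1 ∧
      ∀ t : ℂ, aeval t (f.comp h) = 0 →
        (minpoly ℚ t).natDegree ≤ 4 * (2 * k + 1).totient := by
  set a := f.coeff 2 with ha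
  set b := f.coeff 1 with hb
  set c := f.coeff 0 with hc
  have ha0 : a ≠ 0 := by
    rw [ha, ← hf]
    exact leadingCoeff_ne_zero.mpr fun h => by simp [h] at hf
  set A := 2 * a with hA
  have hA0 : A ≠ 0 := by omega
  set Q := lucasQuotient k with hQ
  set R := Q.divX with hR
  set s := Q.eval (A ^ 2 * (b ^ 2 - 4 * a * c)) with hs
  have hQR : Q = R * X + C (2 * k + 1 : ℤ) := by
    rw [← lucasQuotient_eval_zero k, ← coeff_zero_eq_eval_zero]
    exact (divX_mul_X_add Q).symm
  have hs0 : s ≠ 0 := by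
    have : s = 2 * (2 * a ^ 2 * (b ^ 2 - 4 * a * c)
        * R.eval (A ^ 2 * (b ^ 2 - 4 * a * c)) + k) + 1 := by
      rw [hs, hQR]
      simp only [eval_add, eval_mul, eval_X, eval_C]
      rw [hA]
      ring
    omega
  obtain ⟨u, v, huv⟩ := hk
  push_cast at huv
  set W : ℤ[X] := C A * X + C (u * b) with hW
  set h : ℤ[X] := C (-v * b) + C (2 * k + 1 : ℤ) * X +
    C (A * s ^ 2) * W ^ 3 * R.comp (C (A ^ 2 * s ^ 2) * W ^ 2) with hh
  have hkey : C A * h + C b = W * Q.comp (C (A ^ 2 * s ^ 2) * W ^ 2) := by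
    have hlin : W * C (2 * k + 1 : ℤ) = C A * C (-v * b) + C A * (C (2 * k + 1 : ℤ) * X) + C b := by
      have : C (u * b) * C (2 * k + 1 : ℤ) = C A * C (-v * b) + C b := by
        rw [← C_mul, ← C_mul, ← C_add]
        congr 1
        linear_combination b * huv
      rw [hW]
      linear_combination this
    rw [hQR, add_comp, mul_comp, X_comp, C_comp, hh]
    simp only [C_mul, C_pow] at hlin ⊢
    linear_combination -hlin
  have hWd : W.natDegree = 1 := natDegree_linear hA0
  have hWl : W.leadingCoeff = A := leadingCoeff_linear hA0
  have hc0 : A ^ 2 * s ^ 2 ≠ 0 := by positivity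
  obtain ⟨hQm, hQd⟩ := lucasQuotient_monic_natDegree k
  have hSd : (C (A ^ 2 * s ^ 2) * W ^ 2).natDegree = 2 := by
    rw [natDegree_C_mul hc0, natDegree_pow, hWd]
  have hcompd : (Q.comp (C (A ^ 2 * s ^ 2) * W ^ 2)).natDegree = 2 * k := by
    rw [natDegree_comp, hSd, hQd, mul_comm]
  have hcompl : (Q.comp (C (A ^ 2 * s ^ 2) * W ^ 2)).leadingCoeff
      = (A ^ 2 * s ^ 2 * A ^ 2) ^ k := by
    rw [leadingCoeff_comp (by omega), hQm.leadingCoeff, hQd, leadingCoeff_mul, leadingCoeff_C,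
      leadingCoeff_pow, hWl, one_mul]
  have hcompl0 : (0 : ℤ) < (A ^ 2 * s ^ 2 * A ^ 2) ^ k := by positivity
  have hW0 : W ≠ 0 := fun h => by simp [h] at hWd
  have hprodd : (W * Q.comp (C (A ^ 2 * s ^ 2) * W ^ 2)).natDegree = 2 * k + 1 := by
    rw [natDegree_mul hW0 (leadingCoeff_ne_zero.mp (hcompl ▸ hcompl0.ne')), hWd, hcompd, add_comm]
  have hAh : C A * h = W * Q.comp (C (A ^ 2 * s ^ 2) * W ^ 2) - C b := by
    rw [← hkey, add_sub_cancel_right]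
  have hlt : (C b).natDegree < (W * Q.comp (C (A ^ 2 * s ^ 2) * W ^ 2)).natDegree := by
    rw [natDegree_C, hprodd]
    omega
  have hhd : h.natDegree = 2 * k + 1 := by
    rw [← natDegree_C_mul hA0, hAh, natDegree_sub_eq_left_of_natDegree_lt hlt, hprodd]
  have hhl : h.leadingCoeff = (A ^ 2 * s ^ 2 * A ^ 2) ^ k := by
    have := congrArg leadingCoeff hAh
    rw [leadingCoeff_sub_of_degree_lt (degree_lt_degree hlt), leadingCoeff_mul, leadingCoeff_mul,
      leadingCoeff_C, hWl, hcompl] at this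
    exact mul_left_cancel₀ hA0 this
  refine ⟨h, hhl ▸ hcompl0, hhd, fun t ht => ?_⟩
  have hkey' := congrArg (aeval t) hkey
  simp only [map_add, map_mul, aeval_C, aeval_comp, map_pow, hW, aeval_X] at hkey'
  simp only [algebraMap_int_eq, eq_intCast] at hkey'
  have hquad : (a : ℂ) * aeval t h ^ 2 + b * aeval t h + c = 0 := by
    rw [← ht, aeval_comp, aeval_eq_sum_range (p := f), hf]
    simp only [Finset.sum_range_succ, Finset.sum_range_zero, ← ha, ← hb, ← hc, zsmul_eq_mul]
    ring
  generalize aeval t h = x at hkey' hquad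
  have hAC : (A : ℂ) = 2 * a := by rw [hA]; push_cast; ring
  have hy : (A * (A * x + b) : ℂ) ^ 2 = ((A ^ 2 * (b ^ 2 - 4 * a * c) : ℤ) : ℂ) := by
    push_cast
    rw [hAC]
    linear_combination 16 * (a : ℂ) ^ 3 * hquad
  obtain ⟨K, hfin, hrank, hK⟩ := exists_field_of_lucas_eq k hy
  have hsQ : aeval ((A * (A * x + b) : ℂ) ^ 2) (lucasQuotient k) = (s : ℂ) := by
    rw [hy, hs, ← eq_intCast (algebraMap ℤ ℂ), aeval_algebraMap_apply, coe_aeval_eq_eval,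
      eq_intCast]
  have hmem := hK (A * s * (A * t + u * b)) (by
    rw [hsQ, hkey']
    have : (A * s * (A * t + u * b) : ℂ) ^ 2
      = A ^ 2 * s ^ 2 * (A * t + ((u * b : ℤ) : ℂ)) ^ 2 := by push_cast; ring
    rw [this]
    push_cast
    ring)
  have hAC0 : (A : ℂ) ≠ 0 := Int.cast_ne_zero.mpr hA0
  have hsC0 : (s : ℂ) ≠ 0 := Int.cast_ne_zero.mpr hs0
  have htK : t ∈ K := by
    have ht' : t = (A * s * (A * t + u * b) / (A * s) - u * b) / A := by
      field_simp
      ring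
    rw [ht']
    exact div_mem (sub_mem (div_mem hmem (mul_mem (intCast_mem K A) (intCast_mem K s)))
      (mul_mem (intCast_mem K u) (intCast_mem K b))) (intCast_mem K A)
  rw [← IntermediateField.minpoly_eq (⟨t, htK⟩ : K)]
  exact (minpoly.natDegree_le _).trans hrank

theorem quadratic_smooth_values_infinite (ε : ℝ) (hε : 0 < ε)
    (f : Polynomial ℤ) (hf : f.natDegree = 2) :
    {n : ℕ | f.eval (n : ℤ) ≠ 0 ∧
      ∀ p : ℕ, p.Prime → (p : ℤ) ∣ f.eval (n : ℤ) → (p : ℝ) ≤ (n : ℝ) ^ ε}.Infinite := by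
  have ha0 : f.coeff 2 ≠ 0 := by
    rw [← hf]
    exact leadingCoeff_ne_zero.mpr fun h => by simp [h] at hf
  obtain ⟨m, hm, hcop, hφ⟩ := exists_coprime_totient_le_s1 (2 * f.coeff 2).natAbs (by omega)
    (δ := min (ε / 10) (1 / 2)) (by positivity)
  have hodd : Odd m := by
    rw [Int.natAbs_mul] at hcop
    exact Nat.coprime_two_right.mp hcop.coprime_mul_right_right
  obtain ⟨k, rfl⟩ := hodd
  have htot : (1 : ℝ) ≤ (2 * k + 1).totient := by
    exact_mod_cast Nat.totient_pos.mpr hm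
  have hm' : (0 : ℝ) ≤ ((2 * k + 1 : ℕ) : ℝ) := by positivity
  have h1 := hφ.trans (mul_le_mul_of_nonneg_right (min_le_left _ _) hm')
  have h2 := hφ.trans (mul_le_mul_of_nonneg_right (min_le_right _ _) hm')
  push_cast at h1 h2
  have hk : (1 : ℝ) ≤ 2 * k := by linarith
  obtain ⟨h, hlc, hdeg, hroots⟩ := exists_comp_roots_mem_field f hf k
    (Int.isCoprime_iff_gcd_eq_one.mpr hcop)
  have hcomp : f.comp h ≠ 0 := by
    intro h0
    have := natDegree_comp (p := f) (q := h)
    rw [h0, hf, hdeg, natDegree_zero] at this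
    omega
  have hsmooth := eventually_smooth hcomp hε hroots hlc (e := 2 * k) (by omega) (by
    push_cast
    nlinarith [mul_le_mul_of_nonneg_left hk hε.le])
  have htend : Tendsto (fun n : ℕ => (h.eval (n : ℤ)).toNat) atTop atTop := by
    have ht : Tendsto (fun n : ℕ => h.eval (n : ℤ)) atTop atTop :=
      tendsto_intCast_atTop_iff.mp (tendsto_eval_natCast_atTop hlc (by omega))
    refine tendsto_atTop.mpr fun N => ?_
    filter_upwards [ht.eventually_ge_atTop (N : ℤ)] with n hn
    omega
  refine Nat.frequently_atTop_iff_infinite.mp (htend.frequently (Eventually.frequently ?_))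
  filter_upwards [hsmooth, eventually_eval_ne_zero hcomp,
    htend.eventually_ge_atTop 1] with n hn hne hpos
  have hcast : (((h.eval (n : ℤ)).toNat : ℕ) : ℤ) = h.eval (n : ℤ) := by omega
  rw [eval_comp] at hne
  simp only [eval_comp] at hn
  have hcastR : (((h.eval (n : ℤ)).toNat : ℕ) : ℝ) = ((h.eval (n : ℤ) : ℤ) : ℝ) := by
    exact_mod_cast congrArg (Int.cast (R := ℝ)) hcast
  rw [hcast, hcastR]
  exact ⟨hne, hn⟩
end

section
/- Let f ∈ ℤ[t] be irreducible of positive degree, and let α be a root of f in an algebraic closure of ℚ. Suppose that γ is an element of the subfield ℚ(α) and that g ∈ ℤ[t] has degree k ≥ 2 and satisfies α = g(γ). Then the minimal polynomial of γ over ℚ divides f(g(t)) in ℚ[t], this minimal polynomial has degree equal to deg f, every irreducible factor of f(g(t)) in ℚ[t] has degree at most (deg f)·(k − 1), and hence f admits polysmoothness 1 − 1/k. -/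
open Polynomial

open IntermediateField in
/-- Over a field, if `α = g(γ)` with `γ ∈ K(α)` then `α` and `γ` have the same degree. -/
theorem natDegree_minpoly_eq_of_aeval_eq {K L : Type*} [Field K] [Field L] [Algebra K L]
    {α γ : L} (hαi : IsIntegral K α) (hγi : IsIntegral K γ) (hγ : γ ∈ K⟮α⟯)
    {g : K[X]} (hg : aeval γ g = α) :
    (minpoly K γ).natDegree = (minpoly K α).natDegree := by
  have h : K⟮γ⟯ = K⟮α⟯ := by
    apply le_antisymm
    · exact adjoin_simple_le_iff.mpr hγ
    · exact adjoin_simple_le_iff.mpr (hg ▸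
        algebra_adjoin_le_adjoin K {γ} (aeval_mem_adjoin_singleton K γ))
  rw [← adjoin.finrank hγi, ← adjoin.finrank hαi, h]

/-- If `p` is divisible by a polynomial `m` of degree `n` and has degree `n * k` with `2 ≤ k`,
then irreducible factors of `p` have degree at most `n * (k - 1)`. -/
theorem natDegree_le_of_irreducible_of_dvd {K : Type*} [Field K] {p m q : K[X]} {n k : ℕ}
    (hp0 : p ≠ 0) (hmp : m ∣ p) (hm : m.natDegree = n) (hp : p.natDegree = n * k)
    (hk : 2 ≤ k) (hq : Irreducible q) (hqp : q ∣ p) : q.natDegree ≤ n * (k - 1) := by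
  obtain ⟨h, rfl⟩ := hmp
  have hm0 := left_ne_zero_of_mul hp0
  have hh0 := right_ne_zero_of_mul hp0
  rw [natDegree_mul hm0 hh0, hm] at hp
  rcases hq.prime.dvd_or_dvd hqp with hd | hd
  · calc q.natDegree ≤ n := hm ▸ natDegree_le_of_dvd hd hm0
      _ ≤ n * (k - 1) := Nat.le_mul_of_pos_right n (by lia)
  · refine (natDegree_le_of_dvd hd hh0).trans ?_
    rw [Nat.mul_sub_one]
    lia

theorem minpoly_divides_comp_of_root_eq_image
    (f : Polynomial ℤ) (hf0 : 0 < f.natDegree) (hfirr : Irreducible f)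
    (α : AlgebraicClosure ℚ) (hα : Polynomial.aeval α f = 0)
    (γ : AlgebraicClosure ℚ)
    (hγ : γ ∈ IntermediateField.adjoin ℚ ({α} : Set (AlgebraicClosure ℚ)))
    (g : Polynomial ℤ) (k : ℕ) (hk : g.natDegree = k) (hk2 : 2 ≤ k)
    (hgγ : Polynomial.aeval γ g = α) :
    minpoly ℚ γ ∣ (f.comp g).map (Int.castRingHom ℚ) ∧
    (minpoly ℚ γ).natDegree = f.natDegree ∧
    (∀ q : Polynomial ℚ, Irreducible q → q ∣ (f.comp g).map (Int.castRingHom ℚ) →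
      q.natDegree ≤ f.natDegree * (k - 1)) ∧
    AdmitsPolysmoothness f (1 - 1 / (k : ℝ)) := by
  have hinj : Function.Injective (Int.castRingHom ℚ) := Int.cast_injective
  have haeval (x : AlgebraicClosure ℚ) (p : ℤ[X]) :
      aeval x (p.map (Int.castRingHom ℚ)) = aeval x p := aeval_map_algebraMap ℚ x p
  have hdvd : minpoly ℚ γ ∣ (f.comp g).map (Int.castRingHom ℚ) :=
    minpoly.dvd ℚ γ (by rw [haeval, aeval_comp, hgγ, hα])
  have hirr : Irreducible (f.map (Int.castRingHom ℚ)) :=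
    (IsPrimitive.Int.irreducible_iff_irreducible_map_cast (hfirr.isPrimitive hf0.ne')).mp hfirr
  have hdegα : (minpoly ℚ α).natDegree = f.natDegree := by
    rw [← minpoly.eq_of_irreducible hirr (by rw [haeval, hα]),
      natDegree_mul_leadingCoeff_inv _ hirr.ne_zero, natDegree_map_eq_of_injective hinj]
  have hcomp : ((f.comp g).map (Int.castRingHom ℚ)).natDegree = f.natDegree * k := by
    rw [natDegree_map_eq_of_injective hinj, natDegree_comp, hk]
  have hcomp0 : (f.comp g).map (Int.castRingHom ℚ) ≠ 0 :=
    ne_zero_of_natDegree_gt (n := 0) (hcomp ▸ Nat.mul_pos hf0 (by lia))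
  have hαi : IsIntegral ℚ α :=
    IsAlgebraic.isIntegral ⟨_, hirr.ne_zero, (haeval α f).trans hα⟩
  have hγi : IsIntegral ℚ γ :=
    IsAlgebraic.isIntegral ⟨_, hcomp0, by rw [haeval, aeval_comp, hgγ, hα]⟩
  have hdeg : (minpoly ℚ γ).natDegree = f.natDegree :=
    (natDegree_minpoly_eq_of_aeval_eq hαi hγi hγ ((haeval γ g).trans hgγ)).trans hdegα
  have hfactor (q : ℚ[X]) (hq : Irreducible q)
      (hqd : q ∣ (f.comp g).map (Int.castRingHom ℚ)) : q.natDegree ≤ f.natDegree * (k - 1) :=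
    natDegree_le_of_irreducible_of_dvd hcomp0 hdvd hdeg hcomp hk2 hq hqd
  refine ⟨hdvd, hdeg, hfactor, g, by lia, fun q hq hqd ↦ ?_⟩
  have hle : q.natDegree ≤ f.natDegree * (k - 1) := by
    rcases eq_or_ne q.natDegree 0 with h0 | h0
    · simp [h0]
    · rw [← natDegree_map_eq_of_injective hinj q]
      exact hfactor _ ((IsPrimitive.Int.irreducible_iff_irreducible_map_cast (hq.isPrimitive h0)).mp hq)
        (Polynomial.map_dvd _ hqd)
  have hk0 : (k : ℝ) ≠ 0 := by
    have : k ≠ 0 := by lia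
    exact_mod_cast this
  calc (q.natDegree : ℝ) ≤ (f.natDegree * (k - 1) : ℕ) := by exact_mod_cast hle
    _ = (1 - 1 / (k : ℝ)) * f.natDegree * g.natDegree := by
      rw [hk, Nat.cast_mul, Nat.cast_sub (by lia)]
      field_simp
      push_cast
      ring
end

section
/- Suppose that f ∈ ℤ[t] is irreducible and that f(t) = g(h(t)) − t, where g, h ∈ ℤ[t] each have degree exceeding 1. Let α be a root of f in an algebraic closure of ℚ. Then f(g(t)) is divisible in ℚ[t] by the minimal polynomial of h(α) over ℚ, this minimal polynomial has degree equal to deg f, and hence f admits polysmoothness 1 − 1/deg(g). -/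
open Polynomial

/-- A non-constant irreducible integer polynomial is irreducible over `ℚ`. -/
theorem irreducible_map_rat {q : Polynomial ℤ} (hq : Irreducible q) (hdeg : q.natDegree ≠ 0) :
    Irreducible (q.map (Int.castRingHom ℚ)) :=
  (Polynomial.IsPrimitive.Int.irreducible_iff_irreducible_map_cast
    (hq.isPrimitive hdeg)).mp hq

/-- The minimal polynomial of a root of a non-constant irreducible integer polynomial has the same
degree as that polynomial. -/
theorem natDegree_minpoly_of_irreducible {K : Type*} [Field K] [Algebra ℚ K] {f : Polynomial ℤ}
    (hf : Irreducible f) (hdeg : f.natDegree ≠ 0) {α : K} (hα : Polynomial.aeval α f = 0) :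
    (minpoly ℚ α).natDegree = f.natDegree := by
  have hirr := irreducible_map_rat hf hdeg
  have hroot : Polynomial.aeval α (f.map (Int.castRingHom ℚ)) = 0 := by
    rw [← algebraMap_int_eq, Polynomial.aeval_map_algebraMap, hα]
  rw [← minpoly.eq_of_irreducible hirr hroot, Polynomial.natDegree_mul_C
    (inv_ne_zero (Polynomial.leadingCoeff_ne_zero.mpr hirr.ne_zero)),
    Polynomial.natDegree_map_eq_of_injective (RingHom.injective_int _)]

/-- If each of two elements is an integer polynomial in the other, their minimal polynomials have
the same degree. -/
theorem natDegree_minpoly_eq_of_aeval_eq_s3 {K : Type*} [Field K] [Algebra ℚ K] {g h : Polynomial ℤ}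
    {α β : K} (hint : IsIntegral ℚ α) (hβ : Polynomial.aeval α h = β)
    (hα : Polynomial.aeval β g = α) :
    (minpoly ℚ β).natDegree = (minpoly ℚ α).natDegree := by
  have mem (p : Polynomial ℤ) (x : K) :
      Polynomial.aeval x p ∈ IntermediateField.adjoin ℚ {x} := by
    rw [← Polynomial.aeval_map_algebraMap ℚ]
    exact IntermediateField.algebra_adjoin_le_adjoin ℚ _ (Polynomial.aeval_mem_adjoin_singleton ℚ x)
  have hadj : IntermediateField.adjoin ℚ {β} = IntermediateField.adjoin ℚ {α} := by
    apply le_antisymm <;> rw [IntermediateField.adjoin_simple_le_iff]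
    · exact hβ ▸ mem h α
    · exact hα ▸ mem g β
  have hintβ : IsIntegral ℚ β := by
    have hm := mem h α
    rw [hβ] at hm
    have := IntermediateField.isAlgebraic_adjoin_simple hint
    exact (IntermediateField.isAlgebraic_iff.mp
      (Algebra.IsAlgebraic.isAlgebraic (R := ℚ)
        (⟨β, hm⟩ : IntermediateField.adjoin ℚ {α}))).isIntegral
  rw [← IntermediateField.adjoin.finrank hintβ, ← IntermediateField.adjoin.finrank hint, hadj]

/-- An irreducible factor over `ℤ` of a polynomial divisible by `m` over `ℚ` has degree at most
that of `m` or of the cofactor. -/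
theorem natDegree_le_or_of_dvd_map {F q : Polynomial ℤ} {m : Polynomial ℚ} (hF : F ≠ 0)
    (hm : m ∣ F.map (Int.castRingHom ℚ)) (hq : Irreducible q) (hqF : q ∣ F) :
    q.natDegree ≤ m.natDegree ∨ q.natDegree + m.natDegree ≤ F.natDegree := by
  rcases eq_or_ne q.natDegree 0 with h0 | h0
  · exact Or.inl (h0 ▸ Nat.zero_le _)
  have hinj : Function.Injective (Int.castRingHom ℚ) := RingHom.injective_int _
  obtain ⟨r, hr⟩ := hm
  have hmr : m * r ≠ 0 := hr ▸ (Polynomial.map_ne_zero_iff hinj).mpr hF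
  have hdeg := Polynomial.natDegree_mul (left_ne_zero_of_mul hmr) (right_ne_zero_of_mul hmr)
  rw [← hr, Polynomial.natDegree_map_eq_of_injective hinj] at hdeg
  have hdvd : q.map (Int.castRingHom ℚ) ∣ m * r := hr ▸ Polynomial.map_dvd _ hqF
  rw [← Polynomial.natDegree_map_eq_of_injective hinj q]
  rcases (irreducible_map_rat hq h0).prime.dvd_or_dvd hdvd with hd | hd
  · exact Or.inl (Polynomial.natDegree_le_of_dvd hd (left_ne_zero_of_mul hmr))
  · have := Polynomial.natDegree_le_of_dvd hd (right_ne_zero_of_mul hmr)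
    exact Or.inr (by omega)

theorem polysmoothness_of_comp_decomposition
    (f g h : Polynomial ℤ) (hfirr : Irreducible f)
    (hg : 1 < g.natDegree) (hh : 1 < h.natDegree)
    (hfgh : f = g.comp h - Polynomial.X)
    (α : AlgebraicClosure ℚ) (hα : Polynomial.aeval α f = 0) :
    minpoly ℚ (Polynomial.aeval α h) ∣ (f.comp g).map (Int.castRingHom ℚ) ∧
    (minpoly ℚ (Polynomial.aeval α h)).natDegree = f.natDegree ∧
    AdmitsPolysmoothness f (1 - 1 / (g.natDegree : ℝ)) := by
  have hdeg : f.natDegree = g.natDegree * h.natDegree := by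
    rw [hfgh, Polynomial.natDegree_sub_eq_left_of_natDegree_lt, Polynomial.natDegree_comp]
    rw [Polynomial.natDegree_X, Polynomial.natDegree_comp]
    nlinarith
  have hpos : 0 < f.natDegree := hdeg ▸ Nat.mul_pos (by omega) (by omega)
  have hα' : Polynomial.aeval (Polynomial.aeval α h) g = α := by
    rw [hfgh, map_sub, Polynomial.aeval_comp, Polynomial.aeval_X] at hα
    exact sub_eq_zero.mp hα
  have hint : IsIntegral ℚ α := by
    refine IsAlgebraic.isIntegral ⟨f.map (algebraMap ℤ ℚ), ?_, ?_⟩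
    · exact (Polynomial.map_ne_zero_iff (RingHom.injective_int _)).mpr hfirr.ne_zero
    · rw [Polynomial.aeval_map_algebraMap, hα]
  have hdvd : minpoly ℚ (Polynomial.aeval α h) ∣ (f.comp g).map (Int.castRingHom ℚ) := by
    apply minpoly.dvd
    rw [← algebraMap_int_eq, Polynomial.aeval_map_algebraMap, Polynomial.aeval_comp, hα', hα]
  have hmin : (minpoly ℚ (Polynomial.aeval α h)).natDegree = f.natDegree :=
    (natDegree_minpoly_eq_of_aeval_eq_s3 hint rfl hα').trans
      (natDegree_minpoly_of_irreducible hfirr hpos.ne' hα)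
  refine ⟨hdvd, hmin, g, by omega, fun q hq hqf => ?_⟩
  have hcomp : (f.comp g).natDegree = f.natDegree * g.natDegree := Polynomial.natDegree_comp
  have hne : f.comp g ≠ 0 :=
    Polynomial.ne_zero_of_natDegree_gt (n := 0) (hcomp ▸ Nat.mul_pos hpos (by omega))
  have hbound : q.natDegree + f.natDegree ≤ f.natDegree * g.natDegree := by
    rcases natDegree_le_or_of_dvd_map hne hdvd hq hqf with hle | hle
    · rw [hmin] at hle
      nlinarith
    · rwa [hmin, hcomp] at hle
  have hg0 : (g.natDegree : ℝ) ≠ 0 := by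
    exact_mod_cast (by omega : g.natDegree ≠ 0)
  have hrhs : (1 - 1 / (g.natDegree : ℝ)) * f.natDegree * g.natDegree =
      f.natDegree * g.natDegree - f.natDegree := by
    field_simp
  rw [hrhs, le_sub_iff_add_le]
  exact_mod_cast hbound
end

section
/- (Capelli) Let f ∈ ℚ[t] be monic and irreducible, let α be a root of f in an algebraic closure of ℚ, and put K = ℚ(α). Let g ∈ ℚ[t], and suppose that g(t) − α factors over K[t] as g(t) − α = a_1(t)^{r_1} ··· a_k(t)^{r_k}, where the a_j(t) are pairwise non-associate irreducible polynomials in K[t]. For each j let A_j(t) = ∏_σ a_j^σ(t), the product taken over the deg(f) embeddings σ of K into the algebraic closure of ℚ (equivalently, over the roots β of f, substituting β for α in the coefficients of a_j). Then each A_j lies in ℚ[t] and is irreducible over ℚ, and f(g(t)) = A_1(t)^{r_1} ··· A_k(t)^{r_k} is the factorisation of f(g(t)) into irreducibles in ℚ[t]. -/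
open Polynomial

section EmbeddingProducts

variable {F K Ω : Type*} [Field F] [Field K] [Field Ω] [Algebra F K] [Algebra F Ω]

/-- The product of the conjugates of a polynomial over `K` has coefficients in the base field. -/
theorem exists_map_eq_prod_map_algHom [IsGalois F Ω] [Fintype (K →ₐ[F] Ω)] (p : K[X]) :
    ∃ A : F[X], A.map (algebraMap F Ω) = ∏ σ : K →ₐ[F] Ω, p.map (σ : K →+* Ω) := by
  rw [← mem_lifts, lifts_iff_coeff_lifts]
  intro n
  rw [InfiniteGalois.mem_range_algebraMap_iff_fixed]
  intro τ
  change (τ : Ω →+* Ω) _ = _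
  rw [← coeff_map, Polynomial.map_prod]
  congr 1
  refine Fintype.prod_equiv
    ⟨fun σ => (τ : Ω →ₐ[F] Ω).comp σ, fun σ => (τ.symm : Ω →ₐ[F] Ω).comp σ,
      fun σ => by ext; simp, fun σ => by ext; simp⟩ _ _ fun σ => ?_
  rw [Polynomial.map_map]
  rfl

/-- The minimal polynomial of a separable element `x` is the product of the linear factors
`X - σ x` over the embeddings `σ` of `F⟮x⟯`. -/
theorem map_minpoly_eq_prod_X_sub_C_algHom_gen [IsAlgClosed Ω] {x : K} (hx : IsSeparable F x)
    [Fintype (IntermediateField.adjoin F {x} →ₐ[F] Ω)] :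
    (minpoly F x).map (algebraMap F Ω) =
      ∏ σ : IntermediateField.adjoin F {x} →ₐ[F] Ω,
        (X - C (σ (IntermediateField.AdjoinSimple.gen F x))) := by
  classical
  have hint : IsIntegral F x := hx.isIntegral
  have hsplits := IsAlgClosed.splits ((minpoly F x).map (algebraMap F Ω))
  have hnodup : ((minpoly F x).aroots Ω).Nodup :=
    (nodup_aroots_iff_of_splits (minpoly.ne_zero hint) hsplits).2 hx
  rw [hsplits.eq_prod_roots_of_monic ((minpoly.monic hint).map _)]
  let e := IntermediateField.algHomAdjoinIntegralEquiv F (K := Ω) hint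
  have he (σ) : σ (IntermediateField.AdjoinSimple.gen F x) = (e σ : Ω) := by
    rw [← IntermediateField.algHomAdjoinIntegralEquiv_symm_apply_gen F hint, e.symm_apply_apply]
  have hroots : Finset.univ.val.map
      (fun σ : IntermediateField.adjoin F {x} →ₐ[F] Ω =>
        σ (IntermediateField.AdjoinSimple.gen F x)) = (minpoly F x).aroots Ω := by
    refine (Multiset.Nodup.ext (Multiset.Nodup.map ?_ Finset.univ.nodup) hnodup).2 fun y => ?_
    · intro σ τ h
      simp only [he] at h
      exact e.injective (Subtype.ext h)
    · simp only [Multiset.mem_map, Finset.mem_val, Finset.mem_univ, true_and, he]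
      exact ⟨fun ⟨σ, h⟩ => h ▸ (e σ).2, fun h => ⟨e.symm ⟨y, h⟩, by simp⟩⟩
  change (((minpoly F x).aroots Ω).map _).prod = _
  rw [← hroots, Multiset.map_map]
  rfl

/-- If the embeddings of `K` are separated by `x`, and `p` is an irreducible factor of `g - x` over
`K`, then the product of the conjugates of `p` is irreducible over the base field. -/
theorem irreducible_of_map_eq_prod_map_algHom [IsAlgClosed Ω] [FiniteDimensional F K]
    [Fintype (K →ₐ[F] Ω)] {x : K} (hx : Function.Injective fun σ : K →ₐ[F] Ω => σ x)
    {g : F[X]} {p : K[X]} (hp : Irreducible p) (hpg : p ∣ g.map (algebraMap F K) - C x)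
    {A : F[X]} (hA : A.map (algebraMap F Ω) = ∏ σ : K →ₐ[F] Ω, p.map (σ : K →+* Ω)) :
    Irreducible A := by
  have : Fact (Irreducible p) := ⟨hp⟩
  have hint : IsIntegral F (AdjoinRoot.root p) :=
    isIntegral_trans _ (AdjoinRoot.isIntegral_root hp.ne_zero)
  set h := minpoly F (AdjoinRoot.root p)
  have hph : p ∣ h.map (algebraMap F K) := by
    rw [← AdjoinRoot.mk_eq_zero, ← AdjoinRoot.aeval_eq, aeval_map_algebraMap]
    exact minpoly.aeval _ _
  have hcomp (σ : K →ₐ[F] Ω) (q : F[X]) :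
      (q.map (algebraMap F K)).map (σ : K →+* Ω) = q.map (algebraMap F Ω) := by
    rw [Polynomial.map_map, AlgHom.comp_algebraMap]
  have hAh : A ∣ h := by
    rw [← map_dvd_map' (algebraMap F Ω), hA]
    refine Finset.prod_dvd_of_coprime (fun σ _ τ _ hστ => ?_) fun σ _ => ?_
    · have hdvd (σ : K →ₐ[F] Ω) :
          p.map (σ : K →+* Ω) ∣ g.map (algebraMap F Ω) - C (σ x) := by
        simpa [hcomp] using Polynomial.map_dvd (σ : K →+* Ω) hpg
      refine IsCoprime.of_isCoprime_of_dvd_left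
        (IsCoprime.of_isCoprime_of_dvd_right ?_ (hdvd τ)) (hdvd σ)
      have hne : σ x - τ x ≠ 0 := sub_ne_zero.2 (hx.ne hστ)
      refine ⟨-C (σ x - τ x)⁻¹, C (σ x - τ x)⁻¹, ?_⟩
      rw [← C_1, ← inv_mul_cancel₀ hne, C_mul, C_sub]
      ring
    · rw [← hcomp σ]
      exact Polynomial.map_dvd _ hph
  have hunit : ¬ IsUnit A := by
    intro hu
    have σ : K →ₐ[F] Ω := IsAlgClosed.lift
    have hu' : IsUnit (p.map (σ : K →+* Ω)) := by
      refine isUnit_of_dvd_unit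
        (Finset.dvd_prod_of_mem (fun τ : K →ₐ[F] Ω => p.map (τ : K →+* Ω)) (Finset.mem_univ σ)) ?_
      rw [← hA]
      exact hu.map (mapRingHom (algebraMap F Ω))
    exact hp.not_isUnit (isUnit_map _ |>.1 hu')
  exact ((minpoly.irreducible hint).dvd_iff.1 hAh).resolve_left hunit |>.irreducible_iff.1
    (minpoly.irreducible hint)

end EmbeddingProducts

theorem capelli
    (f : Polynomial ℚ) (hmonic : f.Monic) (hirr : Irreducible f)
    (α : AlgebraicClosure ℚ) (hα : Polynomial.aeval α f = 0)
    (K : IntermediateField ℚ (AlgebraicClosure ℚ))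
    (hK : K = IntermediateField.adjoin ℚ ({α} : Set (AlgebraicClosure ℚ)))
    [FiniteDimensional ℚ K]
    (αK : K) (hαK : (αK : AlgebraicClosure ℚ) = α)
    (g : Polynomial ℚ) (k : ℕ) (a : Fin k → Polynomial K) (r : Fin k → ℕ)
    (hairr : ∀ j, Irreducible (a j))
    (hrpos : ∀ j, 0 < r j)
    (hnonassoc : ∀ i j, i ≠ j → ¬ Associated (a i) (a j))
    (hfact : g.map (algebraMap ℚ K) - C αK = ∏ j, a j ^ r j) :
    ∃ A : Fin k → Polynomial ℚ,
      (∀ j, (A j).map (algebraMap ℚ (AlgebraicClosure ℚ)) =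
        ∏ σ : K →ₐ[ℚ] AlgebraicClosure ℚ, (a j).map (σ : K →+* AlgebraicClosure ℚ)) ∧
      (∀ j, Irreducible (A j)) ∧
      f.comp g = ∏ j, (A j) ^ (r j) := by
  subst hK
  obtain rfl : αK = IntermediateField.AdjoinSimple.gen ℚ α := Subtype.ext hαK
  have hf : minpoly ℚ α = f := (minpoly.eq_of_irreducible_of_monic hirr hα hmonic).symm
  have : Algebra.IsAlgebraic ℚ (AlgebraicClosure ℚ) := by
    convert AlgebraicClosure.isAlgebraic ℚ
    · rfl
    · exact Subsingleton.elim _ _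
  have : IsAlgClosure ℚ (AlgebraicClosure ℚ) := ⟨inferInstance, inferInstance⟩
  have : Normal ℚ (AlgebraicClosure ℚ) := IsAlgClosure.normal ℚ _
  have : IsGalois ℚ (AlgebraicClosure ℚ) := {}
  have hint : IsIntegral ℚ α := Algebra.IsIntegral.isIntegral α
  choose A hA using fun j => exists_map_eq_prod_map_algHom (F := ℚ) (Ω := AlgebraicClosure ℚ) (a j)
  refine ⟨A, hA, fun j => ?_, ?_⟩
  · refine irreducible_of_map_eq_prod_map_algHom (g := g)
      (x := IntermediateField.AdjoinSimple.gen ℚ α) (fun σ τ h => ?_) (hairr j) ?_ (hA j)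
    · exact (IntermediateField.adjoin.powerBasis hint).algHom_ext h
    · rw [hfact]
      exact (dvd_pow_self _ (hrpos j).ne').trans (Finset.dvd_prod_of_mem _ (Finset.mem_univ j))
  · apply Polynomial.map_injective (algebraMap ℚ (AlgebraicClosure ℚ)) (algebraMap ℚ _).injective
    have hσ (σ : IntermediateField.adjoin ℚ {α} →ₐ[ℚ] AlgebraicClosure ℚ) :
        g.map (algebraMap ℚ (AlgebraicClosure ℚ)) -
            C (σ (IntermediateField.AdjoinSimple.gen ℚ α)) =
          ∏ j, (a j).map (σ : _ →+* AlgebraicClosure ℚ) ^ r j := by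
      simpa [Polynomial.map_prod, Polynomial.map_map] using
        congrArg (Polynomial.map (σ : _ →+* AlgebraicClosure ℚ)) hfact
    rw [map_comp, ← hf,
      map_minpoly_eq_prod_X_sub_C_algHom_gen (Algebra.IsSeparable.isSeparable ℚ α),
      prod_comp, Polynomial.map_prod]
    simp only [sub_comp, X_comp, C_comp, Polynomial.map_pow, hA, ← Finset.prod_pow]
    rw [Finset.prod_comm]
    exact Finset.prod_congr rfl fun σ _ => hσ σ
end

section
/- Suppose that f ∈ ℚ[t] is irreducible of degree 3. Then there exists an infinite set S of quadratic polynomials g ∈ ℚ[y] such that f(g(y)) is reducible in ℚ[y] for every g ∈ S, and no two distinct elements g, g' of S are related by a substitution of y by a polynomial in y; equivalently (since only linear substitutions are possible between quadratics), there do not exist a, b ∈ ℚ with a ≠ 0 such that g'(y) = g(a·y + b) for distinct g, g' ∈ S. -/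
open Polynomial

/-- The value at `s` of the monic cubic with coefficients `1, p, q, r`. -/
def monicCubicEval (p q r s : ℚ) : ℚ := s ^ 3 + p * s ^ 2 + q * s + r

/-- The sum of the two roots of `quadraticThrough p q r s`. -/
def rootSum (p q s : ℚ) : ℚ := p ^ 2 - q - 2 * (p + s) * p + (p + s) ^ 2

/-- The quadratic polynomial sending `θ ^ 2 + (p + s) * θ` to `θ` for every root `θ` of the cubic
`X ^ 3 + p * X ^ 2 + q * X + r`. -/
noncomputable def quadraticThrough (p q r s : ℚ) : ℚ[X] :=
  C (-(monicCubicEval p q r s)⁻¹) * X ^ 2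
    + C ((monicCubicEval p q r s)⁻¹ * rootSum p q s) * X
    + C (-(monicCubicEval p q r s)⁻¹ * (r * (p + 2 * s)))

/-- The characteristic polynomial of `θ ^ 2 + (p + s) * θ` over `ℚ`, where `θ` is a root of the
cubic `X ^ 3 + p * X ^ 2 + q * X + r`. -/
noncomputable def generatorCharpoly (p q r s : ℚ) : ℚ[X] :=
  C 1 * X ^ 3 + C (-(p ^ 2 - 2 * q - (p + s) * p)) * X ^ 2
    + C (q ^ 2 - 2 * p * r + (p + s) * (3 * r - p * q) + (p + s) ^ 2 * q) * X
    + C (-(r * monicCubicEval p q r (-(p + s))))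

theorem natDegree_quadraticThrough {p q r s : ℚ} (hs : monicCubicEval p q r s ≠ 0) :
    (quadraticThrough p q r s).natDegree = 2 :=
  natDegree_quadratic (neg_ne_zero.mpr (inv_ne_zero hs))

theorem natDegree_generatorCharpoly (p q r s : ℚ) :
    (generatorCharpoly p q r s).natDegree = 3 :=
  natDegree_cubic one_ne_zero

theorem comp_quadraticThrough {l p q r s : ℚ} (hs : monicCubicEval p q r s ≠ 0) :
    (C l * (X ^ 3 + C p * X ^ 2 + C q * X + C r)).comp (quadraticThrough p q r s) =
      (C (l * (monicCubicEval p q r s)⁻¹ ^ 3) * generatorCharpoly p q r s) *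
        (generatorCharpoly p q r s).comp (C (-1) * X + C (rootSum p q s)) := by
  refine Polynomial.funext fun y => ?_
  simp only [quadraticThrough, generatorCharpoly, eval_comp, eval_mul, eval_add, eval_pow, eval_C,
    eval_X]
  field_simp
  simp only [monicCubicEval, rootSum]
  ring

theorem aeval_quadraticThrough {p q r s : ℚ} (hs : monicCubicEval p q r s ≠ 0) (x : ℂ) :
    (monicCubicEval p q r s : ℂ) * aeval x (quadraticThrough p q r s) =
      -(x ^ 2 - rootSum p q s * x + r * (p + 2 * s)) := by
  have hs' : (monicCubicEval p q r s : ℂ) ≠ 0 := by exact_mod_cast hs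
  simp only [quadraticThrough, map_add, map_mul, map_pow, aeval_C, aeval_X, eq_ratCast]
  push_cast
  field_simp
  ring

theorem aeval_quadraticThrough_generator {p q r s : ℚ} (hs : monicCubicEval p q r s ≠ 0) {θ : ℂ}
    (hθ : θ ^ 3 + p * θ ^ 2 + q * θ + r = 0) :
    aeval (θ ^ 2 + (p + s) * θ) (quadraticThrough p q r s) = θ := by
  have hs' : (monicCubicEval p q r s : ℂ) ≠ 0 := by exact_mod_cast hs
  refine mul_left_cancel₀ hs' ?_
  rw [aeval_quadraticThrough hs]
  simp only [monicCubicEval, rootSum]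
  push_cast
  linear_combination (-θ - p - 2 * s) * hθ

/-- A root of an irreducible rational cubic satisfies no nontrivial quadratic relation. -/
theorem coeff_eq_zero_of_quadratic_relation {f : ℚ[X]} (hirr : Irreducible f)
    (hdeg : f.natDegree = 3) {θ : ℂ} (hθ : aeval θ f = 0) {u v w : ℚ}
    (h : (u : ℂ) * θ ^ 2 + v * θ + w = 0) : u = 0 ∧ v = 0 := by
  have hroot : aeval θ (C u * X ^ 2 + C v * X + C w) = 0 := by simpa using h
  have hdvd : f ∣ C u * X ^ 2 + C v * X + C w :=
    (minpoly.eq_of_irreducible hirr hθ ▸ Dvd.intro _ rfl).trans (minpoly.dvd ℚ θ hroot)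
  have hzero : C u * X ^ 2 + C v * X + C w = 0 :=
    eq_zero_of_dvd_of_natDegree_lt hdvd (by
      rw [hdeg]
      exact natDegree_quadratic_le.trans_lt (by norm_num))
  constructor
  · simpa [coeff_X, coeff_C] using congrArg (coeff · 2) hzero
  · simpa [coeff_X, coeff_C] using congrArg (coeff · 1) hzero

theorem eq_of_quadraticThrough_equivalent {f : ℚ[X]} (hirr : Irreducible f)
    (hdeg : f.natDegree = 3) {p q r : ℚ} {θ : ℂ} (hf : aeval θ f = 0)
    (hθ : θ ^ 3 + p * θ ^ 2 + q * θ + r = 0) {s t a b : ℚ}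
    (hs : monicCubicEval p q r s ≠ 0) (ht : monicCubicEval p q r t ≠ 0)
    (h : quadraticThrough p q r t = (quadraticThrough p q r s).comp (C a * X + C b)) :
    s = t := by
  have hval := congrArg (aeval (θ ^ 2 + (p + t) * θ)) h
  rw [aeval_quadraticThrough_generator ht hθ, aeval_comp] at hval
  simp only [map_add, map_mul, aeval_C, aeval_X, eq_ratCast] at hval
  have hx := aeval_quadraticThrough hs ((a : ℂ) * (θ ^ 2 + (p + t) * θ) + b)
  have hβ := aeval_quadraticThrough hs (θ ^ 2 + (p + s) * θ)
  rw [← hval] at hx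
  rw [aeval_quadraticThrough_generator hs hθ] at hβ
  have hprod : ((a : ℂ) * (θ ^ 2 + (p + t) * θ) + b - (θ ^ 2 + (p + s) * θ)) *
      ((a : ℂ) * (θ ^ 2 + (p + t) * θ) + b + (θ ^ 2 + (p + s) * θ) - rootSum p q s) = 0 := by
    linear_combination hx - hβ
  rcases mul_eq_zero.mp hprod with h0 | h0
  · obtain ⟨h2, h1⟩ := coeff_eq_zero_of_quadratic_relation hirr hdeg hf
      (u := a - 1) (v := a * (p + t) - (p + s)) (w := b) (by
        push_cast
        linear_combination h0)
    linear_combination (p + t) * h2 - h1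
  · obtain ⟨h2, h1⟩ := coeff_eq_zero_of_quadratic_relation hirr hdeg hf
      (u := a + 1) (v := a * (p + t) + (p + s)) (w := b - rootSum p q s) (by
        push_cast
        linear_combination h0)
    linear_combination h1 - (p + t) * h2

theorem cubic_infinitely_many_inequivalent_quadratics
    (f : Polynomial ℚ) (hirr : Irreducible f) (hdeg : f.natDegree = 3) :
    ∃ S : Set (Polynomial ℚ), S.Infinite ∧
      (∀ g ∈ S, g.natDegree = 2) ∧
      (∀ g ∈ S, ∃ h₁ h₂ : Polynomial ℚ, 0 < h₁.natDegree ∧ 0 < h₂.natDegree ∧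
        f.comp g = h₁ * h₂) ∧
      (∀ g ∈ S, ∀ g' ∈ S, g ≠ g' →
        ¬ ∃ a b : ℚ, a ≠ 0 ∧ g' = g.comp (C a * X + C b)) := by
  obtain ⟨l, p, q, r, hl, hf⟩ : ∃ l p q r : ℚ, l ≠ 0 ∧
      f = C l * (X ^ 3 + C p * X ^ 2 + C q * X + C r) := by
    have hl : f.coeff 3 ≠ 0 := by
      rw [← hdeg]
      exact leadingCoeff_ne_zero.mpr hirr.ne_zero
    refine ⟨f.coeff 3, f.coeff 2 / f.coeff 3, f.coeff 1 / f.coeff 3, f.coeff 0 / f.coeff 3, hl,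
      Polynomial.funext fun y => ?_⟩
    rw [eval_eq_sum_range, hdeg]
    simp only [Finset.sum_range_succ, Finset.sum_range_zero, eval_mul, eval_add, eval_pow, eval_C,
      eval_X]
    field_simp
    ring
  have hne (s : ℚ) : monicCubicEval p q r s ≠ 0 := by
    intro hs
    have hroot : f.IsRoot s := by
      rw [IsRoot.def, hf]
      simp only [eval_mul, eval_add, eval_pow, eval_C, eval_X]
      rw [← monicCubicEval, hs, mul_zero]
    have : f.natDegree = 1 :=
      natDegree_eq_of_degree_eq_some (degree_eq_one_of_irreducible_of_root hirr hroot)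
    omega
  obtain ⟨θ, hθ⟩ : ∃ θ : ℂ, aeval θ f = 0 :=
    IsAlgClosed.exists_aeval_eq_zero ℂ f (degree_pos_of_irreducible hirr).ne'
  have hcubic : θ ^ 3 + p * θ ^ 2 + q * θ + r = 0 := by
    have hl' : (l : ℂ) ≠ 0 := by exact_mod_cast hl
    refine (mul_eq_zero.mp ?_).resolve_left hl'
    rw [hf] at hθ
    simpa using hθ
  have hkey {s t a b : ℚ}
      (h : quadraticThrough p q r t = (quadraticThrough p q r s).comp (C a * X + C b)) : s = t :=
    eq_of_quadraticThrough_equivalent hirr hdeg hθ hcubic (hne s) (hne t) h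
  refine ⟨Set.range (quadraticThrough p q r), Set.infinite_range_of_injective fun s t hst => ?_,
    ?_, ?_, ?_⟩
  · exact hkey (a := 1) (b := 0) (by simp [hst])
  · rintro _ ⟨s, rfl⟩
    exact natDegree_quadraticThrough (hne s)
  · rintro _ ⟨s, rfl⟩
    refine ⟨_, _, ?_, ?_, by rw [hf]; exact comp_quadraticThrough (hne s)⟩
    · rw [natDegree_C_mul (mul_ne_zero hl (pow_ne_zero 3 (inv_ne_zero (hne s)))),
        natDegree_generatorCharpoly]
      norm_num
    · rw [natDegree_comp, natDegree_generatorCharpoly, natDegree_linear (by norm_num)]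
      norm_num
  · rintro _ ⟨s, rfl⟩ _ ⟨t, rfl⟩ hst ⟨a, b, _, h⟩
    exact hst (congrArg _ (hkey h))
end

section
/- Let f(t) = a·t² + b·t + c ∈ ℤ[t] be irreducible with a ≠ 0, and let α be a root of f in an algebraic closure of ℚ. Then for every natural number k there exist integers m, n, A, B with A ≠ 0 and gcd(A, B) = 1 such that (m·a·α + n)^k = A·α + B. -/
open Polynomial

/-- The discriminant of an irreducible integer quadratic is nonzero. -/
lemma discr_ne_zero_of_irreducible_quadratic {a b c : ℤ} (ha : a ≠ 0)
    (hirr : Irreducible (C a * X ^ 2 + C b * X + C c : ℤ[X])) : b ^ 2 - 4 * a * c ≠ 0 := by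
  intro hD
  have hdvd : (C a * X ^ 2 + C b * X + C c : ℤ[X]) ∣ (C (2 * a) * X + C b) ^ 2 := by
    refine ⟨C (4 * a), ?_⟩
    have hC : (C b : ℤ[X]) ^ 2 = 4 * C a * C c := by
      have h : b ^ 2 = 4 * a * c := by linarith
      simpa using congrArg (C : ℤ → ℤ[X]) h
    simp only [map_mul, map_ofNat]
    linear_combination hC
  have h2a : 2 * a ≠ 0 := by simpa using ha
  have hlin : (C (2 * a) * X + C b : ℤ[X]) ≠ 0 := fun h ↦ by
    have := natDegree_linear (b := b) h2a
    rw [h, natDegree_zero] at this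
    omega
  have := natDegree_le_of_dvd (hirr.prime.dvd_of_dvd_pow hdvd) hlin
  rw [natDegree_quadratic ha, natDegree_linear h2a] at this
  omega

/-- Coordinates of the powers of `m * β + 1`, where `β ^ 2 + b * β + a * c = 0`, together with
their norms and their residues modulo `a`, modulo powers of `m` and modulo the norm of
`m * β + 1`. -/
lemma exists_pow_succ_eq_of_quadratic {R : Type*} [CommRing R] (a b c m : ℤ) {β : R}
    (hβ : β ^ 2 + b * β + a * c = 0) (j : ℕ) :
    ∃ U V : ℤ, (m * β + 1) ^ (j + 1) = U * β + V ∧ a ∣ V - 1 ∧ m ∣ V - 1 ∧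
      m ^ 2 ∣ U - (j + 1) * m ∧
      (1 - b * m + a * c * m ^ 2) ^ (j + 1) = V ^ 2 - b * U * V + a * c * U ^ 2 ∧
      1 - b * m + a * c * m ^ 2 ∣ V - (2 - b * m) ^ j ∧
      1 - b * m + a * c * m ^ 2 ∣ U - m * (2 - b * m) ^ j := by
  induction j with
  | zero => exact ⟨m, 1, by simp, by simp, by simp, by simp, by ring, by simp, by simp⟩
  | succ j ih =>
    obtain ⟨U, V, hpow, ⟨x, hx⟩, ⟨y, hy⟩, ⟨z, hz⟩, hN, ⟨v, hv⟩, ⟨u, hu⟩⟩ := ih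
    refine ⟨U + m * V - b * m * U, V - a * c * m * U, ?_, ⟨x - c * m * U, ?_⟩,
      ⟨y - a * c * U, ?_⟩, ⟨z + y - b * (j + 1 + m * z), ?_⟩, ?_,
      ⟨v - a * c * m * u - (2 - b * m) ^ j, ?_⟩, ⟨u + m * v - b * m * u, ?_⟩⟩
    · rw [pow_succ, hpow]
      push_cast
      linear_combination (m * U : R) * hβ
    · linear_combination hx
    · linear_combination hy
    · push_cast
      linear_combination (1 - b * m) * hz + m * hy
    · rw [pow_succ, hN]
      ring
    · linear_combination hv - a * c * m * hu
    · linear_combination (1 - b * m) * hu + m * hv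

theorem power_of_prime_generator_quadratic
    (a b c : ℤ) (ha : a ≠ 0) (f : Polynomial ℤ)
    (hf : f = C a * X ^ 2 + C b * X + C c) (hirr : Irreducible f)
    (α : AlgebraicClosure ℚ) (hα : Polynomial.aeval α f = 0)
    (k : ℕ) (hk : 0 < k) :
    ∃ m n A B : ℤ, A ≠ 0 ∧ Int.gcd A B = 1 ∧
      ((m : AlgebraicClosure ℚ) * (a : AlgebraicClosure ℚ) * α + (n : AlgebraicClosure ℚ)) ^ k
        = (A : AlgebraicClosure ℚ) * α + (B : AlgebraicClosure ℚ) := by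
  subst hf
  have hD := discr_ne_zero_of_irreducible_quadratic ha hirr
  obtain ⟨j, rfl⟩ := Nat.exists_eq_succ_of_ne_zero hk.ne'
  have hroot : (a : AlgebraicClosure ℚ) * α ^ 2 + b * α + c = 0 := by simpa using hα
  have hβ : ((a : AlgebraicClosure ℚ) * α) ^ 2 + b * (a * α) + a * c = 0 := by
    linear_combination (a : AlgebraicClosure ℚ) * hroot
  obtain ⟨m, hm⟩ : ∃ m : ℤ, m = (b ^ 2 - 4 * a * c) * (j + 2) := ⟨_, rfl⟩
  have hm0 : m ≠ 0 := hm ▸ mul_ne_zero hD (by positivity)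
  obtain ⟨U, V, hpow, haV, -, hmU, hN, hNV, -⟩ := exists_pow_succ_eq_of_quadratic a b c m hβ j
  have hU : U ≠ 0 := by
    rintro rfl
    have hdvd : m ∣ (j + 1 : ℤ) := by
      rw [zero_sub, dvd_neg, sq] at hmU
      exact Int.dvd_of_mul_dvd_mul_right hm0 hmU
    have hle : (j + 2 : ℤ) ≤ j + 1 :=
      Int.le_of_dvd (by positivity) ((Dvd.intro_left _ hm.symm).trans hdvd)
    omega
  refine ⟨m, 1, a * U, V, mul_ne_zero ha hU, ?_, ?_⟩
  · rw [← Int.isCoprime_iff_gcd_eq_one]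
    refine isCoprime_of_prime_dvd (fun h ↦ mul_ne_zero ha hU h.1) fun p hp hpU hpV ↦ ?_
    have hpU' : p ∣ U := (hp.dvd_or_dvd hpU).resolve_left fun hpa ↦
      hp.not_dvd_one (by simpa using dvd_sub hpV (hpa.trans haV))
    have hpN : p ∣ 1 - b * m + a * c * m ^ 2 := by
      refine hp.dvd_of_dvd_pow (n := j + 1) ?_
      rw [hN]
      obtain ⟨s, rfl⟩ := hpU'
      obtain ⟨t, rfl⟩ := hpV
      exact ⟨p * t ^ 2 - b * p * s * t + a * c * p * s ^ 2, by ring⟩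
    have hpT : p ∣ 2 - b * m :=
      hp.dvd_of_dvd_pow (n := j) (by simpa using dvd_sub hpV (hpN.trans hNV))
    have hpD : p ∣ m ^ 2 * (b ^ 2 - 4 * a * c) := by
      have h : m ^ 2 * (b ^ 2 - 4 * a * c) =
          (2 - b * m) * (2 - b * m) - 4 * (1 - b * m + a * c * m ^ 2) := by ring
      exact h ▸ dvd_sub (hpT.mul_left _) (hpN.mul_left _)
    have hpm : p ∣ m := by
      rcases hp.dvd_or_dvd hpD with h | h
      · exact hp.dvd_of_dvd_pow h
      · exact h.trans (Dvd.intro _ hm.symm)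
    refine hp.not_dvd_one ?_
    have h := dvd_sub hpN (hpm.mul_left (a * c * m - b))
    ring_nf at h
    exact h
  · push_cast
    rw [mul_assoc, hpow]
    ring
end

section
/- Let f ∈ ℚ[t] be irreducible of degree d ≥ 3. Then there exists a polynomial g ∈ ℚ[y] with 2 ≤ deg(g) ≤ d − 1 such that f(g(y)) is reducible in ℚ[y]. More precisely, if α is a root of f in an algebraic closure of ℚ and β ∈ ℚ(α) satisfies [ℚ(β):ℚ] = d and β ∉ span_ℚ{1, α}, then there exists g ∈ ℚ[y] with 2 ≤ deg(g) ≤ d − 1 and α = g(β), and f(g(y)) is divisible by the degree-d minimal polynomial of β over ℚ, hence reducible. -/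
open Polynomial

open scoped IntermediateField

theorem exists_mem_adjoin_sq_add_smul {F E : Type*} [Field F] [Infinite F] [Field E] [Algebra F E]
    [Finite (IntermediateField F E)] (x : E) : ∃ c : F, x ∈ F⟮x ^ 2 + c • x⟯ := by
  obtain ⟨c, c', hne, h⟩ :=
    Finite.exists_ne_map_eq_of_infinite fun c : F => F⟮x ^ 2 + c • x⟯
  refine ⟨c, ?_⟩
  have h₁ : x ^ 2 + c • x ∈ F⟮x ^ 2 + c • x⟯ := IntermediateField.mem_adjoin_simple_self F _
  have h₂ : x ^ 2 + c' • x ∈ F⟮x ^ 2 + c • x⟯ := by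
    rw [show F⟮x ^ 2 + c • x⟯ = F⟮x ^ 2 + c' • x⟯ from h]
    exact IntermediateField.mem_adjoin_simple_self F _
  have h₃ := IntermediateField.smul_mem _ (x := (c - c')⁻¹) (sub_mem h₁ h₂)
  rwa [add_sub_add_left_eq_sub, ← sub_smul, inv_smul_smul₀ (sub_ne_zero.mpr hne)] at h₃

theorem natDegree_minpoly_eq_of_irreducible {F K : Type*} [Field F] [Field K] [Algebra F K]
    {f : F[X]} {x : K} (hf : Irreducible f) (hfx : aeval x f = 0) :
    (minpoly F x).natDegree = f.natDegree := by
  rw [← minpoly.eq_of_irreducible hf hfx,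
    natDegree_mul_C (inv_ne_zero (leadingCoeff_ne_zero.mpr hf.ne_zero))]

theorem natDegree_le_natDegree_of_aeval_eq_zero {F K : Type*} [Field F] [Field K] [Algebra F K]
    {f p : F[X]} {x : K} (hf : Irreducible f) (hfx : aeval x f = 0) (hp : p ≠ 0)
    (hpx : aeval x p = 0) : f.natDegree ≤ p.natDegree := by
  rw [← natDegree_minpoly_eq_of_irreducible hf hfx]
  exact natDegree_le_of_dvd (minpoly.dvd F x hpx) hp

theorem exists_aeval_eq_of_mem_adjoin {F K : Type*} [Field F] [Field K] [Algebra F K]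
    {f : F[X]} {x y : K} (hf : Irreducible f) (hfx : aeval x f = 0) (hd : 2 ≤ f.natDegree)
    (hy : IsIntegral F y) (hx : x ∈ F⟮y⟯) (hspan : y ∉ Submodule.span F ({1, x} : Set K)) :
    ∃ g : F[X], 2 ≤ g.natDegree ∧ g.natDegree < (minpoly F y).natDegree ∧ aeval y g = x := by
  obtain ⟨p, rfl⟩ : ∃ p : F[X], aeval y p = x := by
    rw [← IntermediateField.mem_toSubalgebra,
      IntermediateField.adjoin_simple_toSubalgebra_of_isAlgebraic hy.isAlgebraic,
      Algebra.adjoin_singleton_eq_range_aeval] at hx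
    exact hx
  have hg : aeval y (p %ₘ minpoly F y) = aeval y p :=
    minpoly.aeval_modByMonic_minpoly p y
  refine ⟨p %ₘ minpoly F y, ?_, natDegree_modByMonic_lt _ (minpoly.monic hy)
    (minpoly.ne_one F y), hg⟩
  by_contra! hlt
  obtain ⟨b, a, hba⟩ := exists_eq_X_add_C_of_natDegree_le_one (Nat.le_of_lt_succ hlt)
  rw [← hg, hba] at hfx hspan
  simp only [map_add, map_mul, aeval_C, aeval_X] at hfx hspan
  by_cases hb : b = 0
  · subst hb
    have := natDegree_le_natDegree_of_aeval_eq_zero hf hfx (X_sub_C_ne_zero a) (by simp)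
    rw [natDegree_X_sub_C] at this
    omega
  · refine hspan (Submodule.mem_span_pair.mpr ⟨-(b⁻¹ * a), b⁻¹, ?_⟩)
    have hb' : algebraMap F K b ≠ 0 := by simpa using hb
    simp only [Algebra.smul_def, map_neg, map_mul, map_inv₀]
    field_simp
    ring

theorem minpoly_dvd_comp {F K : Type*} [Field F] [Field K] [Algebra F K] {f g : F[X]} {y : K}
    (h : aeval (aeval y g) f = 0) : minpoly F y ∣ f.comp g :=
  minpoly.dvd F y (by rwa [aeval_comp])

theorem exists_comp_eq_mul {F : Type*} [Field F] {f g m : F[X]} (hm : 0 < m.natDegree)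
    (hdeg : m.natDegree = f.natDegree) (hg : 2 ≤ g.natDegree) (hdvd : m ∣ f.comp g) :
    ∃ h₁ h₂ : F[X], 0 < h₁.natDegree ∧ 0 < h₂.natDegree ∧ f.comp g = h₁ * h₂ := by
  obtain ⟨q, hq⟩ := hdvd
  refine ⟨m, q, hm, Nat.pos_of_ne_zero fun hq0 => ?_, hq⟩
  have hle : (m * q).natDegree ≤ m.natDegree + q.natDegree := natDegree_mul_le
  rw [← hq, natDegree_comp, hq0, hdeg] at hle
  nlinarith

theorem sq_add_smul_notMem_span {F K : Type*} [Field F] [Field K] [Algebra F K] {f : F[X]} {x : K}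
    (hf : Irreducible f) (hfx : aeval x f = 0) (hd : 3 ≤ f.natDegree) (c : F) :
    x ^ 2 + c • x ∉ Submodule.span F ({1, x} : Set K) := by
  intro h
  obtain ⟨a, b, hab⟩ := Submodule.mem_span_pair.mp h
  have hdeg : (C 1 * X ^ 2 + C (c - b) * X + C (-a) : F[X]).natDegree = 2 :=
    natDegree_quadratic one_ne_zero
  have := natDegree_le_natDegree_of_aeval_eq_zero hf hfx
    (p := C 1 * X ^ 2 + C (c - b) * X + C (-a))
    (ne_zero_of_natDegree_gt (n := 1) (by rw [hdeg]; norm_num)) (by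
      simp only [map_add, map_mul, map_pow, aeval_C, aeval_X, map_sub, map_neg, map_one]
      simp only [Algebra.smul_def] at hab
      linear_combination -hab)
  omega

theorem exists_mem_adjoin_sq_add_smul_of_isIntegral {F K : Type*} [Field F] [CharZero F] [Field K]
    [Algebra F K] {x : K} (hx : IsIntegral F x) : ∃ c : F, x ∈ F⟮x ^ 2 + c • x⟯ := by
  have : FiniteDimensional F F⟮x⟯ := IntermediateField.adjoin.finiteDimensional hx
  have : Finite (IntermediateField F F⟮x⟯) :=
    Field.finite_intermediateField_of_exists_primitive_element F F⟮x⟯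
      (Field.exists_primitive_element F F⟮x⟯)
  obtain ⟨c, hc⟩ := exists_mem_adjoin_sq_add_smul (F := F) (IntermediateField.AdjoinSimple.gen F x)
  have := (IntermediateField.mem_map _ (f := F⟮x⟯.val)).mpr ⟨_, hc, rfl⟩
  rw [IntermediateField.adjoin_map, Set.image_singleton] at this
  exact ⟨c, by simpa using this⟩

theorem granville_pleasants_question
    (f : Polynomial ℚ) (hirr : Irreducible f) (d : ℕ) (hd : 3 ≤ d)
    (hdeg : f.natDegree = d)
    (α : AlgebraicClosure ℚ) (hα : Polynomial.aeval α f = 0) :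
    (∃ g : Polynomial ℚ, 2 ≤ g.natDegree ∧ g.natDegree ≤ d - 1 ∧
      ∃ h₁ h₂ : Polynomial ℚ, 0 < h₁.natDegree ∧ 0 < h₂.natDegree ∧
        f.comp g = h₁ * h₂) ∧
    (∀ β : AlgebraicClosure ℚ,
      β ∈ IntermediateField.adjoin ℚ ({α} : Set (AlgebraicClosure ℚ)) →
      (minpoly ℚ β).natDegree = d →
      β ∉ Submodule.span ℚ ({1, α} : Set (AlgebraicClosure ℚ)) →
      ∃ g : Polynomial ℚ, 2 ≤ g.natDegree ∧ g.natDegree ≤ d - 1 ∧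
        Polynomial.aeval β g = α ∧
        minpoly ℚ β ∣ f.comp g ∧
        ∃ h₁ h₂ : Polynomial ℚ, 0 < h₁.natDegree ∧ 0 < h₂.natDegree ∧
          f.comp g = h₁ * h₂) := by
  have hint (x : AlgebraicClosure ℚ) : IsIntegral ℚ x :=
    (AlgebraicClosure.isAlgebraic ℚ).isIntegral.isIntegral x
  have : FiniteDimensional ℚ ℚ⟮α⟯ := IntermediateField.adjoin.finiteDimensional (hint α)
  have hrank : Module.finrank ℚ ℚ⟮α⟯ = d := by
    rw [IntermediateField.adjoin.finrank (hint α),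
      natDegree_minpoly_eq_of_irreducible hirr hα, hdeg]
  refine (and_iff_right_of_imp fun hmain => ?_).mpr ?_
  · obtain ⟨c, hc⟩ := exists_mem_adjoin_sq_add_smul_of_isIntegral (hint α)
    have hmem : α ∈ ℚ⟮α⟯ := IntermediateField.mem_adjoin_simple_self ℚ α
    have hβ : α ^ 2 + c • α ∈ ℚ⟮α⟯ := add_mem (pow_mem hmem 2) (IntermediateField.smul_mem _ hmem)
    have heq : ℚ⟮α ^ 2 + c • α⟯ = ℚ⟮α⟯ :=
      le_antisymm (IntermediateField.adjoin_simple_le_iff.mpr hβ)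
        (IntermediateField.adjoin_simple_le_iff.mpr hc)
    obtain ⟨g, hg₂, hgd, -, -, hred⟩ := hmain (α ^ 2 + c • α) hβ
      (by rw [← IntermediateField.adjoin.finrank (hint _), heq, hrank])
      (sq_add_smul_notMem_span hirr hα (hdeg ▸ hd) c)
    exact ⟨g, hg₂, hgd, hred⟩
  · intro β hβ hβd hspan
    have heq : ℚ⟮β⟯ = ℚ⟮α⟯ :=
      IntermediateField.eq_of_le_of_finrank_eq (IntermediateField.adjoin_simple_le_iff.mpr hβ)
        (by rw [IntermediateField.adjoin.finrank (hint β), hβd, hrank])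
    obtain ⟨g, hg₂, hgd, rfl⟩ := exists_aeval_eq_of_mem_adjoin hirr hα (by omega) (hint β)
      (heq ▸ IntermediateField.mem_adjoin_simple_self ℚ α) hspan
    have hdvd := minpoly_dvd_comp hα
    exact ⟨g, hg₂, by omega, rfl, hdvd, exists_comp_eq_mul (by omega) (by omega) hg₂ hdvd⟩
end

section
/- Let f ∈ ℚ[t] be irreducible of degree d and let g ∈ ℚ[t] be non-constant. Then every non-constant factor of f(g(t)) in ℚ[t] has degree at least d. In particular, if g is quadratic and f(g(t)) is reducible in ℚ[t], then f(g(t)) = h_1(t)·h_2(t) where h_1, h_2 ∈ ℚ[t] each have degree exactly d and each is a constant multiple of an irreducible polynomial of degree d. -/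
open Polynomial

theorem natDegree_le_of_dvd_comp {K : Type*} [Field K] {f g h : K[X]} (hf : Irreducible f)
    (hdvd : h ∣ f.comp g) (hpos : 0 < h.natDegree) : f.natDegree ≤ h.natDegree := by
  obtain ⟨p, hp, hph⟩ := exists_irreducible_of_natDegree_pos hpos
  have hh : h ≠ 0 := ne_zero_of_natDegree_gt hpos
  have : Fact (Irreducible p) := ⟨hp⟩
  let pb := AdjoinRoot.powerBasis hp.ne_zero
  have : FiniteDimensional K (AdjoinRoot p) := pb.finite
  set y : AdjoinRoot p := AdjoinRoot.mk p g with hy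
  have hroot : aeval y f = 0 := by
    rw [hy, ← AdjoinRoot.aeval_eq, ← aeval_comp, AdjoinRoot.aeval_eq, AdjoinRoot.mk_eq_zero]
    exact hph.trans hdvd
  have hdeg : f.natDegree = (minpoly K y).natDegree :=
    natDegree_eq_of_degree_eq (degree_eq_degree_of_associated
      ((minpoly.irreducible (IsIntegral.of_finite K y)).associated_of_dvd hf
        (minpoly.dvd K y hroot)).symm)
  calc f.natDegree = (minpoly K y).natDegree := hdeg
    _ ≤ Module.finrank K (AdjoinRoot p) := minpoly.natDegree_le y
    _ = p.natDegree := by rw [pb.finrank, AdjoinRoot.powerBasis_dim]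
    _ ≤ h.natDegree := natDegree_le_of_dvd hph hh

theorem irreducible_of_dvd_comp_of_natDegree_eq {K : Type*} [Field K] {f g h : K[X]}
    (hf : Irreducible f) (hdvd : h ∣ f.comp g) (hdeg : h.natDegree = f.natDegree) :
    Irreducible h := by
  have hpos : 0 < h.natDegree := hdeg ▸ hf.natDegree_pos
  have hh : h ≠ 0 := ne_zero_of_natDegree_gt hpos
  refine ⟨fun hu => hpos.ne' (natDegree_eq_zero_of_isUnit hu), fun a b hab => ?_⟩
  subst hab
  have ha := left_ne_zero_of_mul hh
  have hb := right_ne_zero_of_mul hh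
  rw [natDegree_mul ha hb] at hdeg
  rcases Nat.eq_zero_or_pos a.natDegree with ha0 | ha0
  · left
    rw [isUnit_iff_degree_eq_zero, degree_eq_natDegree ha, ha0, Nat.cast_zero]
  · right
    have hle := natDegree_le_of_dvd_comp hf ((dvd_mul_right a b).trans hdvd) ha0
    have hb0 : b.natDegree = 0 := by omega
    rw [isUnit_iff_degree_eq_zero, degree_eq_natDegree hb, hb0, Nat.cast_zero]

theorem factors_of_comp_have_degree_at_least
    (f : Polynomial ℚ) (hirr : Irreducible f) (d : ℕ) (hdeg : f.natDegree = d)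
    (g : Polynomial ℚ) (hg : 0 < g.natDegree) :
    (∀ h : Polynomial ℚ, h ∣ f.comp g → 0 < h.natDegree → d ≤ h.natDegree) ∧
    (g.natDegree = 2 →
      (∃ h₁ h₂ : Polynomial ℚ, 0 < h₁.natDegree ∧ 0 < h₂.natDegree ∧
        f.comp g = h₁ * h₂) →
      ∃ h₁ h₂ : Polynomial ℚ, f.comp g = h₁ * h₂ ∧
        h₁.natDegree = d ∧ h₂.natDegree = d ∧
        (∃ c₁ : ℚ, ∃ p₁ : Polynomial ℚ, Irreducible p₁ ∧ p₁.natDegree = d ∧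
          h₁ = C c₁ * p₁) ∧
        (∃ c₂ : ℚ, ∃ p₂ : Polynomial ℚ, Irreducible p₂ ∧ p₂.natDegree = d ∧
          h₂ = C c₂ * p₂)) := by
  subst hdeg
  refine ⟨fun h hdvd hpos => natDegree_le_of_dvd_comp hirr hdvd hpos, ?_⟩
  rintro hquad ⟨h₁, h₂, hpos₁, hpos₂, hmul⟩
  have hdvd₁ : h₁ ∣ f.comp g := hmul ▸ dvd_mul_right h₁ h₂
  have hdvd₂ : h₂ ∣ f.comp g := hmul ▸ dvd_mul_left h₂ h₁
  have hle₁ := natDegree_le_of_dvd_comp hirr hdvd₁ hpos₁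
  have hle₂ := natDegree_le_of_dvd_comp hirr hdvd₂ hpos₂
  have hsum : f.natDegree * 2 = h₁.natDegree + h₂.natDegree := by
    rw [← hquad, ← natDegree_comp, hmul,
      natDegree_mul (ne_zero_of_natDegree_gt hpos₁) (ne_zero_of_natDegree_gt hpos₂)]
  have hdeg₁ : h₁.natDegree = f.natDegree := by omega
  have hdeg₂ : h₂.natDegree = f.natDegree := by omega
  exact ⟨h₁, h₂, hmul, hdeg₁, hdeg₂,
    ⟨1, h₁, irreducible_of_dvd_comp_of_natDegree_eq hirr hdvd₁ hdeg₁, hdeg₁, by simp⟩,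
    ⟨1, h₂, irreducible_of_dvd_comp_of_natDegree_eq hirr hdvd₂ hdeg₂, hdeg₂, by simp⟩⟩
end

section
/- Let f(t) = A·t⁴ + B·t² + C·t + D ∈ ℚ[t] be irreducible with A ≠ 0 and C ≠ 0, and set g(x) = −(A·x² + B·x + D)/C ∈ ℚ[x]. Then f(g(x)) = h_1(x)·h_2(x), where h_1, h_2 ∈ ℚ[x] are (constant multiples of) irreducible polynomials of degree 4. In particular, if α is a root of f in an algebraic closure of ℚ, then α = g(α²), the minimal polynomial of α² over ℚ has degree 4, and it divides f(g(x)) in ℚ[x]. -/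
namespace Polynomial

variable {K L : Type*} [Field K] [Field L] [Algebra K L]

/-- The degree over `K` of a polynomial expression in `β` is at most the degree of `β`. -/
theorem natDegree_minpoly_aeval_le {β : L} (hβ : IsIntegral K β) (g : K[X]) :
    (minpoly K (aeval β g)).natDegree ≤ (minpoly K β).natDegree := by
  have : FiniteDimensional K (IntermediateField.adjoin K {β}) :=
    IntermediateField.adjoin.finiteDimensional hβ
  have hmap : algebraMap (IntermediateField.adjoin K {β}) L
      (aeval (IntermediateField.AdjoinSimple.gen K β) g) = aeval β g := by
    rw [← aeval_algebraMap_apply, IntermediateField.AdjoinSimple.algebraMap_gen]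
  rw [← hmap, minpoly.algebraMap_eq (algebraMap (IntermediateField.adjoin K {β}) L).injective,
    ← IntermediateField.adjoin.finrank hβ]
  exact minpoly.natDegree_le _

theorem natDegree_minpoly_of_irreducible {f : K[X]} (hf : Irreducible f) {α : L}
    (hα : aeval α f = 0) : (minpoly K α).natDegree = f.natDegree := by
  rw [← minpoly.eq_of_irreducible hf hα]
  exact natDegree_mul_C (inv_ne_zero (leadingCoeff_ne_zero.mpr hf.ne_zero))

/-- An irreducible factor of `f.comp g`, with `f` irreducible, has degree at least that of `f`. -/
theorem natDegree_le_of_irreducible_of_dvd_comp {f g p : K[X]} (hf : Irreducible f)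
    (hp : Irreducible p) (hdvd : p ∣ f.comp g) : f.natDegree ≤ p.natDegree := by
  have : Fact (Irreducible p) := ⟨hp⟩
  have hβ : aeval (AdjoinRoot.root p) p = 0 := by simp
  have hfg : aeval (aeval (AdjoinRoot.root p) g) f = 0 := by
    rw [← aeval_comp]
    exact aeval_eq_zero_of_dvd_aeval_eq_zero hdvd hβ
  rw [← natDegree_minpoly_of_irreducible hf hfg, ← natDegree_minpoly_of_irreducible hp hβ]
  exact natDegree_minpoly_aeval_le (AdjoinRoot.isIntegral_root hp.ne_zero) g

end Polynomial

theorem quartic_rational_decomposition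
    (A B C D : ℚ) (hA : A ≠ 0) (hC : C ≠ 0)
    (f g : Polynomial ℚ)
    (hf : f = Polynomial.C A * Polynomial.X ^ 4 + Polynomial.C B * Polynomial.X ^ 2 +
      Polynomial.C C * Polynomial.X + Polynomial.C D)
    (hirr : Irreducible f)
    (hg : g = -(Polynomial.C (C⁻¹)) *
      (Polynomial.C A * Polynomial.X ^ 2 + Polynomial.C B * Polynomial.X + Polynomial.C D))
    (α : AlgebraicClosure ℚ) (hα : Polynomial.aeval α f = 0) :
    (∃ h₁ h₂ : Polynomial ℚ, f.comp g = h₁ * h₂ ∧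
      (∃ c₁ : ℚ, ∃ p₁ : Polynomial ℚ, Irreducible p₁ ∧ p₁.natDegree = 4 ∧
        h₁ = Polynomial.C c₁ * p₁) ∧
      (∃ c₂ : ℚ, ∃ p₂ : Polynomial ℚ, Irreducible p₂ ∧ p₂.natDegree = 4 ∧
        h₂ = Polynomial.C c₂ * p₂)) ∧
    Polynomial.aeval (α ^ 2) g = α ∧
    (minpoly ℚ (α ^ 2)).natDegree = 4 ∧
    minpoly ℚ (α ^ 2) ∣ f.comp g := by
  have hfdeg : f.natDegree = 4 := by rw [hf]; compute_degree!
  have hgdeg : g.natDegree = 2 := by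
    rw [hg, ← Polynomial.C_neg, Polynomial.natDegree_C_mul (neg_ne_zero.mpr (inv_ne_zero hC))]
    compute_degree!
  have hC' : algebraMap ℚ (AlgebraicClosure ℚ) C ≠ 0 := by simpa using hC
  have hroot : Polynomial.aeval (α ^ 2) g = α := by
    rw [hf] at hα
    simp only [map_add, map_mul, map_pow, Polynomial.aeval_C, Polynomial.aeval_X] at hα
    simp only [hg, map_add, map_mul, map_pow, map_neg, Polynomial.aeval_C, Polynomial.aeval_X,
      map_inv₀]
    field_simp
    linear_combination -hα
  have hα_integral : IsIntegral ℚ α := isAlgebraic_iff_isIntegral.mp ⟨f, hirr.ne_zero, hα⟩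
  have hα_sq_integral : IsIntegral ℚ (α ^ 2) := hα_integral.pow 2
  have hαdeg := (Polynomial.natDegree_minpoly_of_irreducible hirr hα).trans hfdeg
  have hdeg : (minpoly ℚ (α ^ 2)).natDegree = 4 := by
    have hle := Polynomial.natDegree_minpoly_aeval_le hα_integral (Polynomial.X ^ 2 : Polynomial ℚ)
    have hge := Polynomial.natDegree_minpoly_aeval_le hα_sq_integral g
    rw [map_pow, Polynomial.aeval_X] at hle
    rw [hroot] at hge
    omega
  have hdvd : minpoly ℚ (α ^ 2) ∣ f.comp g :=
    minpoly.dvd ℚ _ (by rw [Polynomial.aeval_comp, hroot, hα])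
  refine ⟨?_, hroot, hdeg, hdvd⟩
  obtain ⟨q, hq⟩ := hdvd
  have hcomp : (f.comp g).natDegree = 8 := by rw [Polynomial.natDegree_comp, hfdeg, hgdeg]
  have hq0 : q ≠ 0 := by
    rintro rfl
    simp [hq] at hcomp
  have hqdeg : q.natDegree = 4 := by
    rw [hq, Polynomial.natDegree_mul (minpoly.ne_zero hα_sq_integral) hq0] at hcomp
    omega
  refine ⟨minpoly ℚ (α ^ 2), q, hq, ⟨1, _, minpoly.irreducible hα_sq_integral, hdeg, by simp⟩, ?_⟩
  obtain ⟨p, hp, r, rfl⟩ := Polynomial.exists_irreducible_of_natDegree_ne_zero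
    (f := q) (by omega)
  have hpdeg := Polynomial.natDegree_le_of_irreducible_of_dvd_comp hirr hp
    (hq ▸ (dvd_mul_right p r).mul_left _)
  rw [Polynomial.natDegree_mul hp.ne_zero (right_ne_zero_of_mul hq0)] at hqdeg
  obtain ⟨c, rfl⟩ := Polynomial.natDegree_eq_zero.mp (show r.natDegree = 0 by omega)
  exact ⟨c, p, hp, by omega, mul_comm _ _⟩
end

section
/- The polynomial f(t) = t⁴ + 4t² − t + 1 is irreducible over ℚ, and it satisfies the factorisation f(t² + 2t − 2) = (t⁴ + 4t³ − 9t + 5)·(t⁴ + 4t³ − 7t + 7) in ℤ[t], where both quartic factors are irreducible over ℚ. Hence f admits polysmoothness 1/2. -/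
open Polynomial

theorem irreducible_X_pow_four_add_X_add_one_zmod_two :
    Irreducible (X ^ 4 + X + 1 : (ZMod 2)[X]) := by
  have hdeg : (X ^ 4 + X + 1 : (ZMod 2)[X]).natDegree = 4 := by compute_degree!
  have hmonic : (X ^ 4 + X + 1 : (ZMod 2)[X]).Monic := by monicity!
  have hroot : ∀ x : ZMod 2, (X ^ 4 + X + 1 : (ZMod 2)[X]).eval x ≠ 0 := by
    intro x
    simp only [eval_add, eval_pow, eval_X, eval_one]
    revert x
    decide
  have hne : (X ^ 4 + X + 1 : (ZMod 2)[X]) ≠ 1 := by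
    intro h
    rw [h, natDegree_one] at hdeg
    omega
  rw [hmonic.irreducible_iff_lt_natDegree_lt hne]
  intro q hq hqdeg hdvd
  have hqroot : ∀ x : ZMod 2, q.eval x ≠ 0 := fun x hx =>
    hroot x (eval_eq_zero_of_dvd_of_eval_eq_zero hdvd hx)
  have hval : ∀ x : ZMod 2, x ≠ 0 → x = 1 := by decide
  rw [hdeg, Finset.mem_Ioc] at hqdeg
  obtain h | h : q.natDegree = 1 ∨ q.natDegree = 2 := by omega
  · obtain ⟨x, hx⟩ := exists_root_of_degree_eq_one
      ((degree_eq_iff_natDegree_eq hq.ne_zero).2 h)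
    exact hqroot x hx
  · have hlead : q.coeff 2 = 1 := by simpa only [h] using hq.coeff_natDegree
    have hsum := as_sum_range_C_mul_X_pow q
    simp only [h, Finset.sum_range_succ, Finset.sum_range_zero, hlead] at hsum
    have h0 := hval _ (hqroot 0)
    have h1 := hval _ (hqroot 1)
    rw [hsum] at h0 h1
    simp at h0 h1
    have hlin : q.coeff 1 = 1 := by
      rw [h0] at h1
      revert h1
      generalize q.coeff 1 = a
      revert a
      decide
    rw [h0, hlin] at hsum
    have hq' : q = X ^ 2 + X + 1 := by
      rw [hsum]; simp; ring
    have htwo : (2 : (ZMod 2)[X]) = 0 := CharTwo.two_eq_zero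
    have hdiv : (X ^ 4 + X + 1 : (ZMod 2)[X]) = q * (X ^ 2 + X) + 1 := by
      rw [hq']; linear_combination (-X ^ 3 - X ^ 2) * htwo
    rw [hdiv, dvd_add_right (dvd_mul_right _ _)] at hdvd
    have := natDegree_eq_zero_of_isUnit (isUnit_of_dvd_one hdvd)
    omega

theorem irreducible_map_rat_of_map_zmod_two_eq {p : ℤ[X]} (hp : p.Monic)
    (h : p.map (Int.castRingHom (ZMod 2)) = X ^ 4 + X + 1) :
    Irreducible (p.map (Int.castRingHom ℚ)) :=
  (IsPrimitive.Int.irreducible_iff_irreducible_map_cast hp.isPrimitive).1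
    (hp.irreducible_of_irreducible_map (Int.castRingHom (ZMod 2)) p
      (h ▸ irreducible_X_pow_four_add_X_add_one_zmod_two))

theorem quartic_example_polysmoothness_half :
    Irreducible ((X ^ 4 + 4 * X ^ 2 - X + 1 : Polynomial ℤ).map (Int.castRingHom ℚ)) ∧
    (X ^ 4 + 4 * X ^ 2 - X + 1 : Polynomial ℤ).comp (X ^ 2 + 2 * X - 2) =
      (X ^ 4 + 4 * X ^ 3 - 9 * X + 5) * (X ^ 4 + 4 * X ^ 3 - 7 * X + 7) ∧
    Irreducible ((X ^ 4 + 4 * X ^ 3 - 9 * X + 5 : Polynomial ℤ).map (Int.castRingHom ℚ)) ∧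
    Irreducible ((X ^ 4 + 4 * X ^ 3 - 7 * X + 7 : Polynomial ℤ).map (Int.castRingHom ℚ)) ∧
    AdmitsPolysmoothness (X ^ 4 + 4 * X ^ 2 - X + 1) (1 / 2) := by
  have htwo : (2 : (ZMod 2)[X]) = 0 := CharTwo.two_eq_zero
  have hcomp : (X ^ 4 + 4 * X ^ 2 - X + 1 : ℤ[X]).comp (X ^ 2 + 2 * X - 2) =
      (X ^ 4 + 4 * X ^ 3 - 9 * X + 5) * (X ^ 4 + 4 * X ^ 3 - 7 * X + 7) := by
    simp only [add_comp, sub_comp, mul_comp, X_pow_comp, X_comp, one_comp, ofNat_comp]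
    ring
  refine ⟨irreducible_map_rat_of_map_zmod_two_eq (by monicity!) ?_, hcomp,
    irreducible_map_rat_of_map_zmod_two_eq (by monicity!) ?_,
    irreducible_map_rat_of_map_zmod_two_eq (by monicity!) ?_,
    X ^ 2 + 2 * X - 2, ?_, fun q hq hdvd => ?_⟩
  · simp
    linear_combination (2 * X ^ 2 - X) * htwo
  · simp
    linear_combination (2 * X ^ 3 - 5 * X + 2) * htwo
  · simp
    linear_combination (2 * X ^ 3 - 4 * X + 3) * htwo
  · have : (X ^ 2 + 2 * X - 2 : ℤ[X]).natDegree = 2 := by compute_degree!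
    omega
  · have hf : (X ^ 4 + 4 * X ^ 2 - X + 1 : ℤ[X]).natDegree = 4 := by compute_degree!
    have hg : (X ^ 2 + 2 * X - 2 : ℤ[X]).natDegree = 2 := by compute_degree!
    have hA : (X ^ 4 + 4 * X ^ 3 - 9 * X + 5 : ℤ[X]).natDegree = 4 := by compute_degree!
    have hB : (X ^ 4 + 4 * X ^ 3 - 7 * X + 7 : ℤ[X]).natDegree = 4 := by compute_degree!
    have hle : q.natDegree ≤ 4 := by
      rw [hcomp] at hdvd
      rcases hq.prime.dvd_or_dvd hdvd with h | h
      · exact hA ▸ natDegree_le_of_dvd h (ne_zero_of_natDegree_gt (n := 0) (by omega))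
      · exact hB ▸ natDegree_le_of_dvd h (ne_zero_of_natDegree_gt (n := 0) (by omega))
    rw [hf, hg]
    norm_num
    exact hle
end

section
/- Let f ∈ ℤ[t] be irreducible of even degree d = 2k with leading coefficient A. Suppose that there exists a quadratic polynomial g ∈ ℚ[t] for which f(g(t)) is reducible in ℚ[t]. Then there exist rational numbers X and Y with Y ≠ 0 such that A·Y² = f(X); that is, the hyperelliptic curve A·Y² = f(X) has a rational point with nonzero Y-coordinate. -/
open Polynomial in
theorem Polynomial.Monic.exists_sq_eq_eval_zero_of_not_irreducible_comp_sq
    {K : Type*} [Field K] {P : K[X]} (hP : P.Monic) (hirr : Irreducible P)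
    (heven : Even P.natDegree) (b : K) (hred : ¬ Irreducible (P.comp ((X - C b) ^ 2))) :
    ∃ y : K, P.eval 0 = y ^ 2 := by
  by_contra! hne
  refine hred (irreducible_comp hP ((monic_X_sub_C b).pow 2) hirr fun E _ _ x hx ↦ ?_)
  have hint : IsIntegral K x := not_not.mp fun h ↦ hP.ne_zero (hx ▸ minpoly.eq_zero h)
  refine irreducible_of_degree_le_three_of_not_isRoot ?_ fun β hβ ↦ ?_
  · rw [natDegree_sub_C]
    simp
  have hβ' : (β - algebraMap K _ b) ^ 2 = IntermediateField.AdjoinSimple.gen K x := by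
    simpa [IsRoot.def, sub_eq_zero] using hβ
  apply hne (Algebra.norm K (β - algebraMap K _ b))
  rw [← map_pow, hβ', ← IntermediateField.adjoin.powerBasis_gen hint,
    Algebra.PowerBasis.norm_gen_eq_coeff_zero_minpoly, ← coeff_zero_eq_eval_zero]
  simp [IntermediateField.minpoly_gen, hx, heven.neg_one_pow]

open Polynomial in
theorem Polynomial.exists_leadingCoeff_mul_sq_eq_eval_of_not_irreducible_comp
    {K : Type*} [Field K] {F : K[X]} (hirr : Irreducible F) (heven : Even F.natDegree)
    {a : K} (ha : a ≠ 0) (b c : K)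
    (hred : ¬ Irreducible (F.comp (C a * (X - C b) ^ 2 + C c))) :
    ∃ x y : K, y ≠ 0 ∧ F.leadingCoeff * y ^ 2 = F.eval x := by
  let := invertibleOfNonzero ha
  set Q := F.comp (C a * X + C c) with hQ
  have hQirr : Irreducible Q := by
    have := (MulEquiv.irreducible_iff (algEquivCMulXAddC a c)).mpr hirr
    simpa [comp_eq_aeval, hQ] using this
  have hlin : (C a * X + C c).natDegree = 1 := natDegree_linear ha
  have hQdeg : Q.natDegree = F.natDegree := by rw [hQ, natDegree_comp, hlin, mul_one]
  have hQlc : Q.leadingCoeff = F.leadingCoeff * a ^ F.natDegree := by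
    rw [hQ, leadingCoeff_comp (by simp [hlin]), leadingCoeff_linear ha]
  have hQlc0 : Q.leadingCoeff ≠ 0 := leadingCoeff_ne_zero.mpr hQirr.ne_zero
  obtain ⟨y, hy⟩ :=
    (monic_mul_leadingCoeff_inv hQirr.ne_zero).exists_sq_eq_eval_zero_of_not_irreducible_comp_sq
      (irreducible_mul_leadingCoeff_inv.mpr hQirr)
      (by rwa [natDegree_mul_leadingCoeff_inv _ hQirr.ne_zero, hQdeg]) b (by
        rw [mul_comp, C_comp, irreducible_mul_isUnit (isUnit_C.mpr (inv_ne_zero hQlc0).isUnit), hQ,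
          comp_assoc]
        simpa using hred)
  obtain ⟨m, hm⟩ := heven
  have hval : F.eval c = F.leadingCoeff * (a ^ m * y) ^ 2 := by
    have : Q.eval 0 = Q.leadingCoeff * y ^ 2 := by
      rw [← hy]
      simp only [eval_mul, eval_C]
      field_simp
    rw [hQlc, hm] at this
    simp only [hQ, eval_comp, eval_add, eval_mul, eval_C, eval_X, mul_zero, zero_add] at this
    rw [this]
    ring
  refine ⟨c, a ^ m * y, fun h0 ↦ ?_, hval.symm⟩
  have hroot : F.IsRoot c := by rw [IsRoot.def, hval, h0]; simp
  have : F.natDegree = 1 := natDegree_eq_of_degree_eq_some (degree_eq_one_of_irreducible_of_root hirr hroot)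
  omega

open Polynomial in
theorem Polynomial.exists_eq_C_mul_X_sub_C_sq_add_C_of_natDegree_eq_two
    {K : Type*} [Field K] [NeZero (2 : K)] {g : K[X]} (hg : g.natDegree = 2) :
    ∃ a b c : K, a ≠ 0 ∧ g = C a * (X - C b) ^ 2 + C c := by
  have ha : g.coeff 2 ≠ 0 := by
    rw [← hg]
    exact leadingCoeff_ne_zero.mpr (by rintro rfl; simp at hg)
  have h2 : (2 : K) ≠ 0 := two_ne_zero
  set a := g.coeff 2
  set p := g.coeff 1
  set q := g.coeff 0
  refine ⟨a, -p / (2 * a), q - p ^ 2 / (4 * a), ha, ?_⟩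
  have hp : -(2 * a * (-p / (2 * a))) = p := by field_simp
  have hq : a * (-p / (2 * a)) ^ 2 + (q - p ^ 2 / (4 * a)) = q := by
    rw [show (4 : K) = 2 * 2 by norm_num]
    field_simp
    ring
  have hsq (s r : K) : C a * (X - C s) ^ 2 + C r =
      C a * X ^ 2 + C (-(2 * a * s)) * X + C (a * s ^ 2 + r) := by
    simp only [C_neg, C_mul, C_add, C_pow, C_ofNat]
    ring
  rw [hsq, hp, hq]
  exact eq_quadratic_of_degree_le_two (natDegree_le_iff_degree_le.mp hg.le)

theorem reducible_quadratic_comp_gives_point_on_hyperelliptic_curve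
    (f : Polynomial ℤ) (hirr : Irreducible f) (k : ℕ) (hk : 0 < k)
    (hdeg : f.natDegree = 2 * k) (A : ℤ) (hA : f.leadingCoeff = A)
    (g : Polynomial ℚ) (hg : g.natDegree = 2)
    (hred : ∃ h₁ h₂ : Polynomial ℚ, 0 < h₁.natDegree ∧ 0 < h₂.natDegree ∧
      (f.map (Int.castRingHom ℚ)).comp g = h₁ * h₂) :
    ∃ X Y : ℚ, Y ≠ 0 ∧ (A : ℚ) * Y ^ 2 = (f.map (Int.castRingHom ℚ)).eval X := by
  subst hA
  have hprim : f.IsPrimitive := hirr.isPrimitive (by omega)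
  have hF := (Polynomial.IsPrimitive.Int.irreducible_iff_irreducible_map_cast hprim).mp hirr
  have hinj : Function.Injective (Int.castRingHom ℚ) := Int.cast_injective
  obtain ⟨a, b, c, ha, rfl⟩ :=
    Polynomial.exists_eq_C_mul_X_sub_C_sq_add_C_of_natDegree_eq_two hg
  have hred' : ¬ Irreducible ((f.map (Int.castRingHom ℚ)).comp
      (Polynomial.C a * (Polynomial.X - Polynomial.C b) ^ 2 + Polynomial.C c)) := by
    obtain ⟨h₁, h₂, hh₁, hh₂, h⟩ := hred
    intro hi
    rcases hi.isUnit_or_isUnit h with hu | hu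
    · exact hh₁.ne' (Polynomial.natDegree_eq_zero_of_isUnit hu)
    · exact hh₂.ne' (Polynomial.natDegree_eq_zero_of_isUnit hu)
  have := Polynomial.exists_leadingCoeff_mul_sq_eq_eval_of_not_irreducible_comp hF
    (by rw [Polynomial.natDegree_map_eq_of_injective hinj, hdeg]; exact even_two_mul k) ha b c hred'
  rwa [Polynomial.leadingCoeff_map_of_injective hinj] at this
end

section
/- The polynomial F(x) = x⁶ − x⁴ − 21x² − 31 is irreducible over ℚ, and for every quadratic polynomial g ∈ ℚ[x], the polynomial F(g(x)) is irreducible in ℚ[x]. (This rests on the fact that the elliptic curve y² = x³ − x² − 21x − 31 has rank 0 and trivial torsion over ℚ, so that the equation Y² = X⁶ − X⁴ − 21X² − 31 has no rational solutions, and hence the criterion 'f(g) reducible for quadratic g implies a rational point with nonzero Y on Y² = F(X)' cannot be met.) -/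
open Polynomial

section CubicField

open NumberField Module

variable {K : Type*} [Field K] [NumberField K] {φ : 𝓞 K}

theorem natDegree_X_cube_sub {R : Type*} [CommRing R] [Nontrivial R] :
    (X ^ 3 - C 2 * X - C 2 : R[X]).natDegree = 3 := by
  compute_degree!

theorem monic_X_cube_sub {R : Type*} [CommRing R] : (X ^ 3 - C 2 * X - C 2 : R[X]).Monic := by
  monicity!

theorem irreducible_X_cube_sub : Irreducible (X ^ 3 - C 2 * X - C 2 : ℚ[X]) := by
  have hmap : ((X ^ 3 - C 2 * X - C 2 : ℤ[X])).map (Int.castRingHom ℚ) =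
      X ^ 3 - C 2 * X - C 2 := by
    rw [Polynomial.map_sub, Polynomial.map_sub, Polynomial.map_mul, Polynomial.map_pow, map_X,
      map_C, eq_intCast, Int.cast_ofNat]
  have hmonic := monic_X_cube_sub (R := ℤ)
  have hdeg : (X ^ 3 - C 2 * X - C 2 : ℤ[X]).degree = (3 : ℕ) := by
    rw [degree_eq_natDegree hmonic.ne_zero, natDegree_X_cube_sub]
  rw [← hmap]
  refine (IsPrimitive.Int.irreducible_iff_irreducible_map_cast hmonic.isPrimitive).1 ?_
  refine irreducible_of_eisenstein_criterion (P := Ideal.span {2})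
    ((Ideal.span_singleton_prime two_ne_zero).2 Int.prime_two) ?_ ?_ ?_ ?_ hmonic.isPrimitive
  · rw [hmonic.leadingCoeff, Ideal.mem_span_singleton]
    norm_num
  · intro n hn
    have hn : n < 3 := by rw [hdeg] at hn; exact_mod_cast hn
    rw [Ideal.mem_span_singleton]
    simp only [coeff_sub, coeff_C_mul, coeff_X_pow, coeff_X, coeff_C]
    interval_cases n <;> norm_num
  · rw [hdeg]
    norm_num
  · rw [Ideal.span_singleton_pow, Ideal.mem_span_singleton]
    simp [coeff_X_pow, coeff_X]

omit [NumberField K] in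
theorem coe_cube (hφ : φ ^ 3 = 2 * φ + 2) : (φ : K) ^ 3 = 2 * φ + 2 := by
  simpa only [map_pow, map_add, map_mul, map_ofNat] using congrArg (algebraMap (𝓞 K) K) hφ

theorem linearIndependent_cubic (hφ : φ ^ 3 = 2 * φ + 2) :
    LinearIndependent ℚ ![1, (φ : K), (φ : K) ^ 2] := by
  have hφ' : (φ : K) ^ 3 = 2 * φ + 2 := coe_cube hφ
  have hmin : X ^ 3 - C 2 * X - C 2 = minpoly ℚ (φ : K) :=
    minpoly.eq_of_irreducible_of_monic irreducible_X_cube_sub (by simp [hφ']) monic_X_cube_sub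
  have hdeg : (minpoly ℚ (φ : K)).natDegree = 3 := hmin ▸ natDegree_X_cube_sub
  have key : ∀ n, n = (minpoly ℚ (φ : K)).natDegree →
      LinearIndependent ℚ fun i : Fin n => (φ : K) ^ (i : ℕ) := by
    rintro n rfl
    exact linearIndependent_pow _
  convert key 3 hdeg.symm using 1
  ext i
  fin_cases i <;> simp

/-- The basis `1, φ, φ ^ 2` of a cubic field generated by a root `φ` of `X ^ 3 - 2 X - 2`. -/
noncomputable def cubicBasis (hK : finrank ℚ K = 3) (hφ : φ ^ 3 = 2 * φ + 2) :
    Basis (Fin 3) ℚ K :=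
  basisOfLinearIndependentOfCardEqFinrank (linearIndependent_cubic hφ) (by simp [hK])

theorem coe_cubicBasis (hK : finrank ℚ K = 3) (hφ : φ ^ 3 = 2 * φ + 2) :
    ⇑(cubicBasis hK hφ) = ![1, (φ : K), (φ : K) ^ 2] := by
  simp [cubicBasis]

theorem exists_coords (hK : finrank ℚ K = 3) (hφ : φ ^ 3 = 2 * φ + 2) (x : K) :
    ∃ a b c : ℚ, x = a + b * φ + c * φ ^ 2 := by
  refine ⟨(cubicBasis hK hφ).repr x 0, (cubicBasis hK hφ).repr x 1,
    (cubicBasis hK hφ).repr x 2, ?_⟩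
  have h := (cubicBasis hK hφ).sum_repr x
  rw [Fin.sum_univ_three, coe_cubicBasis] at h
  simpa [Algebra.smul_def] using h.symm

theorem coords_eq_zero (hφ : φ ^ 3 = 2 * φ + 2) {a b c : ℚ}
    (h : (a + b * φ + c * φ ^ 2 : K) = 0) : a = 0 ∧ b = 0 ∧ c = 0 := by
  have hli := Fintype.linearIndependent_iff.1 (linearIndependent_cubic (K := K) hφ)
  have := hli ![a, b, c] (by
    rw [Fin.sum_univ_three]
    simp only [Matrix.cons_val, Algebra.smul_def, eq_ratCast, mul_one]
    exact h)
  exact ⟨this 0, this 1, this 2⟩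

theorem leftMulMatrix_cubic (hK : finrank ℚ K = 3) (hφ : φ ^ 3 = 2 * φ + 2) (a b c : ℚ) :
    Algebra.leftMulMatrix (cubicBasis hK hφ) (a + b * φ + c * φ ^ 2 : K) =
      !![a, 2 * c, 2 * b; b, a + 2 * c, 2 * b + 2 * c; c, b, a + 2 * c] := by
  have hφ' : (φ : K) ^ 3 = 2 * φ + 2 := coe_cube hφ
  ext i j
  rw [Algebra.leftMulMatrix_eq_repr_mul]
  set M : Matrix (Fin 3) (Fin 3) ℚ :=
    !![a, 2 * c, 2 * b; b, a + 2 * c, 2 * b + 2 * c; c, b, a + 2 * c] with hM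
  have : (a + b * φ + c * φ ^ 2 : K) * cubicBasis hK hφ j =
      ∑ i, M i j • cubicBasis hK hφ i := by
    simp only [coe_cubicBasis, Fin.sum_univ_three, Algebra.smul_def]
    fin_cases j <;> simp [hM]
    · linear_combination c * hφ'
    · linear_combination (b + c * φ) * hφ'
  rw [this, Basis.repr_sum_self]

theorem norm_cubic (hK : finrank ℚ K = 3) (hφ : φ ^ 3 = 2 * φ + 2) (a b c : ℚ) :
    Algebra.norm ℚ (a + b * φ + c * φ ^ 2 : K) = a * (a + 2 * c) ^ 2 - a * b * (2 * b + 2 * c)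
      - 2 * c * (b * (a + 2 * c) - c * (2 * b + 2 * c)) + 2 * b * (b ^ 2 - c * (a + 2 * c)) := by
  rw [Algebra.norm_eq_matrix_det (cubicBasis hK hφ), leftMulMatrix_cubic, Matrix.det_fin_three]
  simp
  ring

theorem norm_int_cubic (hK : finrank ℚ K = 3) (hφ : φ ^ 3 = 2 * φ + 2) (a b c : ℤ) :
    Algebra.norm ℤ (a + b * φ + c * φ ^ 2 : 𝓞 K) =
      a * (a + 2 * c) ^ 2 - a * b * (2 * b + 2 * c)
      - 2 * c * (b * (a + 2 * c) - c * (2 * b + 2 * c)) + 2 * b * (b ^ 2 - c * (a + 2 * c)) := by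
  have h := norm_cubic hK hφ a b c
  rw [← @Int.cast_inj ℚ, Algebra.coe_norm_int]
  push_cast at h ⊢
  rw [← h]
  simp

theorem trace_cubic (hK : finrank ℚ K = 3) (hφ : φ ^ 3 = 2 * φ + 2) (a b c : ℚ) :
    Algebra.trace ℚ K (a + b * φ + c * φ ^ 2 : K) = 3 * a + 4 * c := by
  rw [Algebra.trace_eq_matrix_trace (cubicBasis hK hφ), leftMulMatrix_cubic,
    Matrix.trace_fin_three]
  simp
  ring

theorem discr_cubicBasis (hK : finrank ℚ K = 3) (hφ : φ ^ 3 = 2 * φ + 2) :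
    Algebra.discr ℚ ![1, (φ : K), (φ : K) ^ 2] = -76 := by
  have hφ' : (φ : K) ^ 3 = 2 * φ + 2 := coe_cube hφ
  have h0 : Algebra.trace ℚ K 1 = 3 := by simpa using trace_cubic hK hφ 1 0 0
  have h1 : Algebra.trace ℚ K φ = 0 := by simpa using trace_cubic hK hφ 0 1 0
  have h2 : Algebra.trace ℚ K (φ ^ 2) = 4 := by simpa using trace_cubic hK hφ 0 0 1
  have h3 : Algebra.trace ℚ K (φ ^ 3) = 6 := by
    have := trace_cubic hK hφ 2 2 0
    norm_num [-map_add] at this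
    rw [hφ', add_comm, this]
  have h4 : Algebra.trace ℚ K (φ ^ 4) = 8 := by
    have := trace_cubic hK hφ 0 2 2
    norm_num [-map_add] at this
    rw [← this]
    congr 1
    linear_combination (φ : K) * hφ'
  rw [Algebra.discr_def, Matrix.det_fin_three]
  simp only [Algebra.traceMatrix_apply, Algebra.traceForm_apply, Matrix.cons_val_zero,
    Matrix.cons_val_one, Matrix.cons_val, one_mul, mul_one, ← pow_succ, ← pow_succ', ← pow_two,
    ← pow_mul, h1, h2, h3]
  norm_num [h0, h4]

theorem exists_discr_mul_sq (hK : finrank ℚ K = 3) (hφ : φ ^ 3 = 2 * φ + 2) :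
    ∃ n : ℤ, n ^ 2 * discr K = -76 := by
  have hcard : Fintype.card (Free.ChooseBasisIndex ℤ (𝓞 K)) = 3 := by
    rw [← finrank_eq_card_chooseBasisIndex, RingOfIntegers.rank, hK]
  let b : Basis (Fin 3) ℤ (𝓞 K) := (RingOfIntegers.basis K).reindex (Fintype.equivFinOfCardEq hcard)
  let P : Matrix (Fin 3) (Fin 3) ℤ := b.toMatrix ![1, φ, φ ^ 2]
  refine ⟨P.det, ?_⟩
  have h := Algebra.discr_of_matrix_vecMul (A := ℤ) b P
  rw [Basis.toMatrix_map_vecMul, NumberField.discr_eq_discr K b] at h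
  rw [← h, ← @Int.cast_inj ℚ, ← eq_intCast (algebraMap ℤ ℚ),
    Algebra.discr_def, RingHom.map_det]
  push_cast
  rw [← discr_cubicBasis hK hφ, Algebra.discr_def]
  congr 1
  ext i j
  simp only [RingHom.mapMatrix_apply, Matrix.map_apply, Algebra.traceMatrix_apply,
    Algebra.traceForm_apply, eq_intCast, Algebra.coe_trace_int]
  congr 1
  fin_cases i <;> fin_cases j <;> simp

theorem abs_discr_le (hK : finrank ℚ K = 3) (hφ : φ ^ 3 = 2 * φ + 2) : |discr K| ≤ 76 := by
  obtain ⟨n, hn⟩ := exists_discr_mul_sq hK hφ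
  exact Int.le_of_dvd (by norm_num) ((abs_dvd _ _).2 ⟨-n ^ 2, by linear_combination hn⟩)

theorem nrComplexPlaces_eq_one (hK : finrank ℚ K = 3) (hφ : φ ^ 3 = 2 * φ + 2) :
    InfinitePlace.nrComplexPlaces K = 1 := by
  have h := InfinitePlace.card_add_two_mul_card_eq_rank K
  have : InfinitePlace.nrComplexPlaces K ≤ 1 := by omega
  interval_cases h' : InfinitePlace.nrComplexPlaces K
  · have hs := sign_discr K
    obtain ⟨n, hn⟩ := exists_discr_mul_sq hK hφ
    rw [h', pow_zero, Int.sign_eq_one_iff_pos] at hs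
    nlinarith [mul_nonneg (sq_nonneg n) hs.le]
  · rfl

end CubicField

section CubicArithmetic

open NumberField Module nonZeroDivisors

variable {K : Type*} [Field K] [NumberField K] {φ : 𝓞 K}

theorem norm_gen (hK : finrank ℚ K = 3) (hφ : φ ^ 3 = 2 * φ + 2) : Algebra.norm ℤ φ = 2 := by
  simpa using norm_int_cubic hK hφ 0 1 0

omit [NumberField K] in
theorem isUnit_one_add_gen (hφ : φ ^ 3 = 2 * φ + 2) : IsUnit (1 + φ) :=
  IsUnit.of_mul_eq_one (φ ^ 2 - φ - 1) (by linear_combination hφ)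

theorem isPrincipalIdealRing_cubic (hK : finrank ℚ K = 3) (hφ : φ ^ 3 = 2 * φ + 2) :
    IsPrincipalIdealRing (𝓞 K) := by
  refine RingOfIntegers.isPrincipalIdealRing_of_isPrincipal_of_norm_le fun I hI => ?_
  rw [nrComplexPlaces_eq_one hK hφ, hK, pow_one] at hI
  have hd : (|discr K| : ℝ) ≤ 76 := by exact_mod_cast abs_discr_le hK hφ
  have hs : √|(discr K : ℝ)| < 8.72 := by
    rw [Real.sqrt_lt' (by norm_num)]
    linarith
  have hπ : 4 / Real.pi < 1.274 := by
    rw [div_lt_iff₀ Real.pi_pos]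
    linarith [Real.pi_gt_d4]
  have hprod : 4 / Real.pi * √|(discr K : ℝ)| < 1.274 * 8.72 :=
    mul_lt_mul'' hπ hs (by positivity) (Real.sqrt_nonneg _)
  have hlt : (Ideal.absNorm (I : Ideal (𝓞 K)) : ℝ) < 3 := by
    norm_num [Nat.factorial] at hI
    linarith
  have hlt : Ideal.absNorm (I : Ideal (𝓞 K)) < 3 := by exact_mod_cast hlt
  have hpos := Ideal.absNorm_pos_of_nonZeroDivisors I
  obtain h | h : Ideal.absNorm (I : Ideal (𝓞 K)) = 1 ∨ Ideal.absNorm (I : Ideal (𝓞 K)) = 2 := by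
    omega
  · rw [Ideal.absNorm_eq_one_iff.1 h]
    exact top_isPrincipal
  · have hprime : (I : Ideal (𝓞 K)).IsPrime := Ideal.isPrime_of_irreducible_absNorm (by
      rw [h]; exact Nat.prime_two)
    have h2 : (2 : 𝓞 K) ∈ (I : Ideal (𝓞 K)) := by
      have := Ideal.absNorm_mem (I : Ideal (𝓞 K))
      rwa [h] at this
    have hmem : φ ∈ (I : Ideal (𝓞 K)) := hprime.mem_of_pow_mem 3 (by
      rw [hφ]
      exact add_mem (Ideal.mul_mem_right _ _ h2) h2)
    have hle : Ideal.span {φ} ≤ (I : Ideal (𝓞 K)) := (Ideal.span_singleton_le_iff_mem _).2 hmem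
    obtain ⟨J, hJ⟩ := Ideal.dvd_iff_le.2 hle
    have hn := congrArg Ideal.absNorm hJ
    rw [map_mul, Ideal.absNorm_span_singleton, norm_gen hK hφ, h] at hn
    have hJ1 : J = ⊤ := by simpa using hn
    rw [hJ1, Ideal.mul_top] at hJ
    exact ⟨φ, hJ.symm⟩

theorem units_eq_sq_or (hK : finrank ℚ K = 3) (hφ : φ ^ 3 = 2 * φ + 2) :
    ∃ η : (𝓞 K)ˣ, ∀ u : (𝓞 K)ˣ, ∃ (w : (𝓞 K)ˣ) (i j : Fin 2),
      u = (-1) ^ (i : ℕ) * η ^ (j : ℕ) * w ^ 2 := by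
  have hrank : Units.rank K = 1 := by
    have h1 := nrComplexPlaces_eq_one hK hφ
    have h2 := InfinitePlace.card_add_two_mul_card_eq_rank K
    have h3 := InfinitePlace.card_eq_nrRealPlaces_add_nrComplexPlaces K
    rw [Units.rank]
    omega
  have : Unique (Fin (Units.rank K)) := by
    rw [hrank]
    infer_instance
  refine ⟨Units.fundSystem K default, fun u => ?_⟩
  obtain ⟨⟨ζ, e⟩, he, -⟩ := Units.exist_unique_eq_mul_prod K u
  rw [Fintype.prod_unique] at he
  obtain ⟨i, hi⟩ : ∃ i : Fin 2, (ζ : (𝓞 K)ˣ) = (-1) ^ (i : ℕ) := by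
    obtain h | h := Units.torsion_eq_one_or_neg_one_of_odd_finrank (by rw [hK]; decide) ζ
    · exact ⟨0, by simpa using h⟩
    · exact ⟨1, by simpa using h⟩
  obtain ⟨k, hk | hk⟩ := Int.even_or_odd' (e default)
  · exact ⟨Units.fundSystem K default ^ k, i, 0, by
      rw [he, hi]
      simp only [hk]
      rw [mul_comm 2 k, zpow_mul]
      simp [zpow_ofNat]⟩
  · exact ⟨Units.fundSystem K default ^ k, i, 1, by
      rw [he, hi]
      simp only [hk]
      rw [zpow_add, mul_comm 2 k, zpow_mul]
      simp [zpow_ofNat, mul_comm, mul_assoc]⟩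

end CubicArithmetic

section UniqueFactorization

variable {R : Type*} [CommRing R] [IsDomain R] [UniqueFactorizationMonoid R]

theorem exists_squarefree_mul_sq {x : R} (hx : x ≠ 0) :
    ∃ d b : R, Squarefree d ∧ x = d * b ^ 2 := by
  induction x using WfDvdMonoid.induction_on_irreducible with
  | zero => exact absurd rfl hx
  | unit u hu => exact ⟨u, 1, hu.squarefree, by ring⟩
  | mul a i ha hi ih =>
    obtain ⟨d, b, hd, rfl⟩ := ih ha
    by_cases hid : i ∣ d
    · obtain ⟨e, rfl⟩ := hid
      exact ⟨e, i * b, hd.of_mul_right, by ring⟩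
    · exact ⟨i * d, b, squarefree_mul_iff.2
        ⟨hi.isRelPrime_iff_not_dvd.2 hid, hi.squarefree, hd⟩, by ring⟩

theorem Squarefree.dvd_of_forall_prime_dvd {d c : R} (hd : Squarefree d) (hd0 : d ≠ 0)
    (h : ∀ q, Prime q → q ∣ d → q ∣ c) : d ∣ c := by
  induction d using WfDvdMonoid.induction_on_irreducible with
  | zero => exact absurd rfl hd0
  | unit u hu => exact hu.dvd
  | mul a i ha hi ih =>
    have hai := squarefree_mul_iff.1 hd
    exact hai.1.mul_dvd (h i hi.prime (dvd_mul_right _ _))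
      (ih hai.2.2 ha fun q hq hqa => h q hq (hqa.mul_left _))

theorem Prime.dvd_of_squarefree_mul_sq_mul_eq_sq {d b y z q : R} (hd : Squarefree d) (hb : b ≠ 0)
    (h : d * b ^ 2 * y = z ^ 2) (hq : Prime q) (hqd : q ∣ d) : q ∣ y := by
  have hbz : b ∣ z :=
    (IsIntegrallyClosed.pow_dvd_pow_iff two_ne_zero).1 ⟨d * y, by rw [← h]; ring⟩
  obtain ⟨w, rfl⟩ := hbz
  have hw : d * y = w ^ 2 := mul_left_cancel₀ (pow_ne_zero 2 hb) (by linear_combination h)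
  obtain ⟨e, rfl⟩ := hqd
  obtain ⟨v, rfl⟩ : q ∣ w := hq.dvd_of_dvd_pow ⟨e * y, by rw [← hw]; ring⟩
  have hv : e * y = q * v ^ 2 := mul_left_cancel₀ hq.ne_zero (by linear_combination hw)
  refine (hq.dvd_or_dvd ⟨v ^ 2, hv⟩).resolve_left fun ⟨f, hf⟩ => ?_
  exact hq.not_isUnit (hd q ⟨f, by rw [hf]; ring⟩)

end UniqueFactorization

section CubicDescent

open NumberField Module

variable {K : Type*} [Field K] [NumberField K] {φ : 𝓞 K}

omit [NumberField K] in
theorem gen_sq_dvd_two (hφ : φ ^ 3 = 2 * φ + 2) : φ ^ 2 ∣ 2 :=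
  ⟨φ - φ ^ 2 + 2, by linear_combination (φ - 1) * hφ⟩

theorem not_isUnit_gen (hK : finrank ℚ K = 3) (hφ : φ ^ 3 = 2 * φ + 2) : ¬ IsUnit φ := by
  intro h
  have := h.map (Algebra.norm ℤ)
  rw [norm_gen hK hφ, Int.isUnit_iff] at this
  omega

theorem gen_ne_zero (hφ : φ ^ 3 = 2 * φ + 2) : φ ≠ 0 := by
  rintro rfl
  norm_num at hφ

theorem gen_dvd_or_dvd_sub_one (hK : finrank ℚ K = 3) (hφ : φ ^ 3 = 2 * φ + 2) (w : 𝓞 K) :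
    φ ∣ w ∨ φ ∣ w - 1 := by
  have hcard : Nat.card (𝓞 K ⧸ Ideal.span {φ}) = 2 := by
    rw [← Submodule.cardQuot_apply, ← Ideal.absNorm_apply, Ideal.absNorm_span_singleton,
      norm_gen hK hφ]
    rfl
  obtain ⟨y, -, hy⟩ := (Nat.card_eq_two_iff' (0 : 𝓞 K ⧸ Ideal.span {φ})).1 hcard
  rw [← Ideal.mem_span_singleton, ← Ideal.mem_span_singleton, ← Ideal.Quotient.eq_zero_iff_mem,
    ← Ideal.Quotient.eq_zero_iff_mem, map_sub, sub_eq_zero, map_one]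
  by_contra! hcon
  have : Nontrivial (𝓞 K ⧸ Ideal.span {φ}) := Ideal.Quotient.nontrivial_iff.2 fun h =>
    not_isUnit_gen hK hφ (Ideal.span_singleton_eq_top.1 h)
  exact hcon.2 ((hy _ hcon.1).trans (hy 1 one_ne_zero).symm)

theorem gen_sq_dvd_sq_sub_one (hK : finrank ℚ K = 3) (hφ : φ ^ 3 = 2 * φ + 2) {w : 𝓞 K}
    (hw : ¬ φ ∣ w) : φ ^ 2 ∣ w ^ 2 - 1 := by
  obtain ⟨h, hh⟩ := (gen_dvd_or_dvd_sub_one hK hφ w).resolve_left hw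
  obtain ⟨k, hk⟩ := gen_sq_dvd_two hφ
  exact ⟨h ^ 2 + k * (w - 1), by linear_combination (w - 1 + φ * h) * hh + (w - 1) * hk⟩

theorem gen_sq_dvd_neg_one_pow_mul_sq_sub_one (hK : finrank ℚ K = 3)
    (hφ : φ ^ 3 = 2 * φ + 2) (i : ℕ) (w : (𝓞 K)ˣ) :
    φ ^ 2 ∣ (-1) ^ i * (w : 𝓞 K) ^ 2 - 1 := by
  have h := gen_sq_dvd_sq_sub_one hK hφ (w := w)
    fun h => not_isUnit_gen hK hφ (isUnit_of_dvd_unit h w.isUnit)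
  obtain hi | hi := neg_one_pow_eq_or (𝓞 K) i
  · rwa [hi, one_mul]
  · rw [hi, show -1 * (w : 𝓞 K) ^ 2 - 1 = -(w ^ 2 - 1) - 2 by ring]
    exact dvd_sub (dvd_neg.2 h) (gen_sq_dvd_two hφ)

theorem not_gen_sq_dvd_gen (hK : finrank ℚ K = 3) (hφ : φ ^ 3 = 2 * φ + 2) : ¬ φ ^ 2 ∣ φ := by
  rintro ⟨k, hk⟩
  exact not_isUnit_gen hK hφ (IsUnit.of_mul_eq_one k
    (mul_left_cancel₀ (gen_ne_zero hφ) (by linear_combination -hk)))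

theorem unit_eq_sq (hK : finrank ℚ K = 3) (hφ : φ ^ 3 = 2 * φ + 2) {u : (𝓞 K)ˣ}
    (hu : φ ^ 2 ∣ (u : 𝓞 K) - 1) (hnorm : 0 < Algebra.norm ℤ (u : 𝓞 K)) :
    ∃ w : (𝓞 K)ˣ, u = w ^ 2 := by
  obtain ⟨η, hη⟩ := units_eq_sq_or hK hφ
  obtain ⟨ε, hε⟩ := isUnit_one_add_gen hφ
  obtain ⟨v, i, j, hv⟩ := hη ε
  obtain ⟨w, k, l, hw⟩ := hη u
  have hj : (j : ℕ) = 1 := by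
    refine (show (j : ℕ) = 0 ∨ (j : ℕ) = 1 by omega).resolve_left fun hj => ?_
    have h := gen_sq_dvd_neg_one_pow_mul_sq_sub_one hK hφ i v
    rw [hj, pow_zero, mul_one] at hv
    have hv' := congrArg (Units.val) hv
    push_cast at hv'
    rw [← hv', hε, add_sub_cancel_left] at h
    exact not_gen_sq_dvd_gen hK hφ h
  have hl : (l : ℕ) = 0 := by
    refine (show (l : ℕ) = 0 ∨ (l : ℕ) = 1 by omega).resolve_right fun hl => ?_
    have h := gen_sq_dvd_neg_one_pow_mul_sq_sub_one hK hφ (i + k) (η * v * w)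
    have hv' := congrArg (Units.val) hv
    have hw' := congrArg (Units.val) hw
    rw [hj] at hv'
    rw [hl] at hw'
    push_cast at hv' hw' h
    rw [show (-1 : 𝓞 K) ^ (i + k : ℕ) * (η * v * w) ^ 2 - 1 = φ + (1 + φ) * (u - 1) by
      rw [← hε, hv', hw', pow_add]
      have : φ = ε - 1 := by rw [hε]; ring
      rw [this, hv']
      ring] at h
    exact not_gen_sq_dvd_gen hK hφ ((dvd_add_left (hu.mul_left _)).1 h)
  rw [hl, pow_zero, mul_one] at hw
  refine ⟨w, ?_⟩
  obtain hk | hk := neg_one_pow_eq_or ((𝓞 K)ˣ) (k : ℕ)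
  · rwa [hk, one_mul] at hw
  · rw [hk] at hw
    have hneg : Algebra.norm ℤ (-1 : 𝓞 K) = -1 := by
      simpa using norm_int_cubic hK hφ (-1) 0 0
    rw [hw] at hnorm
    push_cast at hnorm
    rw [map_mul, map_pow, hneg] at hnorm
    nlinarith [sq_nonneg (Algebra.norm ℤ (w : 𝓞 K))]

theorem exists_sq_eq (hK : finrank ℚ K = 3) (hφ : φ ^ 3 = 2 * φ + 2) {r s t : ℤ}
    (hrs : IsCoprime r s) (ht : t ≠ 0)
    (h : t ^ 2 = r ^ 3 - r ^ 2 * s ^ 2 - 21 * r * s ^ 4 - 31 * s ^ 6) (hodd : Odd (r + s)) :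
    ∃ γ : 𝓞 K, (r : 𝓞 K) - (φ ^ 2 + 2 * φ - 1) * s ^ 2 = γ ^ 2 := by
  have := isPrincipalIdealRing_cubic hK hφ
  set θ : 𝓞 K := φ ^ 2 + 2 * φ - 1 with hθ
  set x : 𝓞 K := r - θ * s ^ 2 with hx
  set y : 𝓞 K := r ^ 2 + r * θ * s ^ 2 + θ ^ 2 * s ^ 4 - s ^ 2 * r - θ * s ^ 4 - 21 * s ^ 4 with hy
  have h' : (t : 𝓞 K) ^ 2 = r ^ 3 - r ^ 2 * s ^ 2 - 21 * r * s ^ 4 - 31 * s ^ 6 := by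
    exact_mod_cast congrArg (Int.cast : ℤ → 𝓞 K) h
  have hf : θ ^ 3 - θ ^ 2 - 21 * θ - 31 = 0 := by
    rw [hθ]
    linear_combination (φ ^ 3 + 6 * φ ^ 2 + 10 * φ + 6) * hφ
  have hxy : x * y = (t : 𝓞 K) ^ 2 := by
    rw [hx, hy]
    linear_combination -h' - (s : 𝓞 K) ^ 6 * hf
  have hnx : Algebra.norm ℤ x = t ^ 2 := by
    have := norm_int_cubic hK hφ (r + s ^ 2) (-2 * s ^ 2) (-s ^ 2)
    push_cast at this
    rw [show x = r + s ^ 2 + -2 * s ^ 2 * φ + -s ^ 2 * φ ^ 2 by rw [hx, hθ]; ring, this, h]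
    ring
  have ht' : (t : 𝓞 K) ≠ 0 := Int.cast_ne_zero.2 ht
  have hx0 : x ≠ 0 := by
    intro h0
    rw [h0, zero_mul] at hxy
    exact pow_ne_zero 2 ht' hxy.symm
  obtain ⟨d, b, hd, hdb⟩ := exists_squarefree_mul_sq hx0
  have hd0 : d ≠ 0 := hd.ne_zero
  have hb0 : b ≠ 0 := by
    rintro rfl
    exact hx0 (by rw [hdb]; ring)
  have hdvd : d ∣ φ * (3 + 2 * φ) := by
    refine hd.dvd_of_forall_prime_dvd hd0 fun q hq hqd => ?_
    have hqy : q ∣ y := hq.dvd_of_squarefree_mul_sq_mul_eq_sq hd hb0 (hdb ▸ hxy) hqd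
    have hqx : q ∣ x := hdb ▸ hqd.mul_right _
    have hqs : ¬ q ∣ s := by
      intro hqs
      obtain ⟨a, c, hac⟩ := hrs
      have hqr : q ∣ r := by
        rw [show (r : 𝓞 K) = x + θ * s * s by rw [hx]; ring]
        exact dvd_add hqx (hqs.mul_left _)
      refine hq.not_isUnit (isUnit_of_dvd_one ?_)
      have : (a * r + c * s : 𝓞 K) = 1 := by exact_mod_cast congrArg (Int.cast : ℤ → 𝓞 K) hac
      rw [← this]
      exact dvd_add (hqr.mul_left _) (hqs.mul_left _)
    have hder : q ∣ φ ^ 4 * (3 + 2 * φ) * s ^ 4 := by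
      have : φ ^ 4 * (3 + 2 * φ) * s ^ 4 = y - x * (r + 2 * θ * s ^ 2 - s ^ 2) := by
        rw [hx, hy, hθ]
        linear_combination (2 * φ ^ 2 - 8) * (s : 𝓞 K) ^ 4 * hφ
      rw [this]
      exact dvd_sub hqy (hqx.mul_right _)
    obtain hq' | hq' := hq.dvd_or_dvd
      ((hq.dvd_or_dvd hder).resolve_right fun h => hqs (hq.dvd_of_dvd_pow h))
    · exact (hq.dvd_of_dvd_pow hq').mul_right _
    · exact hq'.mul_left _
  have hnd : IsUnit d := by
    have h38 : Algebra.norm ℤ d ∣ 38 := by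
      have h1 := norm_int_cubic hK hφ 3 2 0
      norm_num at h1
      have := map_dvd (Algebra.norm ℤ) hdvd
      rwa [map_mul, h1, norm_gen hK hφ] at this
    have hnsq : Algebra.norm ℤ d * Algebra.norm ℤ b ^ 2 = t ^ 2 := by
      rw [← hnx, hdb, map_mul, map_pow]
    have hnb : Algebra.norm ℤ b ≠ 0 := Algebra.norm_ne_zero_iff.2 hb0
    obtain ⟨k, rfl⟩ : Algebra.norm ℤ b ∣ t :=
      (Int.pow_dvd_pow_iff two_ne_zero).1 ⟨_, by rw [← hnsq, mul_comm]⟩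
    have hk : Algebra.norm ℤ d = k ^ 2 :=
      mul_right_cancel₀ (pow_ne_zero 2 hnb) (by rw [hnsq]; ring)
    rw [hk] at h38
    have hle : k ^ 2 ≤ 38 := Int.le_of_dvd (by norm_num) h38
    have h1 : k ≤ 6 := by nlinarith
    have h2 : -6 ≤ k := by nlinarith
    rw [NumberField.isUnit_iff_norm, RingOfIntegers.coe_norm, ← Algebra.coe_norm_int, hk]
    interval_cases k <;> revert h38 <;> norm_num
  obtain ⟨u, rfl⟩ := hnd
  have hxmod : φ ^ 2 ∣ x - 1 := by
    obtain ⟨m, hm⟩ := hodd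
    obtain ⟨k, hk⟩ := gen_sq_dvd_two hφ
    have hm' : (r + s : 𝓞 K) = 2 * m + 1 := by exact_mod_cast congrArg (Int.cast : ℤ → 𝓞 K) hm
    obtain ⟨n, hn⟩ : Even (s * (s - 1)) := Int.even_mul_pred_self s
    have hn' : (s * (s - 1) : 𝓞 K) = n + n := by
      exact_mod_cast congrArg (Int.cast : ℤ → 𝓞 K) hn
    refine ⟨k * (m + n - φ * s ^ 2) - s ^ 2, ?_⟩
    rw [hx, hθ]
    linear_combination hm' + hn' + (m + n - φ * s ^ 2) * hk
  have hbmod : φ ^ 2 ∣ b ^ 2 - 1 := by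
    refine gen_sq_dvd_sq_sub_one hK hφ fun hb => not_isUnit_gen hK hφ ?_
    refine isUnit_of_dvd_one ?_
    rw [show (1 : 𝓞 K) = u * b * b - (x - 1) by rw [hdb]; ring]
    exact dvd_sub (hb.mul_left _) ((dvd_pow_self φ two_ne_zero).trans hxmod)
  have humod : φ ^ 2 ∣ (u : 𝓞 K) - 1 := by
    rw [show (u : 𝓞 K) - 1 = (x - 1) - u * (b ^ 2 - 1) by rw [hdb]; ring]
    exact dvd_sub hxmod (hbmod.mul_left _)
  have hupos : 0 < Algebra.norm ℤ (u : 𝓞 K) := by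
    rw [hdb, map_mul, map_pow] at hnx
    by_contra! hneg
    nlinarith [sq_nonneg (Algebra.norm ℤ b), sq_pos_of_ne_zero ht]
  obtain ⟨w, rfl⟩ := unit_eq_sq hK hφ humod hupos
  exact ⟨w * b, by rw [hdb]; push_cast; ring⟩

end CubicDescent

section EllipticCurve

open NumberField Module

theorem exists_halving_of_sq {K : Type*} [Field K] [NumberField K] {φ : 𝓞 K}
    (hK : finrank ℚ K = 3) (hφ : φ ^ 3 = 2 * φ + 2) {x : ℚ} {γ : K}
    (h : (x : K) - (φ ^ 2 + 2 * φ - 1) = γ ^ 2) :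
    ∃ p c : ℚ, c ^ 2 * (p ^ 3 - p ^ 2 - 21 * p - 31) = 1 ∧
      4 * x = c ^ 2 * (p ^ 4 + 42 * p ^ 2 + 248 * p + 317) := by
  have hφ' : (φ : K) ^ 3 = 2 * φ + 2 := coe_cube hφ
  obtain ⟨a', b', c', hγ⟩ := exists_coords hK hφ γ
  obtain ⟨a, b, c, ha, hb, hc⟩ : ∃ a b c : ℚ, a' = a - b + 9 * c ∧ b' = 2 * b + 6 * c ∧
      c' = b + 4 * c :=
    ⟨a' + 13 / 2 * b' - 12 * c', 2 * b' - 3 * c', c' - b' / 2, by ring, by ring, by ring⟩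
  subst ha hb hc
  have key : (((a ^ 2 + 62 * b * c + 31 * c ^ 2 - x)
      - (2 * a * b + 42 * b * c + 52 * c ^ 2 + 1)
      + 9 * (b ^ 2 + 2 * a * c + 2 * b * c + 22 * c ^ 2) : ℚ) : K)
      + ((2 * (2 * a * b + 42 * b * c + 52 * c ^ 2 + 1)
      + 6 * (b ^ 2 + 2 * a * c + 2 * b * c + 22 * c ^ 2) : ℚ) : K) * φ
      + ((2 * a * b + 42 * b * c + 52 * c ^ 2 + 1
      + 4 * (b ^ 2 + 2 * a * c + 2 * b * c + 22 * c ^ 2) : ℚ) : K) * φ ^ 2 = 0 := by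
    rw [hγ] at h
    push_cast at h ⊢
    linear_combination -h - ((b + 4 * c) ^ 2 * (φ : K) + 2 * (2 * b + 6 * c) * (b + 4 * c)) * hφ'
  obtain ⟨h0, h1, h2⟩ := coords_eq_zero hφ key
  have e2 : b ^ 2 + 2 * a * c + 2 * b * c + 22 * c ^ 2 = 0 := by linarith
  have e1 : 2 * a * b + 42 * b * c + 52 * c ^ 2 + 1 = 0 := by linarith
  have e0 : a ^ 2 + 62 * b * c + 31 * c ^ 2 - x = 0 := by linarith
  have hc : c ≠ 0 := by
    rintro rfl
    have : b = 0 := by simpa using e2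
    subst this
    norm_num at e1
  obtain ⟨p, rfl⟩ : ∃ p, b = (p - 1) * c := ⟨b / c + 1, by field_simp; ring⟩
  obtain rfl : a = -c * (p ^ 2 + 21) / 2 := by
    have : c * (2 * a + c * (p ^ 2 + 21)) = 0 := by linear_combination e2
    have := (mul_eq_zero.1 this).resolve_left hc
    linarith
  exact ⟨p, c, by linear_combination -e1, by linear_combination -4 * e0⟩

theorem exists_cubicField : ∃ (K : Type) (_ : Field K) (_ : NumberField K) (φ : 𝓞 K),
    finrank ℚ K = 3 ∧ φ ^ 3 = 2 * φ + 2 := by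
  have : Fact (Irreducible (X ^ 3 - C 2 * X - C 2 : ℚ[X])) := ⟨irreducible_X_cube_sub⟩
  have hne : (X ^ 3 - C 2 * X - C 2 : ℚ[X]) ≠ 0 := monic_X_cube_sub.ne_zero
  have : FiniteDimensional ℚ (AdjoinRoot (X ^ 3 - C 2 * X - C 2 : ℚ[X])) :=
    (AdjoinRoot.powerBasis hne).finite
  have hroot : AdjoinRoot.root (X ^ 3 - C 2 * X - C 2 : ℚ[X]) ^ 3 =
      2 * AdjoinRoot.root (X ^ 3 - C 2 * X - C 2 : ℚ[X]) + 2 := by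
    have h := AdjoinRoot.eval₂_root (X ^ 3 - C 2 * X - C 2 : ℚ[X])
    simp only [eval₂_sub, eval₂_mul, eval₂_X_pow, eval₂_X, eval₂_ofNat, map_ofNat] at h
    linear_combination h
  refine ⟨AdjoinRoot (X ^ 3 - C 2 * X - C 2 : ℚ[X]), inferInstance, { }, ⟨AdjoinRoot.root _, ?_⟩,
    ?_, ?_⟩
  · refine ⟨X ^ 3 - C 2 * X - C 2, monic_X_cube_sub, ?_⟩
    simp only [eval₂_sub, eval₂_mul, eval₂_X_pow, eval₂_X, eval₂_ofNat, map_ofNat]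
    linear_combination hroot
  · rw [(AdjoinRoot.powerBasis hne).finrank, AdjoinRoot.powerBasis_dim, natDegree_X_cube_sub]
  · exact NumberField.RingOfIntegers.ext hroot

theorem odd_add_of_sq_eq {r s t : ℤ} (hrs : IsCoprime r s)
    (h : t ^ 2 = r ^ 3 - r ^ 2 * s ^ 2 - 21 * r * s ^ 4 - 31 * s ^ 6) : Odd (r + s) := by
  by_contra hodd
  rw [Int.not_odd_iff_even, Int.even_add] at hodd
  obtain hr | hr := Int.even_or_odd r
  · have := hrs.isUnit_of_dvd' hr.two_dvd (hodd.1 hr).two_dvd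
    rw [Int.isUnit_iff] at this
    omega
  · have hs : Odd s := by rwa [← Int.not_even_iff_odd, ← hodd, Int.not_even_iff_odd]
    obtain ⟨a, rfl⟩ := hr
    obtain ⟨b, rfl⟩ := hs
    have h32 := congrArg (Int.cast : ℤ → ZMod 32) h
    push_cast at h32
    have hsq : ∀ z : ZMod 32, z ^ 2 ∈ [0, 1, 4, 9, 16, 17, 25] := by decide
    have hval : ∀ a b : ZMod 32, (2 * a + 1) ^ 3 - (2 * a + 1) ^ 2 * (2 * b + 1) ^ 2
        - 21 * (2 * a + 1) * (2 * b + 1) ^ 4 - 31 * (2 * b + 1) ^ 6 ∉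
          ([0, 1, 4, 9, 16, 17, 25] : List (ZMod 32)) := by
      decide +kernel
    exact hval a b (h32 ▸ hsq t)

theorem odd_of_sq_eq {r s t : ℤ} (hrs : Odd (r + s))
    (h : t ^ 2 = r ^ 3 - r ^ 2 * s ^ 2 - 21 * r * s ^ 4 - 31 * s ^ 6) : Odd t := by
  have : Odd (t ^ 2) := by
    rw [h]
    simp only [← Int.not_even_iff_odd, parity_simps] at hrs ⊢
    have h21 : ¬ Even (21 : ℤ) := by decide
    have h31 : ¬ Even (31 : ℤ) := by decide
    simp only [h21, h31]
    tauto
  exact Int.odd_pow.1 this |>.resolve_right (by norm_num)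

theorem exists_integral_model {p y : ℚ} (h : y ^ 2 = p ^ 3 - p ^ 2 - 21 * p - 31) :
    ∃ r s t : ℤ, s ≠ 0 ∧ IsCoprime r s ∧ p = r / s ^ 2 ∧
      t ^ 2 = r ^ 3 - r ^ 2 * s ^ 2 - 21 * r * s ^ 4 - 31 * s ^ 6 := by
  obtain ⟨n, d, hdpos, hcop, hp⟩ : ∃ n d : ℤ, 0 < d ∧ IsCoprime n d ∧ p = n / d :=
    ⟨p.num, p.den, by exact_mod_cast p.den_pos, p.isCoprime_num_den,
      by exact_mod_cast p.num_div_den.symm⟩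
  have hd0 : (d : ℚ) ≠ 0 := by exact_mod_cast hdpos.ne'
  have hsq : (y * d ^ 2) ^ 2 =
      ((d * (n ^ 3 - n ^ 2 * d - 21 * n * d ^ 2 - 31 * d ^ 3) : ℤ) : ℚ) := by
    rw [mul_pow, h, hp]
    push_cast
    field_simp
  obtain ⟨N, hN⟩ : ∃ N : ℤ, (N : ℚ) = y * d ^ 2 := by
    have hint : IsIntegral ℤ (y * d ^ 2) := by
      refine IsIntegral.of_pow two_pos ?_
      rw [hsq]
      exact isIntegral_algebraMap
    exact IsIntegrallyClosed.isIntegral_iff.1 hint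
  have hNsq : d * (n ^ 3 - n ^ 2 * d - 21 * n * d ^ 2 - 31 * d ^ 3) = N ^ 2 := by
    rw [← hN] at hsq
    exact_mod_cast hsq.symm
  have hcop' : IsCoprime d (n ^ 3 - n ^ 2 * d - 21 * n * d ^ 2 - 31 * d ^ 3) := by
    have : IsCoprime d (n ^ 3) := hcop.symm.pow_right
    rw [show n ^ 3 - n ^ 2 * d - 21 * n * d ^ 2 - 31 * d ^ 3 =
      n ^ 3 + d * (-n ^ 2 - 21 * n * d - 31 * d ^ 2) by ring]
    exact this.add_mul_left_right _
  obtain ⟨s, hs⟩ := Int.sq_of_isCoprime hcop' hNsq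
  have hs : d = s ^ 2 := hs.resolve_right fun h => by nlinarith [sq_nonneg s]
  have hs0 : s ≠ 0 := by
    rintro rfl
    norm_num at hs
    omega
  rw [hs] at hcop hNsq
  obtain ⟨t, rfl⟩ : s ∣ N := (Int.pow_dvd_pow_iff two_ne_zero).1 ⟨_, hNsq.symm⟩
  refine ⟨n, s, t, hs0, (IsCoprime.pow_right_iff two_pos).1 hcop, ?_, ?_⟩
  · rw [hp, hs]
    push_cast
    rfl
  · exact mul_left_cancel₀ (pow_ne_zero 2 hs0) (by linear_combination -hNsq)

theorem two_pow_dvd_of_sq_eq (n : ℕ) {r s t : ℤ} (hs : s ≠ 0) (hrs : IsCoprime r s)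
    (h : t ^ 2 = r ^ 3 - r ^ 2 * s ^ 2 - 21 * r * s ^ 4 - 31 * s ^ 6) : 2 ^ n ∣ s := by
  induction n generalizing r s t with
  | zero => simp
  | succ n ih =>
    obtain ⟨K, _, _, φ, hK, hφ⟩ := exists_cubicField
    have hodd := odd_add_of_sq_eq hrs h
    have ht : t ≠ 0 := by
      rintro rfl
      exact absurd (odd_of_sq_eq hodd h) (by decide)
    obtain ⟨γ, hγ⟩ := exists_sq_eq hK hφ hrs ht h hodd
    have hsK : (s : K) ≠ 0 := Int.cast_ne_zero.2 hs
    obtain ⟨p, c, hc, hx⟩ := exists_halving_of_sq hK hφ (x := r / s ^ 2) (γ := γ / s) (by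
      have h' := congrArg (algebraMap (𝓞 K) K) hγ
      simp only [map_sub, map_mul, map_add, map_pow, map_one, map_ofNat, map_intCast] at h'
      rw [div_pow, ← h']
      push_cast
      field_simp)
    have hc0 : c ≠ 0 := by
      rintro rfl
      norm_num at hc
    obtain ⟨r', s', t', hs', hrs', hp, h'⟩ := exists_integral_model (p := p) (y := c⁻¹) (by
      field_simp
      linear_combination -hc)
    have hodd' := odd_add_of_sq_eq hrs' h'
    have hsQ : (s : ℚ) ≠ 0 := Int.cast_ne_zero.2 hs
    have hsQ' : (s' : ℚ) ≠ 0 := Int.cast_ne_zero.2 hs'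
    have h'Q : (t' : ℚ) ^ 2 = r' ^ 3 - r' ^ 2 * s' ^ 2 - 21 * r' * s' ^ 4 - 31 * s' ^ 6 := by
      exact_mod_cast congrArg (Int.cast : ℤ → ℚ) h'
    have hmain : 4 * r * s' ^ 2 * t' ^ 2 =
        s ^ 2 * (r' ^ 4 + 42 * r' ^ 2 * s' ^ 4 + 248 * r' * s' ^ 6 + 317 * s' ^ 8) := by
      have hct : c ^ 2 * (t' : ℚ) ^ 2 = s' ^ 6 := by
        rw [hp] at hc
        field_simp at hc
        rw [h'Q]
        linear_combination hc
      have hx' : (4 * r * s' ^ 8 : ℚ) = s ^ 2 * c ^ 2 *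
          (r' ^ 4 + 42 * r' ^ 2 * s' ^ 4 + 248 * r' * s' ^ 6 + 317 * s' ^ 8) := by
        rw [hp] at hx
        field_simp at hx
        linear_combination hx
      have : (4 * r * s' ^ 2 * t' ^ 2 : ℚ) =
          s ^ 2 * (r' ^ 4 + 42 * r' ^ 2 * s' ^ 4 + 248 * r' * s' ^ 6 + 317 * s' ^ 8) :=
        mul_left_cancel₀ (pow_ne_zero 6 hsQ') (by
          linear_combination t' ^ 2 * hx' + s ^ 2 *
            (r' ^ 4 + 42 * r' ^ 2 * s' ^ 4 + 248 * r' * s' ^ 6 + 317 * s' ^ 8) * hct)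
      exact_mod_cast this
    obtain ⟨k, hk⟩ := ih hs' hrs' h'
    have hG : Odd (r' ^ 4 + 42 * r' ^ 2 * s' ^ 4 + 248 * r' * s' ^ 6 + 317 * s' ^ 8) := by
      have h317 : ¬ Even (317 : ℤ) := by decide
      have h42 : Even (42 : ℤ) := by decide
      have h248 : Even (248 : ℤ) := by decide
      simp only [← Int.not_even_iff_odd, parity_simps] at hodd' ⊢
      simp only [h317, h42, h248]
      tauto
    have hcop : IsCoprime ((2 ^ (n + 1)) ^ 2 : ℤ)
        (r' ^ 4 + 42 * r' ^ 2 * s' ^ 4 + 248 * r' * s' ^ 6 + 317 * s' ^ 8) :=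
      ((Int.isCoprime_two_left.2 hG).pow_left).pow_left
    refine (Int.pow_dvd_pow_iff two_ne_zero).1 (hcop.dvd_of_dvd_mul_right ?_)
    rw [← hmain, hk]
    exact ⟨r * k ^ 2 * t' ^ 2, by ring⟩

theorem ellipticCurve_no_rational_point (x y : ℚ) : y ^ 2 ≠ x ^ 3 - x ^ 2 - 21 * x - 31 := by
  intro h
  obtain ⟨r, s, t, hs, hrs, -, ht⟩ := exists_integral_model h
  have hdvd := two_pow_dvd_of_sq_eq s.natAbs hs hrs ht
  have hle := Int.le_of_dvd (abs_pos.2 hs) ((dvd_abs _ _).2 hdvd)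
  have hlt : (s.natAbs : ℤ) < 2 ^ s.natAbs := by exact_mod_cast Nat.lt_two_pow_self
  rw [Int.natCast_natAbs] at hlt
  exact hlt.not_ge hle

end EllipticCurve

section Polynomials

theorem Polynomial.irreducible_comp_X_sq {F : Type*} [Field F] {f : F[X]} (hf : f.Monic)
    (hirr : Irreducible f) (h : ∀ y : F, y ^ 2 ≠ (-1) ^ f.natDegree * f.coeff 0) :
    Irreducible (f.comp (X ^ 2)) := by
  refine irreducible_comp hf (monic_X_pow 2) hirr fun E _ _ x hx => ?_
  have hint : IsIntegral F x := by
    by_contra hx'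
    exact hirr.ne_zero (hx ▸ minpoly.eq_zero hx')
  rw [Polynomial.map_pow, map_X]
  refine (X_pow_sub_C_irreducible_iff_of_prime Nat.prime_two).2 fun b hb => ?_
  refine h (Algebra.norm F b) ?_
  rw [← map_pow, hb, ← IntermediateField.adjoin.powerBasis_gen hint,
    Algebra.PowerBasis.norm_gen_eq_coeff_zero_minpoly, IntermediateField.adjoin.powerBasis_gen,
    IntermediateField.adjoin.powerBasis_dim, IntermediateField.minpoly_gen, hx]

theorem Polynomial.irreducible_comp_C_mul_X_add_C {F : Type*} [Field F] {f : F[X]}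
    (hf : Irreducible f) {a : F} (ha : a ≠ 0) (b : F) : Irreducible (f.comp (C a * X + C b)) := by
  have := invertibleOfNonzero ha
  exact (MulEquiv.irreducible_iff (algEquivCMulXAddC a b)).2 hf

theorem irreducible_X_cube_sub_X_sq_sub :
    Irreducible (X ^ 3 - X ^ 2 - 21 * X - 31 : ℚ[X]) := by
  have hdeg : (X ^ 3 - X ^ 2 - 21 * X - 31 : ℚ[X]).natDegree = 3 := by
    compute_degree!
  rw [irreducible_iff_roots_eq_zero_of_degree_le_three (by omega) (by omega)]
  refine Multiset.eq_zero_of_forall_notMem fun x hx => ?_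
  have := isRoot_of_mem_roots hx
  simp only [IsRoot, eval_sub, eval_pow, eval_X, eval_mul, eval_ofNat] at this
  exact ellipticCurve_no_rational_point x 0 (by rw [this]; norm_num)

theorem monic_sextic : (X ^ 6 - X ^ 4 - 21 * X ^ 2 - 31 : ℚ[X]).Monic := by
  monicity!

theorem natDegree_sextic : (X ^ 6 - X ^ 4 - 21 * X ^ 2 - 31 : ℚ[X]).natDegree = 6 := by
  compute_degree!

theorem irreducible_sextic : Irreducible (X ^ 6 - X ^ 4 - 21 * X ^ 2 - 31 : ℚ[X]) := by
  have hcomp : (X ^ 6 - X ^ 4 - 21 * X ^ 2 - 31 : ℚ[X]) =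
      (X ^ 3 - X ^ 2 - 21 * X - 31 : ℚ[X]).comp (X ^ 2) := by
    simp only [sub_comp, mul_comp, pow_comp, X_comp, ofNat_comp]
    ring
  have hdeg : (X ^ 3 - X ^ 2 - 21 * X - 31 : ℚ[X]).natDegree = 3 := by
    compute_degree!
  rw [hcomp]
  refine irreducible_comp_X_sq (by monicity!) irreducible_X_cube_sub_X_sq_sub fun y hy => ?_
  have h31 : ¬ IsSquare (31 : ℚ) := by decide +kernel
  refine h31 ⟨y, ?_⟩
  rw [hdeg, coeff_zero_eq_eval_zero] at hy
  norm_num at hy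
  linarith

theorem irreducible_sextic_comp {a : ℚ} (ha : a ≠ 0) (k : ℚ) :
    Irreducible ((X ^ 6 - X ^ 4 - 21 * X ^ 2 - 31 : ℚ[X]).comp (C a * X ^ 2 + C k)) := by
  set F : ℚ[X] := X ^ 6 - X ^ 4 - 21 * X ^ 2 - 31 with hF
  have hunit : IsUnit (C (a ^ 6)⁻¹ : ℚ[X]) := isUnit_C.2 (by positivity : (a ^ 6)⁻¹ ≠ 0).isUnit
  have hirr : Irreducible (C (a ^ 6)⁻¹ * F.comp (C a * X + C k)) :=
    (irreducible_isUnit_mul hunit).2 (irreducible_comp_C_mul_X_add_C irreducible_sextic ha k)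
  have hlin : (C a * X + C k).natDegree = 1 := natDegree_linear ha
  have hdeg : (C (a ^ 6)⁻¹ * F.comp (C a * X + C k)).natDegree = 6 := by
    rw [natDegree_C_mul (by positivity), natDegree_comp, hlin, hF, natDegree_sextic]
  have hmonic : (C (a ^ 6)⁻¹ * F.comp (C a * X + C k)).Monic := by
    rw [Monic, leadingCoeff_mul, leadingCoeff_C, leadingCoeff_comp (by omega),
      leadingCoeff_linear ha, hF, monic_sextic.leadingCoeff, natDegree_sextic]
    field_simp
  have h := irreducible_comp_X_sq hmonic hirr fun y hy => by
    rw [hdeg, coeff_zero_eq_eval_zero] at hy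
    simp only [hF, eval_mul, eval_C, eval_comp, eval_add, eval_X, eval_sub, eval_pow,
      eval_ofNat] at hy
    refine ellipticCurve_no_rational_point (k ^ 2) (y * a ^ 3) ?_
    field_simp at hy
    linear_combination hy
  rw [mul_comp, C_comp, irreducible_isUnit_mul hunit, comp_assoc] at h
  simpa using h

end Polynomials

theorem sextic_resisting_quadratic_substitutions :
    Irreducible (X ^ 6 - X ^ 4 - 21 * X ^ 2 - 31 : Polynomial ℚ) ∧
    ∀ g : Polynomial ℚ, g.natDegree = 2 →
      Irreducible ((X ^ 6 - X ^ 4 - 21 * X ^ 2 - 31 : Polynomial ℚ).comp g) := by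
  refine ⟨irreducible_sextic, fun g hg => ?_⟩
  obtain ⟨a, b, c, ha, rfl⟩ : ∃ a b c : ℚ, a ≠ 0 ∧ g = C a * X ^ 2 + C b * X + C c := by
    refine ⟨g.coeff 2, g.coeff 1, g.coeff 0, ?_, ?_⟩
    · rw [← hg, coeff_natDegree, leadingCoeff_ne_zero]
      rintro rfl
      simp at hg
    · exact eq_quadratic_of_degree_le_two (natDegree_le_iff_degree_le.1 hg.le)
  have h := irreducible_comp_C_mul_X_add_C (irreducible_sextic_comp ha (c - b ^ 2 / (4 * a)))
    one_ne_zero (b / (2 * a))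
  have hg : (C a * X ^ 2 + C (c - b ^ 2 / (4 * a))).comp (C 1 * X + C (b / (2 * a))) =
      C a * X ^ 2 + C b * X + C c := by
    refine Polynomial.funext fun x => ?_
    simp only [eval_comp, eval_add, eval_mul, eval_C, eval_pow, eval_X]
    field_simp
    ring
  rwa [comp_assoc, hg] at h
end
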